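/- arXiv:0804.4883 — 10 statements merged into one kernel-verified Lean document; each statement's English description precedes it below -/
import Mathlib

section
/- Let P > 0 and let f : ℝ → ℝ be twice continuously differentiable with f''(x) = f(x)² − P for all x ∈ ℝ. If f is bounded, then for every x ∈ ℝ one has H(f(x), f'(x)) ≥ 0 and f(x) ≤ √P. -/
open Set Filter

/-- The second derivative is nonpositive at a local maximum. -/
theorem IsLocalMax.deriv_deriv_nonpos {h : ℝ → ℝ} {y : ℝ} (hmax : IsLocalMax h y)
    (hc : ContinuousAt h y) : deriv (deriv h) y ≤ 0 := by
  by_contra! hpos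
  have hmin := isLocalMin_of_deriv_deriv_pos hpos hmax.deriv_eq_zero hc
  have hconst : h =ᶠ[nhds y] fun _ => h y := by
    filter_upwards [hmax, hmin] with x h₁ h₂ using le_antisymm h₁ h₂
  have := hconst.deriv.deriv_eq
  simp at this
  linarith

/-- A function bounded above, penalized by a small parabola centred at `a`, attains its maximum;
this gives a point where the derivative is small and the second derivative almost nonpositive. -/
theorem exists_almost_critical_point {f : ℝ → ℝ} (hf : Differentiable ℝ f)
    (hf' : Differentiable ℝ (deriv f)) {C : ℝ} (hC : ∀ x, |f x| ≤ C) (a : ℝ) {ε : ℝ}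
    (hε : 0 < ε) :
    ∃ y, f a ≤ f y ∧ deriv f y ^ 2 ≤ 8 * C * ε ∧ deriv (deriv f) y ≤ 2 * ε := by
  set h : ℝ → ℝ := fun x => f x - ε * (x - a) ^ 2 with hh
  have hcont : Continuous h := by
    have := hf.continuous
    fun_prop
  have hlarge : ∀ᶠ x in cocompact ℝ, h x ≤ h a := by
    filter_upwards [(tendsto_dist_right_cocompact_atTop a).eventually_ge_atTop
      (max 1 (2 * C / ε))] with x hx
    rw [Real.dist_eq, max_le_iff, div_le_iff₀ hε] at hx
    have h₁ := abs_le.1 (hC x)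
    have h₂ := abs_le.1 (hC a)
    have h₃ : |x - a| ≤ (x - a) ^ 2 := by
      rw [← sq_abs]
      nlinarith [hx.1]
    have h₄ := mul_le_mul_of_nonneg_right h₃ hε.le
    simp only [hh, sub_self]
    nlinarith [hx.2]
  obtain ⟨y, hy⟩ := hcont.exists_forall_ge' a hlarge
  have hmax : IsLocalMax h y := Eventually.of_forall hy
  have hd (x : ℝ) : HasDerivAt h (deriv f x - ε * (2 * (x - a))) x := by
    exact ((hf x).hasDerivAt.sub
      ((((hasDerivAt_id x).sub_const a).pow 2).const_mul ε)).congr_deriv (by simp)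
  have hderiv : deriv h = fun x => deriv f x - ε * (2 * (x - a)) := funext fun x => (hd x).deriv
  have hdd : deriv (deriv h) y = deriv (deriv f) y - ε * 2 := by
    rw [hderiv]
    exact (((hf' y).hasDerivAt.sub
      ((((hasDerivAt_id y).sub_const a).const_mul 2).const_mul ε)).congr_deriv (by simp)).deriv
  have hcrit := hmax.deriv_eq_zero
  rw [(hd y).deriv] at hcrit
  have hnonpos := hmax.deriv_deriv_nonpos hcont.continuousAt
  have hya := hy a
  simp only [hh, sub_self] at hya
  have h₁ := abs_le.1 (hC y)
  have h₂ := abs_le.1 (hC a)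
  refine ⟨y, by nlinarith [mul_nonneg hε.le (sq_nonneg (y - a))], ?_, by linarith⟩
  have hsq : ε * (y - a) ^ 2 ≤ 2 * C := by linarith
  rw [sub_eq_zero.1 hcrit]
  nlinarith [mul_le_mul_of_nonneg_left hsq hε.le]

/-- The Hamiltonian is conserved along solutions of `f'' = f² - P`. -/
theorem hamiltonian_eq {P : ℝ} {f : ℝ → ℝ} (hf : Differentiable ℝ f)
    (hf' : Differentiable ℝ (deriv f)) (heq : ∀ x, deriv (deriv f) x = f x ^ 2 - P) (x y : ℝ) :
    (1/3) * f x ^ 3 - (1/2) * deriv f x ^ 2 - f x * P =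
      (1/3) * f y ^ 3 - (1/2) * deriv f y ^ 2 - f y * P := by
  have hd (z : ℝ) : HasDerivAt
      (fun z => (1/3) * f z ^ 3 - (1/2) * deriv f z ^ 2 - f z * P) 0 z := by
    have h₁ := (hf z).hasDerivAt
    have h₂ := (hf' z).hasDerivAt
    rw [heq] at h₂
    refine ((((h₁.pow 3).const_mul (1/3)).sub ((h₂.pow 2).const_mul (1/2))).sub
      (h₁.mul_const P)).congr_deriv ?_
    norm_num
    ring
  exact is_const_of_deriv_eq_zero (fun z => (hd z).differentiableAt) (fun z => (hd z).deriv) x y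

/-- For `P > 0`, any bounded twice continuously differentiable solution of
`f'' = f² − P` on `ℝ` satisfies `H(f(x), f'(x)) ≥ 0` and `f(x) ≤ √P` for all `x`, where
`H(f,g) = (1/3)f³ − (1/2)g² − f·P + (2/3)P^{3/2}`. -/
theorem stmt5 (P : ℝ) (hP : 0 < P) (f : ℝ → ℝ)
    (hf : ContDiff ℝ 2 f)
    (heq : ∀ x : ℝ, deriv (deriv f) x = f x ^ 2 - P)
    (hbd : ∃ C : ℝ, ∀ x : ℝ, |f x| ≤ C) :
    ∀ x : ℝ,
      0 ≤ (1/3) * f x ^ 3 - (1/2) * (deriv f x) ^ 2 - f x * P + (2/3) * Real.sqrt P ^ 3 ∧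
      f x ≤ Real.sqrt P := by
  obtain ⟨C, hC⟩ := hbd
  intro x
  have hf₁ : Differentiable ℝ f := hf.differentiable (by norm_num)
  have hf₂ : Differentiable ℝ (deriv f) :=
    (contDiff_succ_iff_deriv.1 (show ContDiff ℝ (1 + 1) f by
      rwa [one_add_one_eq_two])).2.2.differentiable (by norm_num)
  have hs : 0 < √P := Real.sqrt_pos.2 hP
  have hsP : √P ^ 2 = P := Real.sq_sqrt hP.le
  have hC₀ : 0 ≤ C := (abs_nonneg _).trans (hC 0)
  constructor
  · refine le_of_forall_pos_le_add fun δ hδ => ?_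
    set ε := min P (δ / (4 * C + 1)) with hε_def
    have hε : 0 < ε := lt_min hP (by positivity)
    have hεδ : ε * (4 * C + 1) ≤ δ := (le_div_iff₀ (by positivity)).1 (min_le_right _ _)
    obtain ⟨y, -, hy₁, hy₂⟩ := exists_almost_critical_point hf₁ hf₂ hC x hε
    rw [heq] at hy₂
    have hεP : ε ≤ P := min_le_left _ _
    have hlow : -(2 * √P) ≤ f y := (abs_le_of_sq_le_sq' (by nlinarith) (by positivity)).1
    have hpot : 0 ≤ (f y - √P) ^ 2 * (f y + 2 * √P) := mul_nonneg (sq_nonneg _) (by linarith)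
    have hfac : (f y - √P) ^ 2 * (f y + 2 * √P) = f y ^ 3 - 3 * f y * P + 2 * √P ^ 3 := by
      linear_combination (-3 * f y) * hsP
    rw [hamiltonian_eq hf₁ hf₂ heq x y]
    nlinarith
  · by_contra! hlt
    have hgap : 0 < f x ^ 2 - P := by nlinarith
    obtain ⟨y, hxy, -, hy⟩ :=
      exists_almost_critical_point hf₁ hf₂ hC x (show 0 < (f x ^ 2 - P) / 4 by positivity)
    rw [heq] at hy
    nlinarith
end

section
/- Let P ≥ 0, let b ∈ (0,∞], and let f : [0,b) → ℝ be twice continuously differentiable with f''(x) = f(x)² − P for all x ∈ [0,b), f(0) > √P, and f'(0) > 0. If f admits no extension to a twice continuously differentiable solution of the same equation on a strictly larger interval [0,b') with b' > b, then b < ∞ and f(x) → +∞ as x → b from the left. -/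
open Set Filter

open Topology in
/-- Gluing two differentiable functions at a point where the values and the derivatives match. -/
theorem hasDerivWithinAt_ite_lt {B C : ℝ} (hB : 0 < B) {u du v dv : ℝ → ℝ}
    (hu : ∀ x ∈ Ico 0 B, HasDerivWithinAt u (du x) (Ico 0 B) x)
    (hv : ∀ x ∈ Ico B C, HasDerivAt v (dv x) x)
    (hlim : Tendsto u (𝓝[<] B) (𝓝 (v B))) (hdlim : Tendsto du (𝓝[<] B) (𝓝 (dv B)))
    {x : ℝ} (hx : x ∈ Ico 0 C) :
    HasDerivWithinAt (fun y => if y < B then u y else v y)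
      (if x < B then du x else dv x) (Ico 0 C) x := by
  rcases lt_trichotomy x B with h | rfl | h
  · rw [if_pos h]
    have h1 : HasDerivWithinAt (fun y => if y < B then u y else v y) (du x) (Ico 0 B) x :=
      (hu x ⟨hx.1, h⟩).congr (fun y hy => if_pos hy.2) (if_pos h)
    refine h1.mono_of_mem_nhdsWithin ?_
    filter_upwards [self_mem_nhdsWithin, mem_nhdsWithin_of_mem_nhds (Iio_mem_nhds h)] with y h2 h3
    exact ⟨h2.1, h3⟩
  · rw [if_neg (lt_irrefl x)]
    have hd : ∀ y ∈ Ioo 0 x, HasDerivAt (fun y => if y < x then u y else v y) (du y) y := by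
      intro y hy
      refine ((hu y ⟨hy.1.le, hy.2⟩).hasDerivAt (Ico_mem_nhds hy.1 hy.2)).congr_of_eventuallyEq ?_
      filter_upwards [Iio_mem_nhds hy.2] with z hz
      exact if_pos hz
    have hmem : Ioo 0 x ∈ 𝓝[<] x := Ioo_mem_nhdsLT hB
    have hleft : HasDerivWithinAt (fun y => if y < x then u y else v y) (dv x) (Iic x) x := by
      refine hasDerivWithinAt_Iic_of_tendsto_deriv (s := Ioo 0 x)
        (fun y hy => (hd y hy).differentiableAt.differentiableWithinAt) ?_ hmem ?_
      · have : Tendsto (fun y => if y < x then u y else v y) (𝓝[<] x) (𝓝 (v x)) := by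
          refine hlim.congr' ?_
          filter_upwards [self_mem_nhdsWithin] with y hy
          exact (if_pos hy).symm
        have h2 := this.mono_left (nhdsWithin_mono x (fun y (hy : y ∈ Ioo 0 x) => hy.2))
        simpa [ContinuousWithinAt] using h2
      · refine hdlim.congr' ?_
        filter_upwards [hmem] with y hy
        exact (hd y hy).deriv.symm
    have hright : HasDerivWithinAt (fun y => if y < x then u y else v y) (dv x) (Ici x) x :=
      (hv x ⟨le_rfl, hx.2⟩).hasDerivWithinAt.congr (fun y hy => if_neg (not_lt.2 hy))
        (if_neg (lt_irrefl x))
    have := hleft.union hright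
    rw [Iic_union_Ici] at this
    exact this.mono (subset_univ _)
  · rw [if_neg h.not_gt]
    refine ((hv x ⟨h.le, hx.2⟩).congr_of_eventuallyEq ?_).hasDerivWithinAt
    filter_upwards [Ioi_mem_nhds h] with y hy
    exact if_neg (not_lt.2 (le_of_lt hy))

theorem monotoneOn_Icc_of_hasDerivWithinAt_Ico {B t : ℝ} (ht : t < B) {u du : ℝ → ℝ}
    (hu : ∀ x ∈ Ico 0 B, HasDerivWithinAt u (du x) (Ico 0 B) x)
    (hdu : ∀ x ∈ Ioo 0 t, 0 ≤ du x) : MonotoneOn u (Icc 0 t) := by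
  have hsub : Icc 0 t ⊆ Ico 0 B := fun x hx => ⟨hx.1, hx.2.trans_lt ht⟩
  refine monotoneOn_of_hasDerivWithinAt_nonneg (convex_Icc 0 t) (f' := du)
    (fun x hx => ((hu x (hsub hx)).mono hsub).continuousWithinAt) ?_ ?_
  · intro x hx
    exact (hu x (hsub (interior_subset hx))).mono (interior_subset.trans hsub)
  · intro x hx
    rw [interior_Icc] at hx
    exact hdu x hx

/-- A solution of `f'' = f² - P` starting increasingly above `√P` stays above its initial value,
with derivative above its initial derivative. -/
theorem le_of_hasDerivWithinAt_sq_sub {P B : ℝ} {f f' : ℝ → ℝ}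
    (hf : ∀ x ∈ Ico 0 B, HasDerivWithinAt f (f' x) (Ico 0 B) x)
    (hf' : ∀ x ∈ Ico 0 B, HasDerivWithinAt f' (f x ^ 2 - P) (Ico 0 B) x)
    (h0 : Real.sqrt P < f 0) (h0' : 0 < f' 0) {x : ℝ} (hx : x ∈ Ico 0 B) :
    f 0 ≤ f x ∧ f' 0 ≤ f' x := by
  have hf0 : 0 < f 0 := (Real.sqrt_nonneg P).trans_lt h0
  have hP : P < f 0 ^ 2 := (Real.sqrt_lt' hf0).1 h0
  have key : ∀ t ∈ Ico 0 B, (∀ y ∈ Ioo 0 t, 0 ≤ f' y) → f 0 ≤ f t ∧ f' 0 ≤ f' t := by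
    intro t ht hpos
    have hm := monotoneOn_Icc_of_hasDerivWithinAt_Ico ht.2 hf hpos
    have hge : ∀ y ∈ Icc 0 t, f 0 ≤ f y := fun y hy => hm ⟨le_rfl, ht.1⟩ hy hy.1
    have hm' := monotoneOn_Icc_of_hasDerivWithinAt_Ico ht.2 hf' (fun y hy => by
      have := hge y ⟨hy.1.le, hy.2.le⟩
      nlinarith)
    exact ⟨hge t ⟨ht.1, le_rfl⟩, hm' ⟨le_rfl, ht.1⟩ ⟨ht.1, le_rfl⟩ ht.1⟩
  refine key x hx ?_
  by_contra! hcon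
  obtain ⟨y, hy, hy'⟩ := hcon
  have hsub : Icc 0 y ⊆ Ico 0 B := fun z hz => ⟨hz.1, hz.2.trans_lt (hy.2.trans hx.2)⟩
  have hcont : ContinuousOn f' (Icc 0 y) :=
    fun z hz => ((hf' z (hsub hz)).mono hsub).continuousWithinAt
  have hcomp : IsCompact (Icc 0 y ∩ f' ⁻¹' Iic 0) :=
    isCompact_Icc.of_isClosed_subset (hcont.preimage_isClosed_of_isClosed isClosed_Icc isClosed_Iic)
      inter_subset_left
  obtain ⟨t, ⟨ht, ht'⟩, hmin⟩ := hcomp.exists_isLeast ⟨y, ⟨hy.1.le, le_rfl⟩, hy'.le⟩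
  have hle := (key t (hsub ht) (fun z hz => by
    by_contra! hz'
    exact (hmin ⟨⟨hz.1.le, hz.2.le.trans ht.2⟩, hz'.le⟩).not_gt hz.2)).2
  have : f' t ≤ 0 := ht'
  linarith

/-- An increasing solution of `f'' = f² - P` with derivative bounded below by a positive constant
cannot exist on a half-line. -/
theorem not_hasDerivAt_sq_sub_of_pos {P m : ℝ} (hP : 0 ≤ P) (hm : 0 < m) {f f' : ℝ → ℝ}
    (hf : ∀ x, 0 < x → HasDerivAt f (f' x) x)
    (hf' : ∀ x, 0 < x → HasDerivAt f' (f x ^ 2 - P) x) (hpos : ∀ x, 0 < x → m ≤ f' x) :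
    False := by
  have mono : ∀ {a : ℝ} {u du : ℝ → ℝ}, 0 < a → (∀ x, a ≤ x → HasDerivAt u (du x) x) →
      (∀ x, a ≤ x → 0 ≤ du x) → MonotoneOn u (Ici a) := by
    intro a u du _ h1 h2
    refine monotoneOn_of_hasDerivWithinAt_nonneg (convex_Ici a) (f' := du)
      (fun x hx => (h1 x hx).continuousAt.continuousWithinAt)
      (fun x hx => (h1 x (interior_subset hx)).hasDerivWithinAt)
      (fun x hx => h2 x (interior_subset hx))
  have hlin : MonotoneOn (fun x => f x - m * x) (Ici 1) := by
    refine mono (du := fun x => f' x - m * 1) one_pos (fun x hx => ?_) (fun x hx => ?_)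
    · exact (hf x (by linarith)).sub ((hasDerivAt_id x).const_mul m)
    · have := hpos x (by linarith)
      linarith
  have hen : MonotoneOn (fun x => f' x ^ 2 / 2 - f x ^ 3 / 3 + P * f x) (Ici 1) := by
    refine mono (du := fun _ => 0) one_pos (fun x hx => ?_) (fun x hx => le_rfl)
    have h1 := hf x (by linarith)
    have h2 := hf' x (by linarith)
    refine ((((h2.pow 2).div_const 2).sub ((h1.pow 3).div_const 3)).add
      (h1.const_mul P)).congr_deriv ?_
    norm_num
    ring
  set E := |f' 1 ^ 2 / 2 - f 1 ^ 3 / 3 + P * f 1| with hE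
  have hE0 : 0 ≤ E := abs_nonneg _
  set M := 1 + 12 * P + 12 * E with hM
  obtain ⟨X, hX1, hX⟩ : ∃ X : ℝ, 1 ≤ X ∧ ∀ x, X ≤ x → M ≤ f x := by
    refine ⟨1 + |M - f 1| / m, by have := div_nonneg (abs_nonneg (M - f 1)) hm.le; linarith,
      fun x hx => ?_⟩
    have h1 : |M - f 1| / m ≤ x - 1 := by linarith
    have h3 : 1 ≤ x := by
      have := div_nonneg (abs_nonneg (M - f 1)) hm.le
      linarith
    rw [div_le_iff₀ hm] at h1
    have h2 : f 1 - m * 1 ≤ f x - m * x := hlin (mem_Ici.2 le_rfl) (mem_Ici.2 h3) h3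
    have := le_abs_self (M - f 1)
    nlinarith
  have hfpos : ∀ x, X ≤ x → 0 < f x := fun x hx => by
    have := hX x hx
    linarith
  have hgrow : ∀ x, X ≤ x → f x * Real.sqrt (f x) / 2 ≤ f' x := by
    intro x hx
    have h1 : 1 ≤ x := hX1.trans hx
    have h2 : f' 1 ^ 2 / 2 - f 1 ^ 3 / 3 + P * f 1 ≤ f' x ^ 2 / 2 - f x ^ 3 / 3 + P * f x :=
      hen (mem_Ici.2 le_rfl) (mem_Ici.2 h1) h1
    have h3 := neg_abs_le (f' 1 ^ 2 / 2 - f 1 ^ 3 / 3 + P * f 1)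
    rw [← hE] at h3
    have h4 := hX x hx
    have h5 := hfpos x hx
    have h6 : f x * f x ≤ f x ^ 3 := by nlinarith [mul_pos h5 h5]
    have h7 : f x ≤ f x * f x := by nlinarith
    have h8 : 12 * (P * f x) ≤ f x * f x := by nlinarith
    have h9 : f x ^ 3 / 4 ≤ f' x ^ 2 := by nlinarith
    refine le_of_sq_le_sq ?_ (hm.le.trans (hpos x (by linarith)))
    have h10 : (f x * Real.sqrt (f x) / 2) ^ 2 = f x ^ 3 / 4 := by
      rw [div_pow, mul_pow, Real.sq_sqrt h5.le]
      ring
    rw [h10]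
    exact h9
  have hu : MonotoneOn (fun x => -(Real.sqrt (f x))⁻¹ - 1 / 4 * x) (Ici X) := by
    refine mono (du := fun x => -(-(f' x / (2 * Real.sqrt (f x))) / Real.sqrt (f x) ^ 2)
      - 1 / 4 * 1) (by linarith) (fun x hx => ?_) (fun x hx => ?_)
    · have h5 := hfpos x hx
      exact (((hf x (by linarith)).sqrt h5.ne').fun_inv (Real.sqrt_pos.2 h5).ne').neg.sub
        ((hasDerivAt_id x).const_mul (1 / 4))
    · have h5 := hfpos x hx
      have h6 := Real.sqrt_pos.2 h5
      have h7 := hgrow x hx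
      rw [Real.sq_sqrt h5.le, neg_div, neg_neg, div_div, sub_nonneg, le_div_iff₀ (by positivity)]
      linarith
  set s := (Real.sqrt (f X))⁻¹ with hs
  have hs0 : 0 ≤ s := by positivity
  have hle : X ≤ X + 4 * s + 1 := by linarith
  have h1 : -s - 1 / 4 * X ≤ -(Real.sqrt (f (X + 4 * s + 1)))⁻¹ - 1 / 4 * (X + 4 * s + 1) :=
    hu (mem_Ici.2 le_rfl) (mem_Ici.2 hle) hle
  have h2 : 0 ≤ (Real.sqrt (f (X + 4 * s + 1)))⁻¹ := by positivity
  linarith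

open Topology in
/-- A solution of `f'' = f² - P` on `[0, B)` for which `f` and `f'` have limits at `B` extends
past `B`. -/
theorem exists_extension_of_tendsto {P B L L' : ℝ} (hB : 0 < B) {f f' : ℝ → ℝ}
    (hf : ∀ x ∈ Ico 0 B, HasDerivWithinAt f (f' x) (Ico 0 B) x)
    (hf' : ∀ x ∈ Ico 0 B, HasDerivWithinAt f' (f x ^ 2 - P) (Ico 0 B) x)
    (hL : Tendsto f (𝓝[<] B) (𝓝 L)) (hL' : Tendsto f' (𝓝[<] B) (𝓝 L')) :
    ∃ C > B, ∃ g g' : ℝ → ℝ, (∀ x < B, g x = f x) ∧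
      ∀ x ∈ Ico 0 C, HasDerivWithinAt g (g' x) (Ico 0 C) x ∧
        HasDerivWithinAt g' (g x ^ 2 - P) (Ico 0 C) x := by
  have hsmooth : ContDiffAt ℝ 1 (fun p : ℝ × ℝ => (p.2, p.1 ^ 2 - P)) (L, L') := by fun_prop
  obtain ⟨α, hα, ε, hε, hd⟩ :=
    hsmooth.exists_forall_mem_closedBall_exists_eq_forall_mem_Ioo_hasDerivAt₀ B
  have hd1 : ∀ x ∈ Ico B (B + ε), HasDerivAt (fun t => (α t).1) (α x).2 x := fun x hx =>
    (hd x ⟨by linarith [hx.1], hx.2⟩).fst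
  have hd2 : ∀ x ∈ Ico B (B + ε), HasDerivAt (fun t => (α t).2) ((α x).1 ^ 2 - P) x := fun x hx =>
    (hd x ⟨by linarith [hx.1], hx.2⟩).snd
  refine ⟨B + ε, by linarith, fun y => if y < B then f y else (α y).1,
    fun y => if y < B then f' y else (α y).2, fun x hx => if_pos hx, fun x hx => ⟨?_, ?_⟩⟩
  · exact hasDerivWithinAt_ite_lt (dv := fun x => (α x).2) hB hf hd1 (by simpa [hα] using hL)
      (by simpa [hα] using hL') hx
  · have h := hasDerivWithinAt_ite_lt (dv := fun x => (α x).1 ^ 2 - P) hB hf' hd2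
      (by simpa [hα] using hL') (by simpa [hα] using (hL.pow 2).sub_const P) hx
    convert h using 1
    split_ifs with hxB <;> simp [hxB]



/-- Let `P ≥ 0`, `b ∈ (0,∞]` (modelled as `b : EReal`), and let `f` be a
twice continuously differentiable solution of `f'' = f² − P` on `[0,b)` with
`f(0) > √P` and `f'(0) > 0`.  If `f` admits no extension to a solution on a strictly
larger interval `[0,b')`, then `b < ∞` and `f(x) → +∞` as `x → b⁻`. -/
theorem stmt6 (P : ℝ) (hP : 0 ≤ P) (b : EReal) (hb : 0 < b)
    (f f' : ℝ → ℝ)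
    (hf : ∀ x : ℝ, 0 ≤ x → (x : EReal) < b →
      HasDerivWithinAt f (f' x) {y : ℝ | 0 ≤ y ∧ (y : EReal) < b} x)
    (hf' : ∀ x : ℝ, 0 ≤ x → (x : EReal) < b →
      HasDerivWithinAt f' (f x ^ 2 - P) {y : ℝ | 0 ≤ y ∧ (y : EReal) < b} x)
    (h0 : Real.sqrt P < f 0) (h0' : 0 < f' 0)
    (hmax : ¬ ∃ (b' : EReal) (g g' : ℝ → ℝ), b < b' ∧
      (∀ x : ℝ, 0 ≤ x → (x : EReal) < b → g x = f x) ∧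
      (∀ x : ℝ, 0 ≤ x → (x : EReal) < b' →
        HasDerivWithinAt g (g' x) {y : ℝ | 0 ≤ y ∧ (y : EReal) < b'} x ∧
        HasDerivWithinAt g' (g x ^ 2 - P) {y : ℝ | 0 ≤ y ∧ (y : EReal) < b'} x)) :
    ∃ B : ℝ, b = (B : EReal) ∧ Tendsto f (nhdsWithin B (Iio B)) atTop := by
  induction b using EReal.rec with
  | bot => exact absurd hb (by simp)
  | top =>
    exfalso
    simp only [EReal.coe_lt_top, and_true, forall_const] at hf hf'
    have hIci : {y : ℝ | 0 ≤ y} = Ici 0 := rfl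
    rw [hIci] at hf hf'
    refine not_hasDerivAt_sq_sub_of_pos hP h0'
      (fun x hx => (hf x hx.le).hasDerivAt (Ici_mem_nhds hx))
      (fun x hx => (hf' x hx.le).hasDerivAt (Ici_mem_nhds hx)) (fun x hx => ?_)
    exact (le_of_hasDerivWithinAt_sq_sub (B := x + 1)
      (fun y hy => (hf y hy.1).mono Ico_subset_Ici_self)
      (fun y hy => (hf' y hy.1).mono Ico_subset_Ici_self) h0 h0' ⟨hx.le, by linarith⟩).2
  | coe B =>
    refine ⟨B, rfl, ?_⟩
    have hset : ∀ C : ℝ, {y : ℝ | 0 ≤ y ∧ (y : EReal) < (C : EReal)} = Ico 0 C := fun C => by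
      ext y
      simp
    have hB : 0 < B := by exact_mod_cast hb
    rw [hset] at hf hf'
    replace hf : ∀ x ∈ Ico 0 B, HasDerivWithinAt f (f' x) (Ico 0 B) x :=
      fun x hx => hf x hx.1 (by exact_mod_cast hx.2)
    replace hf' : ∀ x ∈ Ico 0 B, HasDerivWithinAt f' (f x ^ 2 - P) (Ico 0 B) x :=
      fun x hx => hf' x hx.1 (by exact_mod_cast hx.2)
    have hge : ∀ x ∈ Ico 0 B, f 0 ≤ f x ∧ f' 0 ≤ f' x :=
      fun x hx => le_of_hasDerivWithinAt_sq_sub hf hf' h0 h0' hx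
    have hf0 : 0 < f 0 := (Real.sqrt_nonneg P).trans_lt h0
    have hPf : P < f 0 ^ 2 := (Real.sqrt_lt' hf0).1 h0
    have hmono : ∀ u du : ℝ → ℝ, (∀ x ∈ Ico 0 B, HasDerivWithinAt u (du x) (Ico 0 B) x) →
        (∀ x ∈ Ico 0 B, 0 ≤ du x) → MonotoneOn u (Ico 0 B) := fun u du h1 h2 x hx y hy hxy =>
      monotoneOn_Icc_of_hasDerivWithinAt_Ico hy.2 h1
        (fun z hz => h2 z ⟨hz.1.le, hz.2.trans hy.2⟩) ⟨hx.1, hxy⟩ ⟨hy.1, le_rfl⟩ hxy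
    have hfm : MonotoneOn f (Ico 0 B) := hmono f f' hf (fun x hx => by linarith [(hge x hx).2])
    have hfm' : MonotoneOn f' (Ico 0 B) := hmono f' _ hf' (fun x hx => by nlinarith [(hge x hx).1])
    by_cases hbdd : ∃ M, ∀ x ∈ Ico 0 B, f x ≤ M
    · exfalso
      obtain ⟨M, hM⟩ := hbdd
      have hgm : MonotoneOn (fun x => (M ^ 2 - P) * x - f' x) (Ico 0 B) := by
        refine hmono _ (fun x => (M ^ 2 - P) * 1 - (f x ^ 2 - P)) (fun x hx => ?_) (fun x hx => ?_)
        · exact ((hasDerivWithinAt_id x _).const_mul _).sub (hf' x hx)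
        · nlinarith [(hge x hx).1, hM x hx]
      have hM' : ∀ x ∈ Ico 0 B, f' x ≤ f' 0 + (M ^ 2 - P) * B := fun x hx => by
        have h1 : (M ^ 2 - P) * 0 - f' 0 ≤ (M ^ 2 - P) * x - f' x := hgm ⟨le_rfl, hB⟩ hx hx.1
        have h2 : 0 ≤ M ^ 2 - P := by nlinarith [(hge x hx).1, hM x hx]
        nlinarith [hx.2]
      have hne : (Ioo 0 B).Nonempty := nonempty_Ioo.2 hB
      have hL := (hfm.mono Ioo_subset_Ico_self).tendsto_nhdsWithin_Ioo_left hne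
        ⟨M, by rintro _ ⟨x, hx, rfl⟩; exact hM x (Ioo_subset_Ico_self hx)⟩
      have hL' := (hfm'.mono Ioo_subset_Ico_self).tendsto_nhdsWithin_Ioo_left hne
        ⟨_, by rintro _ ⟨x, hx, rfl⟩; exact hM' x (Ioo_subset_Ico_self hx)⟩
      obtain ⟨C, hC, g, g', hg, hgd⟩ := exists_extension_of_tendsto hB hf hf' hL hL'
      refine hmax ⟨C, g, g', by exact_mod_cast hC, fun x _ hx => hg x (by exact_mod_cast hx),
        fun x hx hxC => ?_⟩
      rw [hset]
      exact hgd x ⟨hx, by exact_mod_cast hxC⟩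
    · push Not at hbdd
      refine tendsto_atTop.2 fun M => ?_
      obtain ⟨x, hx, hxM⟩ := hbdd M
      filter_upwards [Ioo_mem_nhdsLT hx.2] with y hy
      exact hxM.le.trans (hfm hx ⟨hx.1.trans hy.1.le, hy.2⟩ hy.1.le)
end

section
/- If f : [0,∞) → ℝ is twice continuously differentiable and satisfies f''(x) = f(x)² − φ(x) for all x > 0, then f(x) → 0 as x → +∞. -/
open Set Filter

/-- Green's identity on an interval. -/
lemma integral_green {a b : ℝ} (hab : a ≤ b) {u u' u'' v v' v'' : ℝ → ℝ}
    (hu : ∀ x ∈ Icc a b, HasDerivAt u (u' x) x) (hu' : ∀ x ∈ Icc a b, HasDerivAt u' (u'' x) x)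
    (hu'' : ContinuousOn u'' (Icc a b))
    (hv : ∀ x, HasDerivAt v (v' x) x) (hv' : ∀ x, HasDerivAt v' (v'' x) x)
    (hv'' : Continuous v'') :
    ∫ x in a..b, (u'' x * v x - u x * v'' x) =
      (u' b * v b - u b * v' b) - (u' a * v a - u a * v' a) := by
  have cu : ContinuousOn u (Icc a b) := fun x hx => (hu x hx).continuousAt.continuousWithinAt
  have cv : Continuous v := continuous_iff_continuousAt.2 fun x => (hv x).continuousAt
  refine intervalIntegral.integral_eq_sub_of_hasDerivAt
    (f := fun x => u' x * v x - u x * v' x) ?_ ?_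
  · intro x hx
    rw [uIcc_of_le hab] at hx
    refine HasDerivAt.congr_deriv (((hu' x hx).mul (hv x)).sub ((hu x hx).mul (hv' x))) ?_
    ring
  · apply ContinuousOn.intervalIntegrable
    rw [uIcc_of_le hab]
    exact (hu''.mul cv.continuousOn).sub (cu.mul hv''.continuousOn)

/-- A test function estimate: if `u'' ≥ u² - η` on a window of radius `R`, then `u²` has small
integral over a unit interval at its centre. -/
lemma integral_sq_le_of_sq_sub_le {c R η : ℝ} (hR : 2 ≤ R) (hη : 0 ≤ η) {u u' u'' : ℝ → ℝ}
    (hu : ∀ x ∈ Icc (c - R) (c + R), HasDerivAt u (u' x) x)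
    (hu' : ∀ x ∈ Icc (c - R) (c + R), HasDerivAt u' (u'' x) x)
    (hu'' : ContinuousOn u'' (Icc (c - R) (c + R)))
    (h : ∀ x ∈ Icc (c - R) (c + R), u x ^ 2 - η ≤ u'' x) :
    ∫ x in c..c + 1, u x ^ 2 ≤ 64 * R * (η + 1152 / R ^ 4) := by
  have hab : c - R ≤ c + R := by linarith
  have cu : ContinuousOn u (Icc (c - R) (c + R)) :=
    fun x hx => (hu x hx).continuousAt.continuousWithinAt
  have hd : ∀ x, HasDerivAt (fun x : ℝ => R ^ 2 - (x - c) ^ 2) (-2 * (x - c)) x := by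
    intro x
    refine HasDerivAt.congr_deriv ((((hasDerivAt_id' x).sub_const c).pow 2).const_sub (R ^ 2)) ?_
    simp
  have hv : ∀ x, HasDerivAt (fun x : ℝ => (R ^ 2 - (x - c) ^ 2) ^ 4)
      (-8 * (x - c) * (R ^ 2 - (x - c) ^ 2) ^ 3) x := by
    intro x
    refine HasDerivAt.congr_deriv ((hd x).pow 4) ?_
    push_cast
    ring
  have hv' : ∀ x, HasDerivAt (fun x : ℝ => -8 * (x - c) * (R ^ 2 - (x - c) ^ 2) ^ 3)
      ((R ^ 2 - (x - c) ^ 2) ^ 2 * (-8 * R ^ 2 + 56 * (x - c) ^ 2)) x := by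
    intro x
    refine HasDerivAt.congr_deriv ((((hasDerivAt_id' x).sub_const c).const_mul (-8)).mul ((hd x).pow 3)) ?_
    simp
    ring
  have green := integral_green hab hu hu' hu'' hv hv' (by fun_prop)
  have cψ : Continuous fun x : ℝ => (R ^ 2 - (x - c) ^ 2) ^ 4 := by fun_prop
  have iψ : IntervalIntegrable (fun x => u x ^ 2 * (R ^ 2 - (x - c) ^ 2) ^ 4)
      MeasureTheory.volume (c - R) (c + R) := by
    apply ContinuousOn.intervalIntegrable
    rw [uIcc_of_le hab]
    exact (cu.pow 2).mul cψ.continuousOn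
  have lower : ∫ x in (c - R)..(c + R),
      (1 / 2 * (u x ^ 2 * (R ^ 2 - (x - c) ^ 2) ^ 4) - (η * R ^ 8 + 1152 * R ^ 4)) ≤
      ∫ x in (c - R)..(c + R), (u'' x * (R ^ 2 - (x - c) ^ 2) ^ 4 -
        u x * ((R ^ 2 - (x - c) ^ 2) ^ 2 * (-8 * R ^ 2 + 56 * (x - c) ^ 2))) := by
    refine intervalIntegral.integral_mono_on hab ((iψ.const_mul _).sub (by simp)) ?_ ?_
    · apply ContinuousOn.intervalIntegrable
      rw [uIcc_of_le hab]
      exact (hu''.mul cψ.continuousOn).sub (cu.mul (by fun_prop))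
    · intro x hx
      have hw : (x - c) ^ 2 ≤ R ^ 2 := sq_le_sq' (by linarith [hx.1]) (by linarith [hx.2])
      have hs := h x hx
      set s := (x - c) ^ 2
      have hs0 : 0 ≤ s := sq_nonneg _
      set p := R ^ 2 - s
      have hp0 : 0 ≤ p := sub_nonneg.2 hw
      have hp4 : p ^ 4 ≤ R ^ 8 := by
        calc p ^ 4 ≤ (R ^ 2) ^ 4 := by gcongr; linarith
          _ = R ^ 8 := by ring
      have h1 := mul_le_mul_of_nonneg_right hs (pow_nonneg hp0 4)
      have h2 := mul_le_mul_of_nonneg_left hp4 hη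
      have h3 : (-8 * R ^ 2 + 56 * s) ^ 2 ≤ (48 * R ^ 2) ^ 2 :=
        sq_le_sq' (by nlinarith) (by nlinarith)
      nlinarith [sq_nonneg (u x * p ^ 2 - (-8 * R ^ 2 + 56 * s))]
  have upper : ∫ x in (c - R)..(c + R), u x ^ 2 * (R ^ 2 - (x - c) ^ 2) ^ 4 ≤
      4 * R * (η * R ^ 8 + 1152 * R ^ 4) := by
    rw [green, intervalIntegral.integral_sub (iψ.const_mul _) (by simp),
      intervalIntegral.integral_const_mul, intervalIntegral.integral_const, smul_eq_mul] at lower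
    have hR' : c + R - (c - R) = 2 * R := by ring
    have hboundary : R ^ 2 - (c + R - c) ^ 2 = 0 ∧ R ^ 2 - (c - R - c) ^ 2 = 0 := by
      constructor <;> ring
    rw [hR', hboundary.1, hboundary.2] at lower
    linarith
  have hsub : Icc c (c + 1) ⊆ Icc (c - R) (c + R) := Icc_subset_Icc (by linarith) (by linarith)
  have restrict : ∫ x in c..c + 1, u x ^ 2 * (R ^ 8 / 16) ≤
      ∫ x in (c - R)..(c + R), u x ^ 2 * (R ^ 2 - (x - c) ^ 2) ^ 4 := by
    trans ∫ x in c..c + 1, u x ^ 2 * (R ^ 2 - (x - c) ^ 2) ^ 4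
    · refine intervalIntegral.integral_mono_on (by linarith) ?_ ?_ ?_
      · apply ContinuousOn.intervalIntegrable
        rw [uIcc_of_le (by linarith)]
        exact ((cu.mono hsub).pow 2).mul continuousOn_const
      · apply ContinuousOn.intervalIntegrable
        rw [uIcc_of_le (by linarith)]
        exact ((cu.mono hsub).pow 2).mul cψ.continuousOn
      · intro x hx
        have h1 : (x - c) ^ 2 ≤ 1 := by nlinarith [hx.1, hx.2]
        have h2 : R ^ 2 / 2 ≤ R ^ 2 - (x - c) ^ 2 := by nlinarith
        gcongr
        calc R ^ 8 / 16 = (R ^ 2 / 2) ^ 4 := by ring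
          _ ≤ _ := by gcongr
    · refine intervalIntegral.integral_mono_interval (by linarith) (by linarith) (by linarith)
        (Eventually.of_forall fun x => ?_) iψ
      change 0 ≤ u x ^ 2 * (R ^ 2 - (x - c) ^ 2) ^ 4
      positivity
  rw [intervalIntegral.integral_mul_const] at restrict
  have key := restrict.trans upper
  have hR0 : 0 < R := by linarith
  refine le_of_mul_le_mul_right (key.trans_eq ?_) (by positivity : 0 < R ^ 8 / 16)
  field_simp
  ring

/-- The value of `u` at the left endpoint of a unit interval is controlled by the integral of `u²`
when `u'' = u² + O(η)`. -/
lemma abs_le_integral_sq {c η K : ℝ} (hK : 0 < K) {u u' u'' : ℝ → ℝ}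
    (hu : ∀ x ∈ Icc c (c + 1), HasDerivAt u (u' x) x)
    (hu' : ∀ x ∈ Icc c (c + 1), HasDerivAt u' (u'' x) x)
    (hu'' : ContinuousOn u'' (Icc c (c + 1)))
    (h : ∀ x ∈ Icc c (c + 1), |u'' x| ≤ u x ^ 2 + η) :
    |u c| ≤ (K + 1) * (∫ x in c..c + 1, u x ^ 2) + (η + 9 / K) := by
  have hab : c ≤ c + 1 := by linarith
  have cu : ContinuousOn u (Icc c (c + 1)) :=
    fun x hx => (hu x hx).continuousAt.continuousWithinAt
  have hd : ∀ x, HasDerivAt (fun x : ℝ => x - c) 1 x := fun x => (hasDerivAt_id' x).sub_const c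
  have hv : ∀ x, HasDerivAt (fun x : ℝ => (x - c) * (1 - (x - c)) ^ 2)
      (1 - 4 * (x - c) + 3 * (x - c) ^ 2) x := by
    intro x
    refine HasDerivAt.congr_deriv ((hd x).mul (((hd x).const_sub 1).pow 2)) ?_
    simp
    ring
  have hv' : ∀ x, HasDerivAt (fun x : ℝ => 1 - 4 * (x - c) + 3 * (x - c) ^ 2)
      (-4 + 6 * (x - c)) x := by
    intro x
    refine HasDerivAt.congr_deriv ((((hd x).const_mul 4).const_sub 1).add (((hd x).pow 2).const_mul 3)) ?_
    simp
    ring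
  have green := integral_green hab hu hu' hu'' hv hv' (by fun_prop)
  have hval : u c = ∫ x in c..c + 1,
      (u'' x * ((x - c) * (1 - (x - c)) ^ 2) - u x * (-4 + 6 * (x - c))) := by
    rw [green]
    ring
  have isq : IntervalIntegrable (fun x => u x ^ 2) MeasureTheory.volume c (c + 1) := by
    apply ContinuousOn.intervalIntegrable
    rw [uIcc_of_le hab]
    exact cu.pow 2
  have bound : ‖∫ x in c..c + 1,
      (u'' x * ((x - c) * (1 - (x - c)) ^ 2) - u x * (-4 + 6 * (x - c)))‖ ≤
      ∫ x in c..c + 1, ((K + 1) * u x ^ 2 + (η + 9 / K)) := by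
    refine intervalIntegral.norm_integral_le_of_norm_le hab
      (Eventually.of_forall fun x hx => ?_) ((isq.const_mul _).add (by simp))
    have hx' := Ioc_subset_Icc_self hx
    have ht0 : 0 ≤ x - c := by linarith [hx'.1]
    have ht1 : x - c ≤ 1 := by linarith [hx'.2]
    have hθ : |(x - c) * (1 - (x - c)) ^ 2| ≤ 1 := by
      rw [abs_of_nonneg (by positivity)]
      exact mul_le_one₀ ht1 (sq_nonneg _) (pow_le_one₀ (by linarith) (by linarith))
    have hθ'' : |-4 + 6 * (x - c)| ≤ 6 := abs_le.2 ⟨by linarith, by linarith⟩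
    have young : |u x| * 6 ≤ K * u x ^ 2 + 9 / K := by
      rw [← sq_abs (u x), ← sub_nonneg]
      have : K * |u x| ^ 2 + 9 / K - |u x| * 6 = (K * |u x| - 3) ^ 2 / K := by
        field_simp
        ring
      rw [this]
      positivity
    calc ‖u'' x * ((x - c) * (1 - (x - c)) ^ 2) - u x * (-4 + 6 * (x - c))‖
        ≤ |u'' x| * |(x - c) * (1 - (x - c)) ^ 2| + |u x| * |-4 + 6 * (x - c)| := by
          rw [← abs_mul, ← abs_mul]
          exact norm_sub_le _ _
      _ ≤ |u'' x| * 1 + |u x| * 6 := by gcongr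
      _ ≤ (K + 1) * u x ^ 2 + (η + 9 / K) := by linarith [h x hx']
  rw [← hval, intervalIntegral.integral_add (isq.const_mul _) (by simp),
    intervalIntegral.integral_const_mul, intervalIntegral.integral_const, smul_eq_mul] at bound
  simpa using bound

/-- Let `φ` be smooth with `φ(x) → 0` as `x → +∞`.  If `f : [0,∞) → ℝ` is
twice continuously differentiable and satisfies `f'' = f² − φ` for all `x > 0`, then
`f(x) → 0` as `x → +∞`. -/
theorem stmt7 (φ : ℝ → ℝ) (hφ : ContDiff ℝ (⊤ : ℕ∞) φ)
    (hφ0 : Tendsto φ atTop (nhds 0))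
    (f f' f'' : ℝ → ℝ)
    (hf : ∀ x ∈ Ici (0:ℝ), HasDerivWithinAt f (f' x) (Ici 0) x)
    (hf' : ∀ x ∈ Ici (0:ℝ), HasDerivWithinAt f' (f'' x) (Ici 0) x)
    (hf''cont : ContinuousOn f'' (Ici 0))
    (heq : ∀ x : ℝ, 0 < x → f'' x = f x ^ 2 - φ x) :
    Tendsto f atTop (nhds 0) := by
  rw [Metric.tendsto_atTop]
  intro ε hε
  obtain ⟨K, hK, hKε⟩ : ∃ K : ℝ, 0 < K ∧ 9 / K = ε / 4 :=
    ⟨36 / ε, by positivity, by field_simp; norm_num⟩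
  obtain ⟨R, hR, hRε⟩ : ∃ R : ℝ, 2 ≤ R ∧ (K + 1) * (64 * R * (1152 / R ^ 4)) ≤ ε / 4 := by
    set A := (K + 1) * 64 * 1152 * 4 / ε with hA
    have hA0 : 0 < A := by positivity
    refine ⟨2 + A, by linarith, ?_⟩
    have h1 : (2 + A) ≤ (2 + A) ^ 3 := le_self_pow₀ (by linarith) (by norm_num)
    have h2 : (K + 1) * (64 * (2 + A) * (1152 / (2 + A) ^ 4)) = A * ε / 4 / (2 + A) ^ 3 := by
      have : A * ε = (K + 1) * 64 * 1152 * 4 := by rw [hA]; field_simp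
      rw [this]
      field_simp
    rw [h2, div_le_iff₀ (by positivity)]
    nlinarith
  have hR0 : 0 < R := by linarith
  obtain ⟨η, hη, hηε⟩ : ∃ η : ℝ, 0 < η ∧ (K + 1) * (64 * R * η) + η = ε / 4 :=
    ⟨ε / 4 / ((K + 1) * (64 * R) + 1), by positivity, by field_simp⟩
  obtain ⟨N, hN⟩ := Metric.tendsto_atTop.1 hφ0 η hη
  refine ⟨max N 0 + R + 1, fun c hc => ?_⟩
  have hpos : ∀ x ∈ Icc (c - R) (c + R), 0 < x := fun x hx => by
    linarith [hx.1, le_max_right N 0]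
  have hφη : ∀ x ∈ Icc (c - R) (c + R), |φ x| ≤ η := fun x hx => by
    simpa using (hN x (by linarith [hx.1, le_max_left N 0])).le
  have hu : ∀ x ∈ Icc (c - R) (c + R), HasDerivAt f (f' x) x := fun x hx =>
    (hf x (hpos x hx).le).hasDerivAt (Ici_mem_nhds (hpos x hx))
  have hu' : ∀ x ∈ Icc (c - R) (c + R), HasDerivAt f' (f'' x) x := fun x hx =>
    (hf' x (hpos x hx).le).hasDerivAt (Ici_mem_nhds (hpos x hx))
  have hu'' : ContinuousOn f'' (Icc (c - R) (c + R)) :=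
    hf''cont.mono fun x hx => (hpos x hx).le
  have hsub : Icc c (c + 1) ⊆ Icc (c - R) (c + R) := Icc_subset_Icc (by linarith) (by linarith)
  have hI := integral_sq_le_of_sq_sub_le hR hη.le hu hu' hu'' fun x hx => by
    rw [heq x (hpos x hx)]
    linarith [(abs_le.1 (hφη x hx)).2]
  have hfc := abs_le_integral_sq (η := η) hK (fun x hx => hu x (hsub hx))
    (fun x hx => hu' x (hsub hx)) (hu''.mono hsub) fun x hx => by
      rw [heq x (hpos x (hsub hx))]
      obtain ⟨h1, h2⟩ := abs_le.1 (hφη x (hsub hx))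
      exact abs_le.2 ⟨by linarith [sq_nonneg (f x)], by linarith⟩
  have hKI := mul_le_mul_of_nonneg_left hI (by positivity : 0 ≤ K + 1)
  rw [Real.dist_0_eq_abs]
  linarith
end

section
/- Let R > 0 and suppose A₀, A₁ ≥ 0 with A₁ ≤ 8R. Then for every real ρ with ρ > R, the series Σ_{k=0}^∞ A_k / ρᵏ converges. -/
open Finset

/-- The recursion propagates the bound `0 ≤ A k ≤ 8 R ^ k` from `k = 1` to all `k ≥ 1`. -/
theorem nonneg_and_le_eight_mul_pow {R : ℝ} (hR : 0 < R) {A : ℕ → ℝ} (hA1 : 0 ≤ A 1)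
    (hrec : ∀ k : ℕ, 2 ≤ k →
      A k = (∑ m ∈ Finset.Ico 1 k, A m * A (k - m)) / ((k : ℝ) ^ 2 + 5 * k - 6))
    (h8 : A 1 ≤ 8 * R) (k : ℕ) (hk : 1 ≤ k) : 0 ≤ A k ∧ A k ≤ 8 * R ^ k := by
  induction k using Nat.strong_induction_on with
  | _ k ih =>
    obtain rfl | hk2 := hk.eq_or_lt
    · simpa using ⟨hA1, h8⟩
    have hk2' : (2 : ℝ) ≤ k := by exact_mod_cast hk2
    have hden : 0 < (k : ℝ) ^ 2 + 5 * k - 6 := by nlinarith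
    rw [hrec k hk2]
    constructor
    · refine div_nonneg (Finset.sum_nonneg fun m hm => ?_) hden.le
      obtain ⟨hm1, hmk⟩ := Finset.mem_Ico.mp hm
      exact mul_nonneg (ih m hmk hm1).1 (ih (k - m) (by omega) (by omega)).1
    · rw [div_le_iff₀ hden]
      have hsum : ∑ m ∈ Finset.Ico 1 k, A m * A (k - m) ≤ ((k : ℝ) - 1) * (64 * R ^ k) := by
        calc ∑ m ∈ Finset.Ico 1 k, A m * A (k - m)
            ≤ ∑ _m ∈ Finset.Ico 1 k, 64 * R ^ k := Finset.sum_le_sum fun m hm => by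
              obtain ⟨hm1, hmk⟩ := Finset.mem_Ico.mp hm
              have hkm := ih (k - m) (by omega) (by omega)
              calc A m * A (k - m) ≤ (8 * R ^ m) * (8 * R ^ (k - m)) :=
                    mul_le_mul (ih m hmk hm1).2 hkm.2 hkm.1 (by positivity)
                _ = 64 * (R ^ m * R ^ (k - m)) := by ring
                _ = 64 * R ^ k := by rw [pow_mul_pow_sub R hmk.le]
          _ = ((k : ℝ) - 1) * (64 * R ^ k) := by simp [Nat.cast_sub hk]
      have hcoef : 64 * ((k : ℝ) - 1) ≤ 8 * ((k : ℝ) ^ 2 + 5 * k - 6) := by nlinarith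
      have := mul_le_mul_of_nonneg_right hcoef (pow_pos hR k).le
      linarith

/-- With `A₀, A₁ ≥ 0`, `A₁ ≤ 8R`, and `A_k` defined recursively by
`A_k = (Σ_{m=1}^{k−1} A_m A_{k−m}) / (k² + 5k − 6)` for `k ≥ 2`, the series
`Σ_{k=0}^∞ A_k / ρᵏ` converges for every `ρ > R`. -/
theorem stmt9 (R : ℝ) (hR : 0 < R) (A : ℕ → ℝ)
    (hA0 : 0 ≤ A 0) (hA1 : 0 ≤ A 1)
    (hrec : ∀ k : ℕ, 2 ≤ k →
      A k = (∑ m ∈ Finset.Ico 1 k, A m * A (k - m)) / ((k : ℝ) ^ 2 + 5 * k - 6))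
    (h8 : A 1 ≤ 8 * R) :
    ∀ ρ : ℝ, R < ρ → Summable (fun k : ℕ => A k / ρ ^ k) := by
  intro ρ hρ
  have hρ0 : 0 < ρ := hR.trans hρ
  have hbound := nonneg_and_le_eight_mul_pow hR hA1 hrec h8
  have hgeom : Summable fun k : ℕ => 8 * R * ((R / ρ) ^ k / ρ) :=
    ((summable_geometric_of_lt_one (by positivity)
      ((div_lt_one hρ0).mpr hρ)).div_const ρ).mul_left (8 * R)
  rw [← summable_nat_add_iff 1]
  refine hgeom.of_nonneg_of_le (fun k => ?_) (fun k => ?_)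
  · exact div_nonneg (hbound (k + 1) (by omega)).1 (by positivity)
  · calc A (k + 1) / ρ ^ (k + 1) ≤ 8 * R ^ (k + 1) / ρ ^ (k + 1) := by
          gcongr
          exact (hbound (k + 1) (by omega)).2
      _ = 8 * R * ((R / ρ) ^ k / ρ) := by
          rw [div_pow]
          field_simp
          ring
end

section
/- Suppose φ(x) > 0 for all x > 0, φ(x) → 0 as x → +∞, and there exists x₀ ≥ 0 such that φ'(x) < 0 for all x > x₀. Then there exists b > 0 with (0, b) ∈ Z; that is, Z intersects the half-line {(0, b) : b > 0}. -/
open Set Filter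

/-- The set of initial conditions `(f(0), f'(0))` of bounded, twice continuously
differentiable solutions of `f'' = f² − φ` on `[0,∞)`. -/
def Zset (φ : ℝ → ℝ) : Set (ℝ × ℝ) :=
  {p : ℝ × ℝ | ∃ f f' : ℝ → ℝ,
    (∃ C : ℝ, ∀ x ∈ Ici (0:ℝ), |f x| ≤ C) ∧
    (∀ x ∈ Ici (0:ℝ), HasDerivWithinAt f (f' x) (Ici 0) x) ∧
    (∀ x ∈ Ici (0:ℝ), HasDerivWithinAt f' (f x ^ 2 - φ x) (Ici 0) x) ∧
    f 0 = p.1 ∧ f' 0 = p.2}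

section ExponentialKernels

open MeasureTheory Topology

/-- The bounded solution `v` of `v' = w v - h`. -/
noncomputable def backwardSol (w : ℝ) (h : ℝ → ℝ) (x : ℝ) : ℝ :=
  Real.exp (w * x) * ∫ y in Ioi x, Real.exp (-w * y) * h y

/-- The solution of `u' = v - w u`, `u 0 = 0`, on `[0,∞)`, extended by `0` to the left. -/
noncomputable def forwardSol (w : ℝ) (v : ℝ → ℝ) (x : ℝ) : ℝ :=
  Real.exp (-w * x) * ∫ y in (0 : ℝ)..max x 0, Real.exp (w * y) * v y

theorem integrableOn_exp_neg_mul_of_bounded {w K : ℝ} (hw : 0 < w) {h : ℝ → ℝ}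
    (hm : Measurable h) (h0 : ∀ y, 0 ≤ h y) (hK : ∀ y, h y ≤ K) (x : ℝ) :
    IntegrableOn (fun y => Real.exp (-w * y) * h y) (Ioi x) := by
  refine Integrable.mono' ((exp_neg_integrableOn_Ioi x hw).mul_const K)
    (by fun_prop) (Eventually.of_forall fun y => ?_)
  rw [Real.norm_of_nonneg (mul_nonneg (Real.exp_pos _).le (h0 y))]
  exact mul_le_mul_of_nonneg_left (hK y) (Real.exp_pos _).le

theorem backwardSol_nonneg (w : ℝ) {h : ℝ → ℝ} (h0 : ∀ y, 0 ≤ h y) (x : ℝ) :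
    0 ≤ backwardSol w h x :=
  mul_nonneg (Real.exp_pos _).le
    (integral_nonneg fun y => mul_nonneg (Real.exp_pos _).le (h0 y))

theorem backwardSol_mono {w K : ℝ} (hw : 0 < w) {h k : ℝ → ℝ}
    (hm : Measurable h) (h0 : ∀ y, 0 ≤ h y) (hK : ∀ y, h y ≤ K)
    (km : Measurable k) (k0 : ∀ y, 0 ≤ k y) (kK : ∀ y, k y ≤ K)
    (hk : ∀ y, h y ≤ k y) (x : ℝ) : backwardSol w h x ≤ backwardSol w k x :=
  mul_le_mul_of_nonneg_left
    (setIntegral_mono_on (integrableOn_exp_neg_mul_of_bounded hw hm h0 hK x)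
      (integrableOn_exp_neg_mul_of_bounded hw km k0 kK x) measurableSet_Ioi
      fun y _ => mul_le_mul_of_nonneg_left (hk y) (Real.exp_pos _).le) (Real.exp_pos _).le

theorem backwardSol_le {w K : ℝ} (hw : 0 < w) {h : ℝ → ℝ}
    (hm : Measurable h) (h0 : ∀ y, 0 ≤ h y) (hK : ∀ y, h y ≤ K) (x : ℝ) :
    backwardSol w h x ≤ K / w := by
  have hKn : 0 ≤ K := (h0 0).trans (hK 0)
  refine (backwardSol_mono hw hm h0 hK measurable_const (fun _ => hKn) (fun _ => le_rfl)
    hK x).trans_eq ?_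
  rw [backwardSol, integral_mul_const, integral_exp_mul_Ioi (neg_lt_zero.2 hw), neg_mul,
    Real.exp_neg]
  field_simp

theorem backwardSol_pos {w K : ℝ} (hw : 0 < w) {h : ℝ → ℝ}
    (hm : Measurable h) (h0 : ∀ y, 0 ≤ h y) (hK : ∀ y, h y ≤ K) {x : ℝ}
    (hpos : ∀ y, x < y → 0 < h y) : 0 < backwardSol w h x := by
  refine mul_pos (Real.exp_pos _) ((setIntegral_pos_iff_support_of_nonneg_ae
    (Eventually.of_forall fun y => mul_nonneg (Real.exp_pos _).le (h0 y))
    (integrableOn_exp_neg_mul_of_bounded hw hm h0 hK x)).2 ?_)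
  rw [inter_eq_self_of_subset_right]
  · simp
  · exact fun y hy => (mul_pos (Real.exp_pos _) (hpos y hy)).ne'

theorem backwardSol_eq {w K : ℝ} (hw : 0 < w) {h : ℝ → ℝ}
    (hm : Measurable h) (h0 : ∀ y, 0 ≤ h y) (hK : ∀ y, h y ≤ K) :
    backwardSol w h = fun x => Real.exp (w * x) *
      ((∫ y in Ioi 0, Real.exp (-w * y) * h y) -
        ∫ y in (0 : ℝ)..x, Real.exp (-w * y) * h y) := by
  funext x
  rw [backwardSol, ← intervalIntegral.integral_interval_add_Ioi
    (integrableOn_exp_neg_mul_of_bounded hw hm h0 hK 0)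
    (integrableOn_exp_neg_mul_of_bounded hw hm h0 hK x), add_sub_cancel_left]

theorem continuous_backwardSol {w K : ℝ} (hw : 0 < w) {h : ℝ → ℝ}
    (hm : Measurable h) (h0 : ∀ y, 0 ≤ h y) (hK : ∀ y, h y ≤ K) :
    Continuous (backwardSol w h) := by
  rw [backwardSol_eq hw hm h0 hK]
  have : Continuous fun x => ∫ y in (0 : ℝ)..x, Real.exp (-w * y) * h y := by
    refine intervalIntegral.continuous_primitive (fun a b => ?_) 0
    have hi := integrableOn_exp_neg_mul_of_bounded hw hm h0 hK (min a b)
    exact intervalIntegrable_iff.2 (hi.mono_set fun y hy => hy.1)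
  fun_prop

theorem hasDerivAt_backwardSol {w K : ℝ} (hw : 0 < w) {h : ℝ → ℝ}
    (hc : Continuous h) (h0 : ∀ y, 0 ≤ h y) (hK : ∀ y, h y ≤ K) (x : ℝ) :
    HasDerivAt (backwardSol w h) (w * backwardSol w h x - h x) x := by
  have hp : HasDerivAt (fun x => ∫ y in (0 : ℝ)..x, Real.exp (-w * y) * h y)
      (Real.exp (-w * x) * h x) x :=
    (by fun_prop : Continuous fun y => Real.exp (-w * y) * h y).integral_hasStrictDerivAt 0 x
      |>.hasDerivAt
  have he : HasDerivAt (fun x => Real.exp (w * x)) (Real.exp (w * x) * (w * 1)) x :=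
    ((hasDerivAt_id x).const_mul w).exp
  rw [backwardSol_eq hw hc.measurable h0 hK]
  refine (he.mul (hp.const_sub _)).congr_deriv ?_
  dsimp only
  have : Real.exp (w * x) * Real.exp (-w * x) = 1 := by
    rw [← Real.exp_add]; simp
  linear_combination (-h x) * this

theorem tendsto_backwardSol {w K : ℝ} (hw : 0 < w) {h : ℕ → ℝ → ℝ} {k : ℝ → ℝ}
    (hm : ∀ n, Measurable (h n)) (h0 : ∀ n y, 0 ≤ h n y) (hK : ∀ n y, h n y ≤ K)
    (hk : ∀ y, Tendsto (fun n => h n y) atTop (𝓝 (k y))) (x : ℝ) :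
    Tendsto (fun n => backwardSol w (h n) x) atTop (𝓝 (backwardSol w k x)) := by
  refine Tendsto.const_mul _ (tendsto_integral_of_dominated_convergence
    (fun y => Real.exp (-w * y) * K)
    (fun n => (integrableOn_exp_neg_mul_of_bounded hw (hm n) (h0 n) (hK n) x).1)
    ((exp_neg_integrableOn_Ioi x hw).mul_const K)
    (fun n => Eventually.of_forall fun y => ?_)
    (Eventually.of_forall fun y => (hk y).const_mul _))
  rw [Real.norm_of_nonneg (mul_nonneg (Real.exp_pos _).le (h0 n y))]
  exact mul_le_mul_of_nonneg_left (hK n y) (Real.exp_pos _).le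

theorem forwardSol_nonneg (w : ℝ) {v : ℝ → ℝ} (v0 : ∀ y, 0 ≤ v y) (x : ℝ) :
    0 ≤ forwardSol w v x :=
  mul_nonneg (Real.exp_pos _).le (intervalIntegral.integral_nonneg (le_max_right _ _)
    fun y _ => mul_nonneg (Real.exp_pos _).le (v0 y))

theorem forwardSol_mono (w : ℝ) {u v : ℝ → ℝ} (hu : Continuous u) (hv : Continuous v)
    (huv : ∀ y, u y ≤ v y) (x : ℝ) : forwardSol w u x ≤ forwardSol w v x :=
  mul_le_mul_of_nonneg_left (intervalIntegral.integral_mono_on (le_max_right _ _)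
    ((by fun_prop : Continuous fun y => Real.exp (w * y) * u y).intervalIntegrable _ _)
    ((by fun_prop : Continuous fun y => Real.exp (w * y) * v y).intervalIntegrable _ _)
    fun y _ => mul_le_mul_of_nonneg_left (huv y) (Real.exp_pos _).le) (Real.exp_pos _).le

theorem forwardSol_le {w K : ℝ} (hw : 0 < w) (hKn : 0 ≤ K) {v : ℝ → ℝ} (hv : Continuous v)
    (hK : ∀ y, v y ≤ K) (x : ℝ) : forwardSol w v x ≤ K / w := by
  refine (forwardSol_mono w hv continuous_const hK x).trans ?_
  have hint (b : ℝ) : ∫ y in (0 : ℝ)..b, Real.exp (w * y) * K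
      = K / w * (Real.exp (w * b) - 1) := by
    rw [intervalIntegral.integral_mul_const,
      intervalIntegral.integral_comp_mul_left (f := Real.exp) hw.ne', integral_exp]
    simp
    field_simp
  have hKw : 0 ≤ K / w := by positivity
  rw [forwardSol, hint]
  rcases le_total 0 x with hx | hx
  · rw [max_eq_left hx]
    have : Real.exp (w * x) * Real.exp (-w * x) = 1 := by
      rw [← Real.exp_add]; simp
    have he := mul_nonneg hKw (Real.exp_pos (-w * x)).le
    linear_combination he + K / w * this
  · rw [max_eq_right hx]
    simpa using hKw

theorem continuous_forwardSol (w : ℝ) {v : ℝ → ℝ} (hv : Continuous v) :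
    Continuous (forwardSol w v) := by
  have : Continuous fun x => ∫ y in (0 : ℝ)..x, Real.exp (w * y) * v y :=
    intervalIntegral.continuous_primitive
      (fun a b => (by fun_prop : Continuous fun y => Real.exp (w * y) * v y).intervalIntegrable
        a b) 0
  have h2 := this.comp (continuous_id.max continuous_const : Continuous fun x : ℝ => max x 0)
  unfold forwardSol
  simp only [Function.comp_def] at h2
  fun_prop

theorem hasDerivWithinAt_forwardSol (w : ℝ) {v : ℝ → ℝ} (hv : Continuous v) {x : ℝ}
    (hx : x ∈ Ici (0 : ℝ)) :
    HasDerivWithinAt (forwardSol w v) (v x - w * forwardSol w v x) (Ici 0) x := by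
  have hp : HasDerivAt (fun x => ∫ y in (0 : ℝ)..x, Real.exp (w * y) * v y)
      (Real.exp (w * x) * v x) x :=
    (by fun_prop : Continuous fun y => Real.exp (w * y) * v y).integral_hasStrictDerivAt 0 x
      |>.hasDerivAt
  have he : HasDerivAt (fun x => Real.exp (-w * x)) (Real.exp (-w * x) * (-w * 1)) x :=
    ((hasDerivAt_id x).const_mul (-w)).exp
  have heq : EqOn (forwardSol w v)
      (fun x => Real.exp (-w * x) * ∫ y in (0 : ℝ)..x, Real.exp (w * y) * v y) (Ici 0) :=
    fun y hy => by rw [forwardSol, max_eq_left hy]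
  refine HasDerivWithinAt.congr ?_ heq (heq hx)
  rw [heq hx]
  refine ((he.mul hp).congr_deriv ?_).hasDerivWithinAt
  have : Real.exp (w * x) * Real.exp (-w * x) = 1 := by
    rw [← Real.exp_add]; simp
  linear_combination v x * this

theorem tendsto_forwardSol (w : ℝ) {K : ℝ} {u : ℕ → ℝ → ℝ} {v : ℝ → ℝ}
    (hu : ∀ n, Continuous (u n)) (h0 : ∀ n y, 0 ≤ u n y) (hK : ∀ n y, u n y ≤ K)
    (huv : ∀ y, Tendsto (fun n => u n y) atTop (𝓝 (v y))) (x : ℝ) :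
    Tendsto (fun n => forwardSol w (u n) x) atTop (𝓝 (forwardSol w v x)) := by
  refine Tendsto.const_mul _ (intervalIntegral.tendsto_integral_filter_of_dominated_convergence
    (fun y => Real.exp (w * y) * K) (Eventually.of_forall fun n => ?_)
    (Eventually.of_forall fun n => Eventually.of_forall fun y _ => ?_)
    ((by fun_prop : Continuous fun y => Real.exp (w * y) * K).intervalIntegrable _ _)
    (Eventually.of_forall fun y _ => (huv y).const_mul _))
  · have := hu n
    exact (by fun_prop : Continuous fun y => Real.exp (w * y) * u n y).aestronglyMeasurable
  · rw [Real.norm_of_nonneg (mul_nonneg (Real.exp_pos _).le (h0 n y))]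
    exact mul_le_mul_of_nonneg_left (hK n y) (Real.exp_pos _).le

end ExponentialKernels

section MonotoneIteration

/-- The function `s ↦ w² s - s²` on `[0, w² / 2]`, extended to be constant on both sides. -/
noncomputable def truncatedQuadratic (w s : ℝ) : ℝ :=
  w ^ 2 * max 0 (min s (w ^ 2 / 2)) - max 0 (min s (w ^ 2 / 2)) ^ 2

theorem continuous_truncatedQuadratic (w : ℝ) : Continuous (truncatedQuadratic w) := by
  unfold truncatedQuadratic
  fun_prop

theorem truncatedQuadratic_mono (w : ℝ) : Monotone (truncatedQuadratic w) := by
  intro s t hst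
  have h1 : max 0 (min s (w ^ 2 / 2)) ≤ max 0 (min t (w ^ 2 / 2)) := by gcongr
  have h2 : max 0 (min t (w ^ 2 / 2)) ≤ w ^ 2 / 2 := max_le (by positivity) (min_le_right _ _)
  unfold truncatedQuadratic
  nlinarith

theorem truncatedQuadratic_nonneg (w s : ℝ) : 0 ≤ truncatedQuadratic w s := by
  have h1 : 0 ≤ max 0 (min s (w ^ 2 / 2)) := le_max_left _ _
  have h2 : max 0 (min s (w ^ 2 / 2)) ≤ w ^ 2 / 2 := max_le (by positivity) (min_le_right _ _)
  unfold truncatedQuadratic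
  nlinarith

theorem truncatedQuadratic_le (w s : ℝ) : truncatedQuadratic w s ≤ w ^ 4 / 4 := by
  unfold truncatedQuadratic
  nlinarith [sq_nonneg (max 0 (min s (w ^ 2 / 2)) - w ^ 2 / 2)]

theorem truncatedQuadratic_eq {w s : ℝ} (h0 : 0 ≤ s) (h1 : s ≤ w ^ 2 / 2) :
    truncatedQuadratic w s = w ^ 2 * s - s ^ 2 := by
  rw [truncatedQuadratic, min_eq_left h1, max_eq_right h0]

/-- The right-hand side `h` for which `u'' - w² u = -h` is equivalent to `u'' = u² - ψ`
when `0 ≤ u ≤ w² / 2`. -/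
noncomputable def source (w : ℝ) (ψ u : ℝ → ℝ) (y : ℝ) : ℝ :=
  truncatedQuadratic w (u y) + ψ y

/-- The monotone iteration step: solve `U'' - w² U = -source w ψ u` with `U 0 = 0`, `U` bounded. -/
noncomputable def iterStep (w : ℝ) (ψ u : ℝ → ℝ) : ℝ → ℝ :=
  forwardSol w (backwardSol w (source w ψ u))

variable {w : ℝ} {ψ : ℝ → ℝ}

theorem measurable_source (hψ : Continuous ψ) {u : ℝ → ℝ} (hu : Measurable u) :
    Measurable (source w ψ u) :=
  ((continuous_truncatedQuadratic w).measurable.comp hu).add hψ.measurable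

theorem source_nonneg (hψ0 : ∀ y, 0 ≤ ψ y) (u : ℝ → ℝ) (y : ℝ) : 0 ≤ source w ψ u y :=
  add_nonneg (truncatedQuadratic_nonneg _ _) (hψ0 y)

theorem source_le (hψB : ∀ y, ψ y ≤ w ^ 4 / 4) (u : ℝ → ℝ) (y : ℝ) :
    source w ψ u y ≤ w ^ 4 / 2 := by
  have := truncatedQuadratic_le w (u y)
  have := hψB y
  unfold source
  linarith

theorem exists_bounded_fixedPoint_iterStep (hw : 0 < w) (hψ : Continuous ψ)
    (hψ0 : ∀ y, 0 ≤ ψ y) (hψB : ∀ y, ψ y ≤ w ^ 4 / 4) :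
    ∃ u : ℝ → ℝ, Continuous u ∧ (∀ x, 0 ≤ u x ∧ u x ≤ w ^ 2 / 2) ∧ iterStep w ψ u = u := by
  have hcv {u : ℝ → ℝ} (hu : Measurable u) : Continuous (backwardSol w (source w ψ u)) :=
    continuous_backwardSol hw (measurable_source hψ hu) (source_nonneg hψ0 u) (source_le hψB u)
  have hv0 (u : ℝ → ℝ) : ∀ y, 0 ≤ backwardSol w (source w ψ u) y :=
    backwardSol_nonneg w (source_nonneg hψ0 u)
  have hvB {u : ℝ → ℝ} (hu : Measurable u) :
      ∀ y, backwardSol w (source w ψ u) y ≤ w ^ 4 / 2 / w :=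
    backwardSol_le hw (measurable_source hψ hu) (source_nonneg hψ0 u) (source_le hψB u)
  have hcont {u : ℝ → ℝ} (hu : Measurable u) : Continuous (iterStep w ψ u) :=
    continuous_forwardSol w (hcv hu)
  have hnonneg (u : ℝ → ℝ) (x : ℝ) : 0 ≤ iterStep w ψ u x := forwardSol_nonneg w (hv0 u) x
  have hle {u : ℝ → ℝ} (hu : Measurable u) (x : ℝ) : iterStep w ψ u x ≤ w ^ 2 / 2 :=
    (forwardSol_le hw (by positivity) (hcv hu) (hvB hu) x).trans_eq (by field_simp)
  set s : ℕ → ℝ → ℝ := fun n => (iterStep w ψ)^[n] 0 with hs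
  have hsucc (n : ℕ) : s (n + 1) = iterStep w ψ (s n) := Function.iterate_succ_apply' _ _ _
  have hscont (n : ℕ) : Continuous (s n) := by
    induction n with
    | zero => exact continuous_const
    | succ n ih => rw [hsucc]; exact hcont ih.measurable
  have hsle (n : ℕ) (x : ℝ) : s n x ≤ w ^ 2 / 2 := by
    cases n with
    | zero => exact (by positivity : (0 : ℝ) ≤ w ^ 2 / 2)
    | succ n => rw [hsucc]; exact hle (hscont n).measurable x
  have hstep (n : ℕ) : ∀ x, s n x ≤ s (n + 1) x := by
    induction n with
    | zero => intro x; rw [hsucc]; exact hnonneg _ x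
    | succ n ih =>
      intro x
      rw [hsucc (n + 1)]
      refine (congrFun (hsucc n) x).trans_le ?_
      exact forwardSol_mono w (hcv (hscont n).measurable) (hcv (hscont (n + 1)).measurable)
        (backwardSol_mono hw (measurable_source hψ (hscont n).measurable)
          (source_nonneg hψ0 _) (source_le hψB _)
          (measurable_source hψ (hscont (n + 1)).measurable)
          (source_nonneg hψ0 _) (source_le hψB _)
          fun y => add_le_add_left (truncatedQuadratic_mono w (ih y)) _) x
  set u : ℝ → ℝ := fun x => ⨆ n, s n x with hu
  have hlim (x : ℝ) : Tendsto (fun n => s n x) atTop (nhds (u x)) :=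
    tendsto_atTop_ciSup (monotone_nat_of_le_succ fun n => hstep n x)
      ⟨w ^ 2 / 2, by rintro _ ⟨n, rfl⟩; exact hsle n x⟩
  have hum : Measurable u :=
    measurable_of_tendsto_metrizable (fun n => (hscont n).measurable) (tendsto_pi_nhds.2 hlim)
  have hfix : iterStep w ψ u = u := by
    funext x
    refine tendsto_nhds_unique ?_ ((tendsto_add_atTop_iff_nat 1).2 (hlim x))
    simp only [hsucc]
    refine tendsto_forwardSol w (fun n => hcv (hscont n).measurable) (fun n => hv0 _)
      (fun n => hvB (hscont n).measurable) (fun y => ?_) x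
    refine tendsto_backwardSol hw (fun n => measurable_source hψ (hscont n).measurable)
      (fun n => source_nonneg hψ0 _) (fun n => source_le hψB _) (fun z => ?_) y
    exact (((continuous_truncatedQuadratic w).tendsto _).comp (hlim z)).add_const _
  refine ⟨u, hfix ▸ hcont hum, fun x => ?_, hfix⟩
  rw [← hfix]
  exact ⟨hnonneg u x, hle hum x⟩

end MonotoneIteration

theorem exists_pos_mem_Zset_of_bounded {φ : ℝ → ℝ} (hφ : Continuous φ)
    (hφpos : ∀ x : ℝ, 0 < x → 0 < φ x) {w : ℝ} (hw : 0 < w)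
    (hφB : ∀ x : ℝ, 0 ≤ x → φ x ≤ w ^ 4 / 4) : ∃ b : ℝ, 0 < b ∧ ((0 : ℝ), b) ∈ Zset φ := by
  have hφ0 : 0 ≤ φ 0 :=
    ge_of_tendsto (hφ.continuousWithinAt (s := Ioi 0) (x := 0))
      (eventually_mem_nhdsWithin.mono fun x hx => (hφpos x hx).le)
  set ψ : ℝ → ℝ := fun x => φ |x| with hψdef
  have hψ : Continuous ψ := hφ.comp continuous_abs
  have hψ0 (y : ℝ) : 0 ≤ ψ y := by
    rcases (abs_nonneg y).eq_or_lt with h | h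
    · simpa [hψdef, ← h] using hφ0
    · exact (hφpos _ h).le
  have hψB (y : ℝ) : ψ y ≤ w ^ 4 / 4 := hφB _ (abs_nonneg y)
  obtain ⟨u, huc, hub, hfix⟩ := exists_bounded_fixedPoint_iterStep hw hψ hψ0 hψB
  have hsm := measurable_source (w := w) hψ huc.measurable
  have hs0 := source_nonneg (w := w) hψ0 u
  have hsB := source_le hψB u
  have hsc : Continuous (source w ψ u) :=
    ((continuous_truncatedQuadratic w).comp huc).add hψ
  set v := backwardSol w (source w ψ u) with hv
  have hvc : Continuous v := continuous_backwardSol hw hsm hs0 hsB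
  have hfix' : forwardSol w v = u := hfix
  have hu' (x : ℝ) (hx : x ∈ Ici (0 : ℝ)) :
      HasDerivWithinAt u (v x - w * u x) (Ici 0) x := by
    have := hasDerivWithinAt_forwardSol w hvc hx
    rwa [hfix'] at this
  have hu0 : u 0 = 0 := by rw [← hfix']; simp [forwardSol]
  refine ⟨v 0, backwardSol_pos hw hsm hs0 hsB fun y hy => ?_, u, fun x => v x - w * u x,
    ⟨w ^ 2 / 2, fun x _ => ?_⟩, hu', fun x hx => ?_, hu0, by simp [hu0]⟩
  · exact add_pos_of_nonneg_of_pos (truncatedQuadratic_nonneg _ _) (hφpos _ (abs_pos.2 hy.ne'))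
  · rw [abs_of_nonneg (hub x).1]
    exact (hub x).2
  · have hv' := (hasDerivAt_backwardSol hw hsc hs0 hsB x).hasDerivWithinAt (s := Ici 0)
    refine (hv'.sub ((hu' x hx).const_mul w)).congr_deriv ?_
    have hsx : source w ψ u x = w ^ 2 * u x - u x ^ 2 + φ x := by
      simp only [source, truncatedQuadratic_eq (hub x).1 (hub x).2, hψdef,
        abs_of_nonneg (mem_Ici.1 hx)]
    linear_combination -hsx

theorem exists_upperBound_of_tendsto_atTop {φ : ℝ → ℝ} {l : ℝ} (hφ : Continuous φ)
    (hl : Tendsto φ atTop (nhds l)) (a : ℝ) : ∃ C : ℝ, ∀ x, a ≤ x → φ x ≤ C := by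
  obtain ⟨N, hN⟩ := eventually_atTop.1 (hl.eventually (gt_mem_nhds (lt_add_one l)))
  obtain ⟨C, hC⟩ := (isCompact_Icc (a := a) (b := N)).bddAbove_image hφ.continuousOn
  refine ⟨max C (l + 1), fun x hx => ?_⟩
  rcases le_total x N with h | h
  · exact (hC (mem_image_of_mem φ ⟨hx, h⟩)).trans (le_max_left _ _)
  · exact (hN x h).le.trans (le_max_right _ _)

/-- If `φ > 0` on `(0,∞)`, `φ → 0` at `+∞`, and `φ' < 0` beyond some
`x₀ ≥ 0`, then `Z` meets the half-line `{(0,b) : b > 0}`. -/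
theorem stmt11 (φ : ℝ → ℝ) (hφ : ContDiff ℝ (⊤ : ℕ∞) φ)
    (hφpos : ∀ x : ℝ, 0 < x → 0 < φ x)
    (hφ0 : Tendsto φ atTop (nhds 0))
    (hφ' : ∃ x₀ : ℝ, 0 ≤ x₀ ∧ ∀ x : ℝ, x₀ < x → deriv φ x < 0) :
    ∃ b : ℝ, 0 < b ∧ ((0 : ℝ), b) ∈ Zset φ := by
  obtain ⟨C, hC⟩ := exists_upperBound_of_tendsto_atTop hφ.continuous hφ0 0
  have h1 : 1 ≤ max 1 (4 * C) := le_max_left _ _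
  have h2 : 4 * C ≤ max 1 (4 * C) := le_max_right _ _
  refine exists_pos_mem_Zset_of_bounded hφ.continuous hφpos
    (w := max 1 (4 * C)) (by linarith) fun x hx => (hC x hx).trans ?_
  have h3 := le_self_pow₀ h1 (n := 4) (by norm_num)
  linarith
end

section
/- Suppose there are constants 0 < k < 1 and D > 1 such that φ(x) > 0 and φ'(x) < −D·(4√2/(k√3))·φ(x)^{5/4} for all x > 0. Then: (i) every (a,b) ∈ Z satisfies a ≥ −k·√(φ(0)); (ii) for every a ≥ 0 there is exactly one b ∈ ℝ with (a,b) ∈ Z; (iii) if (a₁,b) ∈ Z and (a₂,b) ∈ Z with a₁ ≥ 0 and a₂ ≥ 0, then a₁ = a₂; and (iv) there is exactly one a ∈ ℝ with (a,0) ∈ Z. -/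
open Set Filter

section HalfLine

variable {f f' : ℝ → ℝ}

lemma monotoneOn_of_hasDerivWithinAt_Ici {D : Set ℝ} (hD : Convex ℝ D) (hD0 : D ⊆ Ici 0)
    (hf : ∀ x ∈ Ici (0:ℝ), HasDerivWithinAt f (f' x) (Ici 0) x)
    (h : ∀ x ∈ interior D, 0 ≤ f' x) : MonotoneOn f D :=
  monotoneOn_of_hasDerivWithinAt_nonneg hD
    (fun x hx => ((hf x (hD0 hx)).continuousWithinAt.mono hD0))
    (fun x hx => (hf x (hD0 (interior_subset hx))).mono (interior_subset.trans hD0)) h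

lemma antitoneOn_of_hasDerivWithinAt_Ici {D : Set ℝ} (hD : Convex ℝ D) (hD0 : D ⊆ Ici 0)
    (hf : ∀ x ∈ Ici (0:ℝ), HasDerivWithinAt f (f' x) (Ici 0) x)
    (h : ∀ x ∈ interior D, f' x ≤ 0) : AntitoneOn f D :=
  antitoneOn_of_hasDerivWithinAt_nonpos hD
    (fun x hx => ((hf x (hD0 hx)).continuousWithinAt.mono hD0))
    (fun x hx => (hf x (hD0 (interior_subset hx))).mono (interior_subset.trans hD0)) h

/-- A function whose derivative is eventually at least `m > 0` tends to infinity. -/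
lemma eventually_ge_of_le_deriv
    (hf : ∀ x ∈ Ici (0:ℝ), HasDerivWithinAt f (f' x) (Ici 0) x) {X m : ℝ} (hX : 0 ≤ X)
    (hm : 0 < m) (h : ∀ x, X < x → m ≤ f' x) (N : ℝ) : ∃ Y, X ≤ Y ∧ ∀ x, Y ≤ x → N ≤ f x := by
  have hmono : MonotoneOn (fun x => f x - m * x) (Ici X) := by
    refine monotoneOn_of_hasDerivWithinAt_Ici (f' := fun x => f' x - m * 1) (convex_Ici X)
      (Ici_subset_Ici.2 hX) (fun x hx => (hf x hx).sub ((hasDerivWithinAt_id x _).const_mul m)) ?_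
    intro x hx
    rw [interior_Ici] at hx
    have := h x hx
    linarith
  refine ⟨max X (X + (N - f X) / m), le_max_left _ _, fun x hx => ?_⟩
  have h1 := hmono (self_mem_Ici) (show x ∈ Ici X from (le_max_left _ _).trans hx)
    ((le_max_left _ _).trans hx)
  have h2 : (N - f X) / m ≤ x - X := by linarith [(le_max_right X (X + (N - f X) / m)).trans hx]
  rw [div_le_iff₀ hm] at h2
  simp only at h1
  nlinarith

/-- Continuous induction: positivity on `[X, y)` propagates to `y`, hence to all of `[X, ∞)`. -/
lemma pos_of_continuousOn_Ici {g : ℝ → ℝ} {X : ℝ} (hg : ContinuousOn g (Ici X)) (h0 : 0 < g X)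
    (hstep : ∀ y, X < y → (∀ x ∈ Ico X y, 0 < g x) → 0 ≤ g y → 0 < g y) :
    ∀ x, X ≤ x → 0 < g x := by
  by_contra! hcon
  obtain ⟨z, hz, hgz⟩ := hcon
  have hcomp : IsCompact (Icc X z ∩ g ⁻¹' Iic 0) :=
    isCompact_Icc.of_isClosed_subset
      ((hg.mono Icc_subset_Ici_self).preimage_isClosed_of_isClosed isClosed_Icc isClosed_Iic)
      inter_subset_left
  obtain ⟨y, ⟨⟨hXy, hyz⟩, hy⟩, hleast⟩ := hcomp.exists_isLeast ⟨z, ⟨hz, le_rfl⟩, hgz⟩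
  have hy : g y ≤ 0 := hy
  have hXy' : X < y := by
    refine lt_of_le_of_ne hXy ?_
    rintro rfl
    linarith
  have hpos : ∀ x ∈ Ico X y, 0 < g x := by
    intro x hx
    by_contra! h
    exact absurd (hleast ⟨⟨hx.1, hx.2.le.trans hyz⟩, h⟩) (not_le.2 hx.2)
  have hy0 : 0 ≤ g y := by
    by_contra! h
    obtain ⟨w, hw, hgw⟩ := intermediate_value_Icc' hXy (hg.mono Icc_subset_Ici_self)
      (show (0:ℝ) ∈ Icc (g y) (g X) from ⟨h.le, h0.le⟩)
    have hwy : w < y := by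
      refine lt_of_le_of_ne hw.2 ?_
      rintro rfl
      linarith
    linarith [hpos w ⟨hw.1, hwy⟩]
  linarith [hstep y hXy' hpos hy0]

end HalfLine

/-- `f` is a bounded solution of `f'' = f² - φ` on `[0, ∞)` with derivative `f'`. -/
structure BoundedSolution (φ f f' : ℝ → ℝ) : Prop where
  bdd : ∃ C : ℝ, ∀ x ∈ Ici (0:ℝ), |f x| ≤ C
  deriv₁ : ∀ x ∈ Ici (0:ℝ), HasDerivWithinAt f (f' x) (Ici 0) x
  deriv₂ : ∀ x ∈ Ici (0:ℝ), HasDerivWithinAt f' (f x ^ 2 - φ x) (Ici 0) x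

lemma mem_Zset_iff {φ : ℝ → ℝ} {a b : ℝ} :
    (a, b) ∈ Zset φ ↔ ∃ f f', BoundedSolution φ f f' ∧ f 0 = a ∧ f' 0 = b :=
  ⟨fun ⟨f, f', h₀, h₁, h₂, h₃⟩ => ⟨f, f', ⟨h₀, h₁, h₂⟩, h₃⟩,
    fun ⟨f, f', ⟨h₀, h₁, h₂⟩, h₃⟩ => ⟨f, f', h₀, h₁, h₂, h₃⟩⟩

/-- `φ` is continuous, positive and decreasing to zero on `[0, ∞)`. -/
structure DecaysToZero (φ : ℝ → ℝ) : Prop where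
  cont : Continuous φ
  pos : ∀ x, 0 ≤ x → 0 < φ x
  anti : AntitoneOn φ (Ici 0)
  small : ∀ ε, 0 < ε → ∃ X, 0 ≤ X ∧ ∀ x, X ≤ x → φ x ≤ ε

namespace BoundedSolution

variable {φ f f' : ℝ → ℝ}

lemma continuousOn (h : BoundedSolution φ f f') : ContinuousOn f (Ici 0) :=
  fun x hx => (h.deriv₁ x hx).continuousWithinAt

lemma continuousOn_deriv (h : BoundedSolution φ f f') : ContinuousOn f' (Ici 0) :=
  fun x hx => (h.deriv₂ x hx).continuousWithinAt

lemma not_le_deriv (h : BoundedSolution φ f f') {X m : ℝ} (hX : 0 ≤ X) (hm : 0 < m) :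
    ¬ ∀ x, X < x → m ≤ f' x := by
  intro hle
  obtain ⟨C, hC⟩ := h.bdd
  obtain ⟨Y, hY, hf⟩ := eventually_ge_of_le_deriv h.deriv₁ hX hm hle (C + 1)
  linarith [hf Y le_rfl, (abs_le.1 (hC Y (hX.trans hY))).2]

lemma not_deriv_le_neg (h : BoundedSolution φ f f') {X m : ℝ} (hX : 0 ≤ X) (hm : 0 < m) :
    ¬ ∀ x, X < x → f' x ≤ -m := by
  intro hle
  obtain ⟨C, hC⟩ := h.bdd
  obtain ⟨Y, hY, hf⟩ := eventually_ge_of_le_deriv (f := fun x => -f x) (f' := fun x => -f' x)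
    (fun x hx => (h.deriv₁ x hx).neg) hX hm (fun x hx => by linarith [hle x hx]) (C + 1)
  linarith [hf Y le_rfl, (abs_le.1 (hC Y (hX.trans hY))).1]

lemma not_le_deriv₂ (h : BoundedSolution φ f f') {X m : ℝ} (hX : 0 ≤ X) (hm : 0 < m) :
    ¬ ∀ x, X < x → m ≤ f x ^ 2 - φ x := by
  intro hle
  obtain ⟨Y, hY, hf⟩ := eventually_ge_of_le_deriv h.deriv₂ hX hm hle 1
  exact h.not_le_deriv (hX.trans hY) one_pos fun x hx => hf x hx.le

lemma cubic_gap {s u v : ℝ} (hs : 0 ≤ s) (huv : u ≤ v) :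
    -(4 / 3 * s ^ 3) ≤ (v ^ 3 / 3 - s ^ 2 * v) - (u ^ 3 / 3 - s ^ 2 * u) := by
  have h1 : 0 ≤ (v - u) * (u + v) ^ 2 := mul_nonneg (by linarith) (sq_nonneg _)
  have h2 : 0 ≤ (v - u - 2 * s) ^ 2 * (v - u + 4 * s) :=
    mul_nonneg (sq_nonneg _) (by linarith)
  nlinarith

/-- A bounded solution cannot have enough kinetic energy to cross the potential barrier. -/
lemma deriv_sq_le (h : BoundedSolution φ f f') (hφ : DecaysToZero φ) {x₁ : ℝ} (hx₁ : 0 ≤ x₁)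
    (hpos : 0 < f' x₁) : f' x₁ ^ 2 ≤ 8 / 3 * Real.sqrt (φ x₁) ^ 3 := by
  by_contra! hlt
  set s := Real.sqrt (φ x₁) with hs
  have hs0 : 0 ≤ s := Real.sqrt_nonneg _
  have hsq : s ^ 2 = φ x₁ := Real.sq_sqrt (hφ.pos x₁ hx₁).le
  have hsub : Ici x₁ ⊆ Ici (0:ℝ) := Ici_subset_Ici.2 hx₁
  have hW : ∀ x ∈ Ici (0:ℝ), HasDerivWithinAt
      (fun x => f' x ^ 2 / 2 - (f x ^ 3 / 3 - s ^ 2 * f x)) (f' x * (φ x₁ - φ x)) (Ici 0) x := by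
    intro x hx
    have h1 := (((h.deriv₂ x hx).pow 2).div_const 2).sub
      ((((h.deriv₁ x hx).pow 3).div_const 3).sub ((h.deriv₁ x hx).const_mul (s ^ 2)))
    refine h1.congr_deriv ?_
    rw [hsq]
    push_cast
    ring
  have key : ∀ y, x₁ ≤ y → (∀ x ∈ Ico x₁ y, 0 < f' x) →
      f' x₁ ^ 2 - 8 / 3 * s ^ 3 ≤ f' y ^ 2 := by
    intro y hy hfy
    have hI : Icc x₁ y ⊆ Ici (0:ℝ) := Icc_subset_Ici_self.trans hsub
    have hmf : f x₁ ≤ f y := monotoneOn_of_hasDerivWithinAt_Ici (convex_Icc x₁ y) hI h.deriv₁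
      (fun x hx => by
        rw [interior_Icc] at hx
        exact (hfy x ⟨hx.1.le, hx.2⟩).le) ⟨le_rfl, hy⟩ ⟨hy, le_rfl⟩ hy
    have hmW := monotoneOn_of_hasDerivWithinAt_Ici (convex_Icc x₁ y) hI hW
      (fun x hx => by
        rw [interior_Icc] at hx
        exact mul_nonneg (hfy x ⟨hx.1.le, hx.2⟩).le (sub_nonneg.2
          (hφ.anti hx₁ (hx₁.trans hx.1.le) hx.1.le))) ⟨le_rfl, hy⟩ ⟨hy, le_rfl⟩ hy
    have := cubic_gap hs0 hmf
    simp only at hmW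
    linarith
  have hall : ∀ x, x₁ ≤ x → 0 < f' x := by
    refine pos_of_continuousOn_Ici (h.continuousOn_deriv.mono hsub) hpos ?_
    intro y hy hfy hy0
    refine lt_of_le_of_ne hy0 fun h0 => ?_
    have := key y hy.le hfy
    rw [← h0] at this
    linarith
  set m := Real.sqrt (f' x₁ ^ 2 - 8 / 3 * s ^ 3) with hm
  have hm0 : 0 < m := Real.sqrt_pos.2 (by linarith)
  refine h.not_le_deriv hx₁ hm0 fun x hx => ?_
  exact Real.sqrt_le_iff.2 ⟨(hall x hx.le).le, key x hx.le fun z hz => hall z hz.1⟩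

/-- A bounded solution lying above `-√φ` cannot decrease while it is nonpositive. -/
lemma deriv_nonneg_of_nonpos (h : BoundedSolution φ f f')
    (hlow : ∀ x, 0 ≤ x → -Real.sqrt (φ x) ≤ f x) (hφ : DecaysToZero φ)
    {x₁ : ℝ} (hx₁ : 0 ≤ x₁) (hf : f x₁ ≤ 0) : 0 ≤ f' x₁ := by
  by_contra! hneg
  have hsub : Ici x₁ ⊆ Ici (0:ℝ) := Ici_subset_Ici.2 hx₁
  have key : ∀ y, x₁ ≤ y → (∀ x ∈ Ico x₁ y, 0 < -f' x) → f' y ≤ f' x₁ := by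
    intro y hy hfy
    have hI : Icc x₁ y ⊆ Ici (0:ℝ) := Icc_subset_Ici_self.trans hsub
    have hanti : AntitoneOn f (Icc x₁ y) := antitoneOn_of_hasDerivWithinAt_Ici (convex_Icc x₁ y)
      hI h.deriv₁ (fun x hx => by
        rw [interior_Icc] at hx
        linarith [hfy x ⟨hx.1.le, hx.2⟩])
    refine antitoneOn_of_hasDerivWithinAt_Ici (convex_Icc x₁ y) hI h.deriv₂ (fun x hx => ?_)
      ⟨le_rfl, hy⟩ ⟨hy, le_rfl⟩ hy
    have hx' := interior_subset hx
    have h1 := hanti ⟨le_rfl, hy⟩ hx' hx'.1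
    have h2 := hlow x (hI hx')
    have h3 := Real.sq_sqrt (hφ.pos x (hI hx')).le
    nlinarith
  have hall : ∀ x, x₁ ≤ x → 0 < -f' x :=
    pos_of_continuousOn_Ici (h.continuousOn_deriv.mono hsub).neg (by linarith)
      fun y hy hfy _ => by linarith [key y hy.le hfy]
  exact h.not_deriv_le_neg hx₁ (neg_pos.2 hneg) fun x hx => by
    linarith [key x hx.le fun z hz => hall z hz.1]

lemma nonneg (h : BoundedSolution φ f f')
    (hlow : ∀ x, 0 ≤ x → -Real.sqrt (φ x) ≤ f x) (hφ : DecaysToZero φ) (hf : 0 ≤ f 0)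
    {x : ℝ} (hx : 0 ≤ x) : 0 ≤ f x := by
  have key : ∀ ε, 0 < ε → -f x ≤ ε * (1 + x) := by
    intro ε hε
    refine image_le_of_deriv_right_lt_deriv_boundary (f := fun x => -f x) (f' := fun x => -f' x)
      (a := 0) (b := x) (B := fun x => ε * (1 + x)) (B' := fun _ => ε * 1)
      (h.continuousOn.mono Icc_subset_Ici_self).neg
      (fun z hz => ((h.deriv₁ z hz.1).mono (Ici_subset_Ici.2 hz.1)).neg) (by linarith)
      (fun z => ((hasDerivAt_id z).const_add 1).const_mul ε) ?_ ⟨hx, le_rfl⟩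
    intro z hz hfz
    have : 0 < ε * (1 + z) := mul_pos hε (by linarith [hz.1])
    have := h.deriv_nonneg_of_nonpos hlow hφ hz.1 (by linarith)
    linarith
  by_contra! hlt
  have hx1 : 0 < 1 + x := by linarith
  have := key (-f x / 2 / (1 + x)) (div_pos (half_pos (neg_pos.2 hlt)) hx1)
  rw [div_mul_cancel₀ _ hx1.ne'] at this
  linarith

/-- Two bounded nonnegative solutions with the same initial value have the same initial slope. -/
lemma deriv_zero_le {g g' : ℝ → ℝ} (h : BoundedSolution φ f f') (hg : BoundedSolution φ g g')
    (hf0 : ∀ x, 0 ≤ x → 0 ≤ f x) (hg0 : ∀ x, 0 ≤ x → 0 ≤ g x) (h0 : f 0 = g 0) :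
    f' 0 ≤ g' 0 := by
  by_contra! hlt
  have hd : ∀ x ∈ Ici (0:ℝ), HasDerivWithinAt (fun x => f x - g x) (f' x - g' x) (Ici 0) x :=
    fun x hx => (h.deriv₁ x hx).sub (hg.deriv₁ x hx)
  have hd' : ∀ x ∈ Ici (0:ℝ), HasDerivWithinAt (fun x => f' x - g' x)
      ((f x ^ 2 - φ x) - (g x ^ 2 - φ x)) (Ici 0) x :=
    fun x hx => (h.deriv₂ x hx).sub (hg.deriv₂ x hx)
  have key : ∀ y, 0 ≤ y → (∀ x ∈ Ico 0 y, 0 < f' x - g' x) → f' 0 - g' 0 ≤ f' y - g' y := by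
    intro y hy hfy
    have hmono := monotoneOn_of_hasDerivWithinAt_Ici (convex_Icc 0 y) Icc_subset_Ici_self hd
      (fun x hx => by
        rw [interior_Icc] at hx
        exact (hfy x ⟨hx.1.le, hx.2⟩).le)
    refine monotoneOn_of_hasDerivWithinAt_Ici (convex_Icc 0 y) Icc_subset_Ici_self hd'
      (fun x hx => ?_) ⟨le_rfl, hy⟩ ⟨hy, le_rfl⟩ hy
    have hx' := interior_subset hx
    have h1 := hmono ⟨le_rfl, hy⟩ hx' hx'.1
    simp only [h0, sub_self] at h1
    nlinarith [hf0 x hx'.1, hg0 x hx'.1]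
  have hall := pos_of_continuousOn_Ici (h.continuousOn_deriv.sub hg.continuousOn_deriv)
    (sub_pos.2 hlt) fun y hy hfy _ => (sub_pos.2 hlt).trans_le (key y hy.le hfy)
  obtain ⟨C, hC⟩ := h.bdd
  obtain ⟨C', hC'⟩ := hg.bdd
  obtain ⟨Y, hY, hfg⟩ := eventually_ge_of_le_deriv hd le_rfl (sub_pos.2 hlt)
    (fun x hx => key x hx.le fun z hz => hall z hz.1) (C + C' + 1)
  linarith [hfg Y le_rfl, (abs_le.1 (hC Y hY)).2, (abs_le.1 (hC' Y hY)).1]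

/-- Bounded nonnegative solutions with the same initial slope have the same initial value. -/
lemma zero_le {g g' : ℝ → ℝ} (h : BoundedSolution φ f f') (hg : BoundedSolution φ g g')
    (hg0 : ∀ x, 0 ≤ x → 0 ≤ g x) (h0 : f' 0 = g' 0) : f 0 ≤ g 0 := by
  by_contra! hlt
  have hd : ∀ x ∈ Ici (0:ℝ), HasDerivWithinAt (fun x => f x - g x) (f' x - g' x) (Ici 0) x :=
    fun x hx => (h.deriv₁ x hx).sub (hg.deriv₁ x hx)
  have hd' : ∀ x ∈ Ici (0:ℝ), HasDerivWithinAt (fun x => f' x - g' x)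
      ((f x ^ 2 - φ x) - (g x ^ 2 - φ x)) (Ici 0) x :=
    fun x hx => (h.deriv₂ x hx).sub (hg.deriv₂ x hx)
  have key : ∀ y, 0 ≤ y → (∀ x ∈ Ico 0 y, 0 < f x - g x) → f 0 - g 0 ≤ f y - g y := by
    intro y hy hfy
    have hmono : MonotoneOn (fun x => f' x - g' x) (Ico 0 y) :=
      monotoneOn_of_hasDerivWithinAt_Ici (convex_Ico 0 y) Ico_subset_Ici_self hd'
        (fun x hx => by
          have hx' := interior_subset hx
          nlinarith [hfy x hx', hg0 x hx'.1])
    refine monotoneOn_of_hasDerivWithinAt_Ici (convex_Icc 0 y) Icc_subset_Ici_self hd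
      (fun x hx => ?_) ⟨le_rfl, hy⟩ ⟨hy, le_rfl⟩ hy
    rw [interior_Icc] at hx
    have h1 := hmono ⟨le_rfl, hx.1.trans hx.2⟩ ⟨hx.1.le, hx.2⟩ hx.1.le
    simpa only [h0, sub_self] using h1
  have hall := pos_of_continuousOn_Ici (h.continuousOn.sub hg.continuousOn)
    (sub_pos.2 hlt) fun y hy hfy _ => (sub_pos.2 hlt).trans_le (key y hy.le hfy)
  have hge : ∀ x, 0 ≤ x → f 0 - g 0 ≤ f x - g x :=
    fun x hx => key x hx fun z hz => hall z hz.1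
  have hpos := sub_pos.2 hlt
  obtain ⟨C, hC⟩ := h.bdd
  obtain ⟨C', hC'⟩ := hg.bdd
  obtain ⟨X, hX, hX'⟩ := eventually_ge_of_le_deriv hd' le_rfl (pow_pos hpos 2)
    (fun x hx => by nlinarith [hge x hx.le, hg0 x hx.le]) 1
  obtain ⟨Y, hY, hfg⟩ := eventually_ge_of_le_deriv hd hX one_pos
    (fun x hx => hX' x hx.le) (C + C' + 1)
  linarith [hfg Y le_rfl, (abs_le.1 (hC Y (hX.trans hY))).2, (abs_le.1 (hC' Y (hX.trans hY))).1]

/-- A bounded solution lying above `-√φ`, strictly at `0`, with zero initial slope starts at a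
nonnegative value. -/
lemma zero_nonneg_of_deriv_eq_zero (h : BoundedSolution φ f f')
    (hlow : ∀ x, 0 ≤ x → -Real.sqrt (φ x) ≤ f x) (hlow0 : -Real.sqrt (φ 0) < f 0)
    (hφ : DecaysToZero φ) (h0 : f' 0 = 0) : 0 ≤ f 0 := by
  by_contra! hlt
  have hneg : f 0 ^ 2 - φ 0 < 0 := by
    have := Real.sq_sqrt (hφ.pos 0 le_rfl).le
    nlinarith
  have hcont : ContinuousWithinAt (fun x => f x ^ 2 - φ x) (Ici 0) 0 :=
    ((h.continuousOn 0 self_mem_Ici).pow 2).sub hφ.cont.continuousWithinAt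
  have hev := (hcont.eventually_lt_const hneg).and
    ((h.continuousOn 0 self_mem_Ici).eventually_lt_const hlt)
  obtain ⟨δ, hδ, hδ'⟩ := (mem_nhdsGE_iff_exists_Icc_subset).1 hev
  have hδ : 0 < δ := hδ
  have hanti : StrictAntiOn f' (Icc 0 δ) :=
    strictAntiOn_of_hasDerivWithinAt_neg (f' := fun x => f x ^ 2 - φ x) (convex_Icc 0 δ)
      (h.continuousOn_deriv.mono Icc_subset_Ici_self)
      (fun x hx => (h.deriv₂ x (interior_subset hx).1).mono
        (interior_subset.trans Icc_subset_Ici_self))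
      (fun x hx => (hδ' (interior_subset hx)).1)
  have h1 := hanti ⟨le_rfl, hδ.le⟩ ⟨hδ.le, le_rfl⟩ hδ
  have h2 := h.deriv_nonneg_of_nonpos hlow hφ hδ.le (hδ' ⟨hδ.le, le_rfl⟩).2.le
  linarith

end BoundedSolution

lemma decaysToZero_of_deriv_lt {φ : ℝ → ℝ} (hφ : ContDiff ℝ (⊤ : ℕ∞) φ) {c : ℝ} (hc : 0 < c)
    (hpos : ∀ x : ℝ, 0 < x → 0 < φ x)
    (hderiv : ∀ x : ℝ, 0 < x → deriv φ x < -(c * φ x ^ ((5 : ℝ) / 4))) : DecaysToZero φ := by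
  have hanti : StrictAntiOn φ (Ici 0) := by
    refine strictAntiOn_of_deriv_neg (convex_Ici 0) hφ.continuous.continuousOn fun x hx => ?_
    rw [interior_Ici] at hx
    have := mul_pos hc (Real.rpow_pos_of_pos (hpos x hx) (5 / 4))
    linarith [hderiv x hx]
  refine ⟨hφ.continuous, fun x hx => ?_, hanti.antitoneOn, fun ε hε => ?_⟩
  · have h1 : (0:ℝ) ≤ x + 1 := by linarith
    exact (hpos (x + 1) (by linarith)).trans (hanti hx h1 (by linarith))
  · by_contra! hcon
    have hge : ∀ x, 0 < x → ε ≤ φ x := by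
      intro x hx
      obtain ⟨y, hy, hy'⟩ := hcon x hx.le
      exact hy'.le.trans (hanti.antitoneOn hx.le (hx.le.trans hy) hy)
    obtain ⟨Y, hY, h⟩ := eventually_ge_of_le_deriv (f := fun x => -φ x)
      (f' := fun x => -deriv φ x)
      (fun x _ => ((hφ.differentiable (by simp)) x).hasDerivAt.hasDerivWithinAt.neg) le_rfl
      (mul_pos hc (Real.rpow_pos_of_pos hε (5 / 4))) (fun x hx => by
        have h1 : ε ^ ((5 : ℝ) / 4) ≤ φ x ^ ((5 : ℝ) / 4) :=
          Real.rpow_le_rpow hε.le (hge x hx) (by norm_num)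
        have h2 := mul_le_mul_of_nonneg_left h1 hc.le
        linarith [hderiv x hx]) 0
    have h1 := h (Y + 1) (by linarith)
    have h2 := hpos (Y + 1) (by linarith)
    linarith

/-- If `φ` decays fast enough, the curve `-k√φ` rises faster than any bounded solution can, so
every bounded solution lies above it. -/
lemma BoundedSolution.neg_mul_sqrt_le {φ f f' : ℝ → ℝ} (h : BoundedSolution φ f f')
    (hφ : DecaysToZero φ) (hdiff : Differentiable ℝ φ) {k D : ℝ} (hk : 0 < k) (hD : 1 < D)
    (hderiv : ∀ x : ℝ, 0 < x →
      deriv φ x < -(D * (4 * Real.sqrt 2 / (k * Real.sqrt 3)) * φ x ^ ((5 : ℝ) / 4)))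
    {x₀ : ℝ} (hx₀ : 0 ≤ x₀) : -(k * Real.sqrt (φ x₀)) ≤ f x₀ := by
  by_contra! hlt
  have hsub : Ici x₀ ⊆ Ici (0:ℝ) := Ici_subset_Ici.2 hx₀
  have hd : ∀ x ∈ Ici (0:ℝ), HasDerivWithinAt (fun x => -(k * Real.sqrt (φ x)) - f x)
      (-(k * (deriv φ x / (2 * Real.sqrt (φ x)))) - f' x) (Ici 0) x := fun x hx =>
    ((((hdiff x).hasDerivAt.sqrt (hφ.pos x hx).ne').const_mul k).neg.hasDerivWithinAt).sub
      (h.deriv₁ x hx)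
  have hmono : MonotoneOn (fun x => -(k * Real.sqrt (φ x)) - f x) (Ici x₀) := by
    refine monotoneOn_of_hasDerivWithinAt_Ici (convex_Ici x₀) hsub hd fun x hx => ?_
    rw [interior_Ici] at hx
    have hx0 : 0 < x := hx₀.trans_lt hx
    have hφx := hφ.pos x hx0.le
    obtain ⟨q, hq, hqφ⟩ : ∃ q : ℝ, 0 < q ∧ φ x = q ^ 4 :=
      ⟨φ x ^ ((1:ℝ) / 4), Real.rpow_pos_of_pos hφx _, by
        rw [← Real.rpow_natCast, ← Real.rpow_mul hφx.le]; norm_num⟩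
    have hsqrt : Real.sqrt (φ x) = q ^ 2 := by
      rw [hqφ, show q ^ 4 = (q ^ 2) ^ 2 by ring, Real.sqrt_sq (by positivity)]
    have hrpow : φ x ^ ((5 : ℝ) / 4) = q ^ 5 := by
      rw [hqφ, ← Real.rpow_natCast, ← Real.rpow_natCast, ← Real.rpow_mul hq.le]; norm_num
    set r := Real.sqrt 2 / Real.sqrt 3 with hr
    have hr0 : 0 < r := by positivity
    have hr2 : r ^ 2 = 2 / 3 := by
      rw [hr, div_pow, Real.sq_sqrt (by norm_num), Real.sq_sqrt (by norm_num)]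
    have hspeed : f' x ≤ 2 * r * q ^ 3 := by
      by_cases hf : 0 < f' x
      · have h1 := h.deriv_sq_le hφ hx0.le hf
        rw [hsqrt] at h1
        refine abs_le_of_sq_le_sq' ?_ (by positivity) |>.2
        calc f' x ^ 2 ≤ 8 / 3 * (q ^ 2) ^ 3 := h1
          _ = 4 * r ^ 2 * (q ^ 3) ^ 2 := by rw [hr2]; ring
          _ = _ := by ring
      · exact (not_lt.1 hf).trans (by positivity)
    have h1 := hderiv x hx0
    rw [hrpow, show 4 * Real.sqrt 2 / (k * Real.sqrt 3) = 4 * r / k by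
      rw [hr]; field_simp] at h1
    have h2 : D * (2 * r * q ^ 3) ≤ -(k * (deriv φ x / (2 * Real.sqrt (φ x)))) := by
      rw [hsqrt]
      calc D * (2 * r * q ^ 3) = k * ((D * (4 * r / k) * q ^ 5) / (2 * q ^ 2)) := by
            field_simp
            ring
        _ ≤ k * (-deriv φ x / (2 * q ^ 2)) := by
            gcongr
            linarith
        _ = _ := by ring
    have h3 : 0 < 2 * r * q ^ 3 := by positivity
    nlinarith
  set h₀ := -(k * Real.sqrt (φ x₀)) - f x₀ with hh₀
  have hh₀pos : 0 < h₀ := by linarith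
  obtain ⟨X, hX, hsmall⟩ := hφ.small (h₀ ^ 2 / 2) (by positivity)
  refine h.not_le_deriv₂ (hX.trans (le_max_left X x₀)) (m := h₀ ^ 2 / 2) (by positivity)
    fun x hx => ?_
  have hxX := (le_max_left X x₀).trans hx.le
  have hxx := (le_max_right X x₀).trans hx.le
  have h1 := hmono self_mem_Ici hxx hxx
  simp only [← hh₀] at h1
  have h2 := hsmall x hxX
  have h3 : 0 ≤ k * Real.sqrt (φ x) := by positivity
  nlinarith

section Existence

open MeasureTheory Topology

/-- The solution of `S'' = μ² S` which is `sinh (μ y)` for `σ = -1` and `cosh (μ y)` for `σ = 1`. -/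
noncomputable def hypS (σ μ y : ℝ) : ℝ := (Real.exp (μ * y) + σ * Real.exp (-(μ * y))) / 2

/-- The Green function of `-v'' + μ² v` on the half-line: `σ = -1` gives the Dirichlet and `σ = 1`
the Neumann boundary condition. -/
noncomputable def green (σ μ x y : ℝ) : ℝ :=
  Real.exp (-(μ * max x y)) * hypS σ μ (min x y) / μ

/-- One step of the monotone iteration for `v'' = v² - ψ`. -/
noncomputable def iter (σ μ α : ℝ) (ψ u : ℝ → ℝ) (x : ℝ) : ℝ :=
  α * Real.exp (-(μ * |x|)) +
    ∫ y in Ioi 0, green σ μ |x| y * (μ ^ 2 * u y - u y ^ 2 + ψ y)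

variable {σ μ α : ℝ}

lemma continuous_hypS : Continuous (hypS σ μ) := by
  unfold hypS
  fun_prop

lemma hasDerivAt_exp_mul (x : ℝ) :
    HasDerivAt (fun y => Real.exp (μ * y)) (μ * Real.exp (μ * x)) x := by
  have := ((hasDerivAt_id x).const_mul μ).exp
  refine this.congr_deriv ?_
  simp only [id]
  ring

lemma hasDerivAt_exp_neg_mul (x : ℝ) :
    HasDerivAt (fun y => Real.exp (-(μ * y))) (-(μ * Real.exp (-(μ * x)))) x := by
  have := hasDerivAt_exp_mul (μ := -μ) x
  simpa only [neg_mul] using this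

lemma hasDerivAt_hypS (x : ℝ) : HasDerivAt (hypS σ μ) (μ * hypS (-σ) μ x) x := by
  have := ((hasDerivAt_exp_mul (μ := μ) x).add
    ((hasDerivAt_exp_neg_mul (μ := μ) x).const_mul σ)).div_const 2
  refine this.congr_deriv ?_
  unfold hypS
  ring

lemma hypS_nonneg (hσ : |σ| ≤ 1) (hμ : 0 < μ) {y : ℝ} (hy : 0 ≤ y) : 0 ≤ hypS σ μ y := by
  unfold hypS
  have h1 : Real.exp (-(μ * y)) ≤ Real.exp (μ * y) :=
    Real.exp_le_exp.2 (by nlinarith [mul_nonneg hμ.le hy])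
  nlinarith [(abs_le.1 hσ).1, Real.exp_pos (-(μ * y))]

lemma hypS_le (hσ : |σ| ≤ 1) (hμ : 0 < μ) {y : ℝ} (hy : 0 ≤ y) :
    hypS σ μ y ≤ Real.exp (μ * y) := by
  unfold hypS
  have h1 : Real.exp (-(μ * y)) ≤ Real.exp (μ * y) :=
    Real.exp_le_exp.2 (by nlinarith [mul_nonneg hμ.le hy])
  nlinarith [(abs_le.1 hσ).2, Real.exp_pos (-(μ * y))]

lemma green_nonneg (hσ : |σ| ≤ 1) (hμ : 0 < μ) {x y : ℝ} (hx : 0 ≤ x) (hy : 0 ≤ y) :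
    0 ≤ green σ μ x y :=
  div_nonneg (mul_nonneg (Real.exp_pos _).le (hypS_nonneg hσ hμ (le_min hx hy))) hμ.le

lemma green_le (hσ : |σ| ≤ 1) (hμ : 0 < μ) {x y : ℝ} (hx : 0 ≤ x) (hy : 0 ≤ y) :
    green σ μ x y ≤ Real.exp (μ * x) / μ * Real.exp (-μ * y) := by
  have h1 : Real.exp (-(μ * max x y)) ≤ Real.exp (-μ * y) :=
    Real.exp_le_exp.2 (by nlinarith [mul_le_mul_of_nonneg_left (le_max_right x y) hμ.le])
  have h2 : hypS σ μ (min x y) ≤ Real.exp (μ * x) :=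
    (hypS_le hσ hμ (le_min hx hy)).trans
      (Real.exp_le_exp.2 (mul_le_mul_of_nonneg_left (min_le_left x y) hμ.le))
  unfold green
  rw [div_mul_eq_mul_div, mul_comm (Real.exp (μ * x))]
  exact div_le_div_of_nonneg_right
    (mul_le_mul h1 h2 (hypS_nonneg hσ hμ (le_min hx hy)) (Real.exp_pos _).le) hμ.le

lemma continuous_green : Continuous fun p : ℝ × ℝ => green σ μ |p.1| p.2 := by
  unfold green hypS
  fun_prop

variable {h : ℝ → ℝ} {C : ℝ}

lemma integrableOn_exp_neg_mul (hμ : 0 < μ) (hm : Measurable h) (hC : ∀ y, |h y| ≤ C) :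
    IntegrableOn (fun y => Real.exp (-(μ * y)) * h y) (Ioi 0) := by
  refine ((exp_neg_integrableOn_Ioi 0 hμ).mul_const C).mono'
    ((by fun_prop : Measurable _).aestronglyMeasurable) ?_
  filter_upwards with y
  rw [Real.norm_eq_abs, abs_mul, abs_of_pos (Real.exp_pos _), neg_mul]
  exact mul_le_mul_of_nonneg_left (hC y) (Real.exp_pos _).le

lemma norm_green_mul_le (hσ : |σ| ≤ 1) (hμ : 0 < μ) {x y c : ℝ} (hx : 0 ≤ x) (hy : 0 ≤ y)
    (hc : |c| ≤ C) :
    ‖green σ μ x y * c‖ ≤ Real.exp (μ * x) / μ * Real.exp (-μ * y) * C := by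
  rw [Real.norm_eq_abs, abs_mul, abs_of_nonneg (green_nonneg hσ hμ hx hy)]
  exact mul_le_mul (green_le hσ hμ hx hy) hc (abs_nonneg _) (by positivity)

lemma integrableOn_bound (hμ : 0 < μ) (x C : ℝ) :
    IntegrableOn (fun y => Real.exp (μ * x) / μ * Real.exp (-μ * y) * C) (Ioi 0) :=
  ((exp_neg_integrableOn_Ioi 0 hμ).const_mul _).mul_const C

lemma measurable_green_mul (hm : Measurable h) (x : ℝ) :
    Measurable fun y => green σ μ |x| y * h y :=
  (continuous_green.comp (by fun_prop : Continuous fun y : ℝ => (x, y))).measurable.mul hm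

lemma integrableOn_green_mul (hσ : |σ| ≤ 1) (hμ : 0 < μ) (hm : Measurable h)
    (hC : ∀ y, |h y| ≤ C) (x : ℝ) :
    IntegrableOn (fun y => green σ μ |x| y * h y) (Ioi 0) := by
  refine (integrableOn_bound hμ |x| C).mono' (measurable_green_mul hm x).aestronglyMeasurable ?_
  filter_upwards [ae_restrict_mem measurableSet_Ioi] with y hy
  exact norm_green_mul_le hσ hμ (abs_nonneg x) (le_of_lt hy) (hC y)

lemma intervalIntegrable_mul_of_bounded {s : ℝ → ℝ} (hs : Continuous s) (hm : Measurable h)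
    (hC : ∀ y, |h y| ≤ C) (a b : ℝ) : IntervalIntegrable (fun y => s y * h y) volume a b := by
  refine ((hs.abs.mul continuous_const).intervalIntegrable (μ := volume) a b).mono_fun'
    (g := fun y => |s y| * C) (hs.measurable.mul hm).aestronglyMeasurable ?_
  filter_upwards with y
  rw [Real.norm_eq_abs, abs_mul]
  exact mul_le_mul_of_nonneg_left (hC y) (abs_nonneg _)

/-- The Green potential of `h`, split at `x` into two one-sided integrals. -/
noncomputable def potential (σ μ : ℝ) (h : ℝ → ℝ) (x : ℝ) : ℝ :=
  (Real.exp (-(μ * x)) * (∫ y in (0:ℝ)..x, hypS σ μ y * h y) +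
    hypS σ μ x * ((∫ y in Ioi 0, Real.exp (-(μ * y)) * h y) -
      ∫ y in (0:ℝ)..x, Real.exp (-(μ * y)) * h y)) / μ

lemma integral_green_mul (hσ : |σ| ≤ 1) (hμ : 0 < μ) (hm : Measurable h)
    (hC : ∀ y, |h y| ≤ C) {x : ℝ} (hx : 0 ≤ x) :
    ∫ y in Ioi 0, green σ μ x y * h y = potential σ μ h x := by
  have hint := integrableOn_green_mul hσ hμ hm hC x
  rw [abs_of_nonneg hx] at hint
  have hexp := integrableOn_exp_neg_mul hμ hm hC
  have hsub : Ioi x ⊆ Ioi 0 := Ioi_subset_Ioi hx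
  rw [← intervalIntegral.integral_interval_add_Ioi hint (hint.mono_set hsub)]
  have h1 : ∫ y in (0:ℝ)..x, green σ μ x y * h y =
      Real.exp (-(μ * x)) / μ * ∫ y in (0:ℝ)..x, hypS σ μ y * h y := by
    rw [← intervalIntegral.integral_const_mul]
    refine intervalIntegral.integral_congr fun y hy => ?_
    rw [uIcc_of_le hx] at hy
    simp only [green, max_eq_left hy.2, min_eq_right hy.2]
    ring
  have h2 : ∫ y in Ioi x, green σ μ x y * h y =
      hypS σ μ x / μ * ∫ y in Ioi x, Real.exp (-(μ * y)) * h y := by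
    rw [← integral_const_mul]
    refine setIntegral_congr_fun measurableSet_Ioi fun y hy => ?_
    have hy : x ≤ y := le_of_lt hy
    simp only [green, max_eq_right hy, min_eq_left hy]
    ring
  rw [h1, h2, potential, ← intervalIntegral.integral_interval_add_Ioi hexp (hexp.mono_set hsub)]
  ring

lemma continuous_potential (hm : Measurable h) (hC : ∀ y, |h y| ≤ C) :
    Continuous (potential σ μ h) := by
  have h1 : Continuous fun x => ∫ y in (0:ℝ)..x, hypS σ μ y * h y :=
    intervalIntegral.continuous_primitive
      (intervalIntegrable_mul_of_bounded continuous_hypS hm hC) 0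
  have h2 : Continuous fun x => ∫ y in (0:ℝ)..x, Real.exp (-(μ * y)) * h y :=
    intervalIntegral.continuous_primitive
      (intervalIntegrable_mul_of_bounded (by fun_prop) hm hC) 0
  have h3 : Continuous (hypS σ μ) := continuous_hypS
  unfold potential
  fun_prop

/-- The derivative of `potential`. -/
noncomputable def potentialDeriv (σ μ : ℝ) (h : ℝ → ℝ) (x : ℝ) : ℝ :=
  -(Real.exp (-(μ * x)) * (∫ y in (0:ℝ)..x, hypS σ μ y * h y)) +
    hypS (-σ) μ x * ((∫ y in Ioi 0, Real.exp (-(μ * y)) * h y) -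
      ∫ y in (0:ℝ)..x, Real.exp (-(μ * y)) * h y)

lemma hasDerivAt_potential (hμ : 0 < μ) (hc : Continuous h) (x : ℝ) :
    HasDerivAt (potential σ μ h) (potentialDeriv σ μ h x) x := by
  have h1 : HasDerivAt (fun x => ∫ y in (0:ℝ)..x, hypS σ μ y * h y) (hypS σ μ x * h x) x :=
    (continuous_hypS.mul hc).integral_hasStrictDerivAt 0 x |>.hasDerivAt
  have h2 : HasDerivAt (fun x => ∫ y in (0:ℝ)..x, Real.exp (-(μ * y)) * h y)
      (Real.exp (-(μ * x)) * h x) x :=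
    ((by fun_prop : Continuous fun y => Real.exp (-(μ * y))).mul hc).integral_hasStrictDerivAt 0 x
      |>.hasDerivAt
  have := (((hasDerivAt_exp_neg_mul (μ := μ) x).mul h1).add ((hasDerivAt_hypS (σ := σ) (μ := μ) x).mul
    (h2.const_sub (∫ y in Ioi 0, Real.exp (-(μ * y)) * h y)))).div_const μ
  refine this.congr_deriv ?_
  unfold potentialDeriv
  field_simp
  ring

lemma hasDerivAt_potentialDeriv (hc : Continuous h) (x : ℝ) :
    HasDerivAt (potentialDeriv σ μ h) (μ ^ 2 * potential σ μ h x - h x) x := by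
  have h1 : HasDerivAt (fun x => ∫ y in (0:ℝ)..x, hypS σ μ y * h y) (hypS σ μ x * h x) x :=
    (continuous_hypS.mul hc).integral_hasStrictDerivAt 0 x |>.hasDerivAt
  have h2 : HasDerivAt (fun x => ∫ y in (0:ℝ)..x, Real.exp (-(μ * y)) * h y)
      (Real.exp (-(μ * x)) * h x) x :=
    ((by fun_prop : Continuous fun y => Real.exp (-(μ * y))).mul hc).integral_hasStrictDerivAt 0 x
      |>.hasDerivAt
  have := ((hasDerivAt_exp_neg_mul (μ := μ) x).mul h1).neg.add
    ((hasDerivAt_hypS (σ := -σ) (μ := μ) x).mul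
    (h2.const_sub (∫ y in Ioi 0, Real.exp (-(μ * y)) * h y)))
  refine this.congr_deriv ?_
  have hprod : Real.exp (μ * x) * Real.exp (-(μ * x)) = 1 := by
    rw [← Real.exp_add, add_neg_cancel, Real.exp_zero]
  have hsum : hypS σ μ x + hypS (-σ) μ x = Real.exp (μ * x) := by
    unfold hypS
    ring
  rw [← hsum] at hprod
  unfold potential
  field_simp
  linear_combination (-h x) * hprod

lemma potential_one (hμ : 0 < μ) (x : ℝ) :
    potential σ μ (fun _ => 1) x = (1 - (1 - σ) / 2 * Real.exp (-(μ * x))) / μ ^ 2 := by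
  have h1 : ∫ y in (0:ℝ)..x, hypS σ μ y * 1 = hypS (-σ) μ x / μ - hypS (-σ) μ 0 / μ := by
    refine intervalIntegral.integral_eq_sub_of_hasDerivAt (f := fun y => hypS (-σ) μ y / μ)
      (fun y _ => ?_) ((continuous_hypS.mul continuous_const).intervalIntegrable _ _)
    refine ((hasDerivAt_hypS y).div_const μ).congr_deriv ?_
    rw [neg_neg]
    field_simp
  have h2 : ∫ y in (0:ℝ)..x, Real.exp (-(μ * y)) * 1 =
      -Real.exp (-(μ * x)) / μ - -Real.exp (-(μ * 0)) / μ := by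
    refine intervalIntegral.integral_eq_sub_of_hasDerivAt
      (f := fun y => -Real.exp (-(μ * y)) / μ)
      (fun y _ => ?_) ((by fun_prop : Continuous _).intervalIntegrable _ _)
    refine ((hasDerivAt_exp_neg_mul y).neg.div_const μ).congr_deriv ?_
    field_simp
  have h3 : ∫ y in Ioi (0:ℝ), Real.exp (-(μ * y)) * 1 = 1 / μ := by
    have := integral_exp_mul_Ioi (neg_lt_zero.2 hμ) 0
    simpa only [neg_mul, mul_one, mul_zero, neg_zero, Real.exp_zero, neg_div_neg_eq] using this
  have hprod : Real.exp (μ * x) * Real.exp (-(μ * x)) = 1 := by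
    rw [← Real.exp_add, add_neg_cancel, Real.exp_zero]
  rw [potential, h1, h2, h3]
  unfold hypS
  simp only [mul_zero, neg_zero, Real.exp_zero]
  field_simp
  linear_combination 2 * hprod

/-! ### Monotone iteration -/

variable {ψ u v : ℝ → ℝ}

lemma source_nonneg_s12 (hψ0 : ∀ y, 0 ≤ ψ y) (hu0 : ∀ y, 0 ≤ u y) (hu1 : ∀ y, u y ≤ μ ^ 2 / 2)
    (y : ℝ) : 0 ≤ μ ^ 2 * u y - u y ^ 2 + ψ y := by
  nlinarith [hψ0 y, hu0 y, hu1 y, mul_nonneg (hu0 y) (sub_nonneg.2 (hu1 y))]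

lemma source_le_s12 (hψ1 : ∀ y, ψ y ≤ (μ ^ 2 / 2) ^ 2) (y : ℝ) :
    μ ^ 2 * u y - u y ^ 2 + ψ y ≤ μ ^ 4 / 2 := by
  nlinarith [hψ1 y, sq_nonneg (u y - μ ^ 2 / 2)]

lemma abs_source_le (hψ0 : ∀ y, 0 ≤ ψ y) (hψ1 : ∀ y, ψ y ≤ (μ ^ 2 / 2) ^ 2)
    (hu0 : ∀ y, 0 ≤ u y) (hu1 : ∀ y, u y ≤ μ ^ 2 / 2) (y : ℝ) :
    |μ ^ 2 * u y - u y ^ 2 + ψ y| ≤ μ ^ 4 / 2 :=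
  (abs_of_nonneg (source_nonneg_s12 hψ0 hu0 hu1 y)).trans_le (source_le_s12 hψ1 y)

lemma measurable_source_s12 (hψ : Continuous ψ) (hu : Measurable u) :
    Measurable fun y => μ ^ 2 * u y - u y ^ 2 + ψ y := by
  have := hψ.measurable
  fun_prop

lemma measurable_iter (hψ : Continuous ψ) (hu : Measurable u) :
    Measurable (iter σ μ α ψ u) := by
  have h1 : Measurable fun p : ℝ × ℝ =>
      green σ μ |p.1| p.2 * (μ ^ 2 * u p.2 - u p.2 ^ 2 + ψ p.2) :=
    continuous_green.measurable.mul ((measurable_source_s12 hψ hu).comp measurable_snd)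
  have h2 := (StronglyMeasurable.integral_prod_right (ν := volume.restrict (Ioi (0:ℝ)))
    (f := fun x y => green σ μ |x| y * (μ ^ 2 * u y - u y ^ 2 + ψ y))
    h1.stronglyMeasurable).measurable
  unfold iter
  exact (by fun_prop : Measurable fun x : ℝ => α * Real.exp (-(μ * |x|))).add h2

lemma iter_nonneg (hσ : |σ| ≤ 1) (hμ : 0 < μ) (hα : 0 ≤ α) (hψ0 : ∀ y, 0 ≤ ψ y)
    (hu0 : ∀ y, 0 ≤ u y) (hu1 : ∀ y, u y ≤ μ ^ 2 / 2) (x : ℝ) : 0 ≤ iter σ μ α ψ u x :=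
  add_nonneg (mul_nonneg hα (Real.exp_pos _).le)
    (setIntegral_nonneg measurableSet_Ioi fun y hy =>
      mul_nonneg (green_nonneg hσ hμ (abs_nonneg x) (le_of_lt hy))
        (source_nonneg_s12 hψ0 hu0 hu1 y))

lemma iter_mono (hσ : |σ| ≤ 1) (hμ : 0 < μ) (hψ : Continuous ψ) (hψ0 : ∀ y, 0 ≤ ψ y)
    (hψ1 : ∀ y, ψ y ≤ (μ ^ 2 / 2) ^ 2) (hu : Measurable u) (hv : Measurable v)
    (hu0 : ∀ y, 0 ≤ u y) (huv : ∀ y, u y ≤ v y) (hv1 : ∀ y, v y ≤ μ ^ 2 / 2) (x : ℝ) :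
    iter σ μ α ψ u x ≤ iter σ μ α ψ v x := by
  refine add_le_add le_rfl (setIntegral_mono_on
    (integrableOn_green_mul hσ hμ (measurable_source_s12 hψ hu)
      (abs_source_le hψ0 hψ1 hu0 fun y => (huv y).trans (hv1 y)) x)
    (integrableOn_green_mul hσ hμ (measurable_source_s12 hψ hv)
      (abs_source_le hψ0 hψ1 (fun y => (hu0 y).trans (huv y)) hv1) x)
    measurableSet_Ioi fun y hy => mul_le_mul_of_nonneg_left ?_
      (green_nonneg hσ hμ (abs_nonneg x) (le_of_lt hy)))
  nlinarith [mul_nonneg (sub_nonneg.2 (huv y))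
    (show 0 ≤ μ ^ 2 - u y - v y by linarith [huv y, hv1 y])]

lemma iter_le (hσ : |σ| ≤ 1) (hμ : 0 < μ) (hα1 : α ≤ μ ^ 2 / 2 * ((1 - σ) / 2))
    (hψ : Continuous ψ) (hψ0 : ∀ y, 0 ≤ ψ y)
    (hψ1 : ∀ y, ψ y ≤ (μ ^ 2 / 2) ^ 2) (hu : Measurable u)
    (hu0 : ∀ y, 0 ≤ u y) (hu1 : ∀ y, u y ≤ μ ^ 2 / 2) (x : ℝ) :
    iter σ μ α ψ u x ≤ μ ^ 2 / 2 := by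
  have h1 : ∫ y in Ioi 0, green σ μ |x| y * (μ ^ 2 * u y - u y ^ 2 + ψ y) ≤
      ∫ y in Ioi 0, green σ μ |x| y * 1 * (μ ^ 4 / 2) := by
    refine setIntegral_mono_on (integrableOn_green_mul hσ hμ (measurable_source_s12 hψ hu)
      (abs_source_le hψ0 hψ1 hu0 hu1) x)
      ((integrableOn_green_mul (C := 1) hσ hμ measurable_const (by simp) x).mul_const _)
      measurableSet_Ioi fun y hy => ?_
    rw [mul_one]
    exact mul_le_mul_of_nonneg_left (source_le_s12 hψ1 y)
      (green_nonneg hσ hμ (abs_nonneg x) (le_of_lt hy))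
  rw [integral_mul_const, integral_green_mul (C := 1) hσ hμ measurable_const (by simp)
    (abs_nonneg x), potential_one hμ] at h1
  have h2 : (1 - (1 - σ) / 2 * Real.exp (-(μ * |x|))) / μ ^ 2 * (μ ^ 4 / 2) =
      μ ^ 2 / 2 - μ ^ 2 / 2 * ((1 - σ) / 2) * Real.exp (-(μ * |x|)) := by
    field_simp
  have h3 := mul_le_mul_of_nonneg_right hα1 (Real.exp_pos (-(μ * |x|))).le
  unfold iter
  linarith

/-- The limit of the monotone iteration started at `0`. -/
lemma exists_fixedPoint_iter (hσ : |σ| ≤ 1) (hμ : 0 < μ) (hα : 0 ≤ α)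
    (hα1 : α ≤ μ ^ 2 / 2 * ((1 - σ) / 2)) (hψ : Continuous ψ) (hψ0 : ∀ y, 0 ≤ ψ y)
    (hψ1 : ∀ y, ψ y ≤ (μ ^ 2 / 2) ^ 2) :
    ∃ u : ℝ → ℝ, Measurable u ∧ (∀ y, 0 ≤ u y) ∧ (∀ y, u y ≤ μ ^ 2 / 2) ∧
      ∀ x, u x = iter σ μ α ψ u x := by
  set w : ℕ → ℝ → ℝ := fun n => (iter σ μ α ψ)^[n] 0 with hw
  have hsucc : ∀ n, w (n + 1) = iter σ μ α ψ (w n) := fun n =>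
    Function.iterate_succ_apply' _ _ _
  have hinv : ∀ n, Measurable (w n) ∧ (∀ y, 0 ≤ w n y) ∧ ∀ y, w n y ≤ μ ^ 2 / 2 := by
    intro n
    induction n with
    | zero => exact ⟨measurable_const, fun y => le_rfl, fun y => by
        change (0:ℝ) ≤ _
        positivity⟩
    | succ n ih =>
      rw [hsucc]
      exact ⟨measurable_iter hψ ih.1, iter_nonneg hσ hμ hα hψ0 ih.2.1 ih.2.2,
        iter_le hσ hμ hα1 hψ hψ0 hψ1 ih.1 ih.2.1 ih.2.2⟩
  have hstep : ∀ n y, w n y ≤ w (n + 1) y := by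
    intro n
    induction n with
    | zero => exact fun y => (hinv 1).2.1 y
    | succ n ih =>
      intro y
      rw [hsucc n, hsucc (n + 1)]
      exact iter_mono hσ hμ hψ hψ0 hψ1 (hinv n).1 (hinv (n + 1)).1 (hinv n).2.1 ih
        (hinv (n + 1)).2.2 y
  have hbdd : ∀ y, BddAbove (range fun n => w n y) := fun y =>
    ⟨μ ^ 2 / 2, by rintro _ ⟨n, rfl⟩; exact (hinv n).2.2 y⟩
  have hlim : ∀ y, Tendsto (fun n => w n y) atTop (𝓝 (⨆ n, w n y)) := fun y =>
    tendsto_atTop_ciSup (monotone_nat_of_le_succ fun n => hstep n y) (hbdd y)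
  refine ⟨fun y => ⨆ n, w n y, Measurable.iSup fun n => (hinv n).1,
    fun y => ge_of_tendsto' (hlim y) fun n => (hinv n).2.1 y,
    fun y => le_of_tendsto' (hlim y) fun n => (hinv n).2.2 y, fun x => ?_⟩
  have h1 : Tendsto (fun n => w (n + 1) x) atTop (𝓝 (⨆ n, w n x)) :=
    (tendsto_add_atTop_iff_nat 1).2 (hlim x)
  refine tendsto_nhds_unique h1 ?_
  simp only [hsucc]
  refine Tendsto.const_add _ (tendsto_integral_of_dominated_convergence
    (fun y => Real.exp (μ * |x|) / μ * Real.exp (-μ * y) * (μ ^ 4 / 2))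
    (fun n => (measurable_green_mul (measurable_source_s12 hψ (hinv n).1) x).aestronglyMeasurable)
    (integrableOn_bound hμ |x| _) (fun n => ?_) ?_)
  · filter_upwards [ae_restrict_mem measurableSet_Ioi] with y hy
    exact norm_green_mul_le hσ hμ (abs_nonneg x) (le_of_lt hy)
      (abs_source_le hψ0 hψ1 (hinv n).2.1 (hinv n).2.2 y)
  · filter_upwards with y
    exact (((hlim y).const_mul _).sub ((hlim y).pow 2)).add_const _ |>.const_mul _

lemma exists_boundedSolution_of_iter (hσ : |σ| ≤ 1) (hμ : 0 < μ) (hα : 0 ≤ α)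
    (hα1 : α ≤ μ ^ 2 / 2 * ((1 - σ) / 2)) (hψ : Continuous ψ) (hψ0 : ∀ y, 0 ≤ ψ y)
    (hψ1 : ∀ y, ψ y ≤ (μ ^ 2 / 2) ^ 2) :
    ∃ f f' Q, BoundedSolution ψ f f' ∧ f 0 = α + (1 + σ) / 2 * Q / μ ∧
      f' 0 = -(μ * α) + (1 - σ) / 2 * Q := by
  obtain ⟨u, hu, hu0, hu1, hfix⟩ := exists_fixedPoint_iter hσ hμ hα hα1 hψ hψ0 hψ1
  set h : ℝ → ℝ := fun y => μ ^ 2 * u y - u y ^ 2 + ψ y with hh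
  have hm : Measurable h := measurable_source_s12 hψ hu
  have hb := abs_source_le hψ0 hψ1 hu0 hu1
  set f : ℝ → ℝ := fun x => α * Real.exp (-(μ * x)) + potential σ μ h x with hf
  have huf : ∀ x, u x = f |x| := by
    intro x
    rw [hfix x, iter, integral_green_mul hσ hμ hm hb (abs_nonneg x)]
  have hpot : Continuous (potential σ μ h) := continuous_potential hm hb
  have hfc : Continuous f := by fun_prop
  have hc : Continuous h := by
    have : Continuous u := by
      rw [funext huf]
      exact hfc.comp continuous_abs
    fun_prop
  have huf' : ∀ x, 0 ≤ x → u x = f x := fun x hx => by rw [huf, abs_of_nonneg hx]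
  refine ⟨f, fun x => α * -(μ * Real.exp (-(μ * x))) + potentialDeriv σ μ h x,
    ∫ y in Ioi 0, Real.exp (-(μ * y)) * h y, ⟨⟨μ ^ 2 / 2, fun x hx => ?_⟩, fun x hx => ?_,
    fun x hx => ?_⟩, ?_, ?_⟩
  · rw [← huf' x hx, abs_of_nonneg (hu0 x)]
    exact hu1 x
  · exact (((hasDerivAt_exp_neg_mul x).const_mul α).add
      (hasDerivAt_potential hμ hc x)).hasDerivWithinAt
  · refine (((((hasDerivAt_exp_neg_mul x).const_mul μ).neg.const_mul α).add
      (hasDerivAt_potentialDeriv hc x)).congr_deriv ?_).hasDerivWithinAt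
    simp only [hh, huf' x hx]
    simp only [hf]
    ring
  · simp [hf, potential, hypS]
  · simp [potentialDeriv, hypS]
    ring

end Existence

lemma DecaysToZero.exists_boundedSolution {φ : ℝ → ℝ} (hφ : DecaysToZero φ) {σ μ α : ℝ}
    (hσ : |σ| ≤ 1) (hμ : 0 < μ) (hα : 0 ≤ α) (hα1 : α ≤ μ ^ 2 / 2 * ((1 - σ) / 2))
    (hφμ : φ 0 ≤ (μ ^ 2 / 2) ^ 2) :
    ∃ f f' Q, BoundedSolution φ f f' ∧ f 0 = α + (1 + σ) / 2 * Q / μ ∧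
      f' 0 = -(μ * α) + (1 - σ) / 2 * Q := by
  obtain ⟨f, f', Q, h, h0⟩ := exists_boundedSolution_of_iter (ψ := fun y => φ |y|) hσ hμ hα hα1
    (hφ.cont.comp continuous_abs) (fun y => (hφ.pos _ (abs_nonneg y)).le)
    (fun y => (hφ.anti self_mem_Ici (abs_nonneg y) (abs_nonneg y)).trans hφμ)
  refine ⟨f, f', Q, ⟨h.bdd, h.deriv₁, fun x hx => ?_⟩, h0⟩
  have := h.deriv₂ x hx
  rwa [abs_of_nonneg hx] at this

/-- A bounded solution with any prescribed nonnegative initial value. -/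
lemma DecaysToZero.exists_boundedSolution_zero_eq {φ : ℝ → ℝ} (hφ : DecaysToZero φ) {a : ℝ}
    (ha : 0 ≤ a) : ∃ f f', BoundedSolution φ f f' ∧ f 0 = a := by
  have hs := Real.sqrt_pos.2 (hφ.pos 0 le_rfl)
  have hsq := Real.sq_sqrt (hφ.pos 0 le_rfl).le
  have hμ : Real.sqrt (2 * (a + Real.sqrt (φ 0))) ^ 2 = 2 * (a + Real.sqrt (φ 0)) :=
    Real.sq_sqrt (by positivity)
  obtain ⟨f, f', Q, h, h0, -⟩ := hφ.exists_boundedSolution (σ := -1)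
    (μ := Real.sqrt (2 * (a + Real.sqrt (φ 0)))) (α := a) (by simp)
    (Real.sqrt_pos.2 (by positivity)) ha (by rw [hμ]; linarith) (by rw [hμ]; nlinarith)
  exact ⟨f, f', h, by simpa using h0⟩

/-- A bounded solution with zero initial slope. -/
lemma DecaysToZero.exists_boundedSolution_deriv_eq_zero {φ : ℝ → ℝ} (hφ : DecaysToZero φ) :
    ∃ f f', BoundedSolution φ f f' ∧ f' 0 = 0 := by
  have hs := Real.sqrt_pos.2 (hφ.pos 0 le_rfl)
  have hsq := Real.sq_sqrt (hφ.pos 0 le_rfl).le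
  have hμ : Real.sqrt (2 * Real.sqrt (φ 0)) ^ 2 = 2 * Real.sqrt (φ 0) :=
    Real.sq_sqrt (by positivity)
  obtain ⟨f, f', Q, h, -, h0⟩ := hφ.exists_boundedSolution (σ := 1)
    (μ := Real.sqrt (2 * Real.sqrt (φ 0))) (α := 0) (by simp)
    (Real.sqrt_pos.2 (by positivity)) le_rfl (by simp) (by rw [hμ]; nlinarith)
  exact ⟨f, f', h, by simpa using h0⟩

/-- If `φ > 0` and `φ' < −D·(4√2/(k√3))·φ^{5/4}` on `(0,∞)` for constants
`0 < k < 1`, `D > 1`, then: (i) every `(a,b) ∈ Z` has `a ≥ −k√(φ(0))`; (ii) each vertical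
line over `a ≥ 0` meets `Z` exactly once; (iii) each horizontal line meets `Z` at most once
among points with nonnegative first coordinate; and (iv) `Z` meets `{b = 0}` exactly once. -/
theorem stmt12 (φ : ℝ → ℝ) (hφ : ContDiff ℝ (⊤ : ℕ∞) φ)
    (k D : ℝ) (hk0 : 0 < k) (hk1 : k < 1) (hD : 1 < D)
    (hφpos : ∀ x : ℝ, 0 < x → 0 < φ x)
    (hφ' : ∀ x : ℝ, 0 < x →
      deriv φ x < -(D * (4 * Real.sqrt 2 / (k * Real.sqrt 3)) * φ x ^ ((5 : ℝ) / 4))) :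
    (∀ p ∈ Zset φ, -(k * Real.sqrt (φ 0)) ≤ p.1) ∧
    (∀ a : ℝ, 0 ≤ a → ∃! b : ℝ, (a, b) ∈ Zset φ) ∧
    (∀ a₁ a₂ b : ℝ, 0 ≤ a₁ → 0 ≤ a₂ → (a₁, b) ∈ Zset φ → (a₂, b) ∈ Zset φ → a₁ = a₂) ∧
    (∃! a : ℝ, (a, (0 : ℝ)) ∈ Zset φ) := by
  have hdec : DecaysToZero φ := decaysToZero_of_deriv_lt hφ (by positivity) hφpos hφ'
  have hlow : ∀ {f f' : ℝ → ℝ}, BoundedSolution φ f f' → ∀ x, 0 ≤ x →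
      -(k * Real.sqrt (φ x)) ≤ f x := fun h x hx =>
    h.neg_mul_sqrt_le hdec (hφ.differentiable (by simp)) hk0 hD hφ' hx
  have hlow' : ∀ {f f' : ℝ → ℝ}, BoundedSolution φ f f' → ∀ x, 0 ≤ x →
      -Real.sqrt (φ x) ≤ f x := fun h x hx => by
    nlinarith [hlow h x hx, Real.sqrt_nonneg (φ x)]
  have hnn : ∀ {f f' : ℝ → ℝ}, BoundedSolution φ f f' → 0 ≤ f 0 → ∀ x, 0 ≤ x → 0 ≤ f x :=
    fun h h0 x hx => h.nonneg (hlow' h) hdec h0 hx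
  have hhor : ∀ a₁ a₂ b : ℝ, 0 ≤ a₁ → 0 ≤ a₂ → (a₁, b) ∈ Zset φ → (a₂, b) ∈ Zset φ →
      a₁ = a₂ := by
    intro a₁ a₂ b ha₁ ha₂ h₁ h₂
    obtain ⟨f, f', hf, rfl, rfl⟩ := mem_Zset_iff.1 h₁
    obtain ⟨g, g', hg, rfl, hfg⟩ := mem_Zset_iff.1 h₂
    exact le_antisymm (hf.zero_le hg (hnn hg ha₂) hfg.symm) (hg.zero_le hf (hnn hf ha₁) hfg)
  refine ⟨?_, ?_, hhor, ?_⟩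
  · rintro ⟨a, b⟩ hp
    obtain ⟨f, f', hf, rfl, -⟩ := mem_Zset_iff.1 hp
    exact hlow hf 0 le_rfl
  · intro a ha
    obtain ⟨f, f', hf, rfl⟩ := hdec.exists_boundedSolution_zero_eq ha
    refine ⟨f' 0, mem_Zset_iff.2 ⟨f, f', hf, rfl, rfl⟩, fun b hb => ?_⟩
    obtain ⟨g, g', hg, hg0, rfl⟩ := mem_Zset_iff.1 hb
    have hgn := hnn hg (hg0 ▸ ha)
    have hfn := hnn hf ha
    exact le_antisymm (hg.deriv_zero_le hf hgn hfn hg0) (hf.deriv_zero_le hg hfn hgn hg0.symm)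
  · have hpos : ∀ a : ℝ, (a, (0:ℝ)) ∈ Zset φ → 0 ≤ a := by
      intro a ha
      obtain ⟨f, f', hf, rfl, h0⟩ := mem_Zset_iff.1 ha
      refine hf.zero_nonneg_of_deriv_eq_zero (hlow' hf) ?_ hdec h0
      nlinarith [hlow hf 0 le_rfl, Real.sqrt_pos.2 (hdec.pos 0 le_rfl)]
    obtain ⟨f, f', hf, h0⟩ := hdec.exists_boundedSolution_deriv_eq_zero
    have hmem : (f 0, (0:ℝ)) ∈ Zset φ := mem_Zset_iff.2 ⟨f, f', hf, rfl, h0⟩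
    exact ⟨f 0, hmem, fun a ha => hhor a (f 0) 0 (hpos a ha) (hpos _ hmem) ha hmem⟩
end

section
/- If f : [0,∞) → ℝ is bounded, twice continuously differentiable, and satisfies f''(x) = f(x)² − φ(x) for all x ≥ 0, then f'(0) ≤ √(8/3) · ‖φ‖∞^{3/4}. -/
open Set Filter

/-- The positive part of `m² - s²` has total mass `4m³/3`. -/
theorem integral_max_sq_sub_sq_le {m : ℝ} (hm : 0 ≤ m) {a b : ℝ} (hab : a ≤ b) :
    ∫ s in a..b, max (m ^ 2 - s ^ 2) 0 ≤ 4 / 3 * m ^ 3 := by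
  have hg : Continuous fun s : ℝ => max (m ^ 2 - s ^ 2) 0 := by fun_prop
  have hi : ∀ u v : ℝ, IntervalIntegrable (fun s : ℝ => max (m ^ 2 - s ^ 2) 0)
      MeasureTheory.volume u v := fun u v => hg.intervalIntegrable u v
  have hmono : ∫ s in a..b, max (m ^ 2 - s ^ 2) 0 ≤
      ∫ s in (min a (-m))..(max b m), max (m ^ 2 - s ^ 2) 0 :=
    intervalIntegral.integral_mono_interval (min_le_left _ _) hab (le_max_left _ _)
      (Eventually.of_forall fun s => le_max_right _ _) (hi _ _)
  have hleft : ∫ s in (min a (-m))..(-m), max (m ^ 2 - s ^ 2) 0 = 0 := by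
    rw [intervalIntegral.integral_congr (g := fun _ => (0 : ℝ)), intervalIntegral.integral_zero]
    intro s hs
    rw [uIcc_of_le (min_le_right _ _)] at hs
    exact max_eq_right (by nlinarith [hs.2])
  have hright : ∫ s in m..(max b m), max (m ^ 2 - s ^ 2) 0 = 0 := by
    rw [intervalIntegral.integral_congr (g := fun _ => (0 : ℝ)), intervalIntegral.integral_zero]
    intro s hs
    rw [uIcc_of_le (le_max_right _ _)] at hs
    exact max_eq_right (by nlinarith [hs.1])
  have hmid : ∫ s in (-m)..m, max (m ^ 2 - s ^ 2) 0 = 4 / 3 * m ^ 3 := by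
    rw [intervalIntegral.integral_congr (g := fun s => m ^ 2 - s ^ 2)]
    · rw [intervalIntegral.integral_sub (by simp) ((continuous_pow 2).intervalIntegrable _ _)]
      simp
      ring
    · intro s hs
      rw [uIcc_of_le (by linarith)] at hs
      exact max_eq_left (by nlinarith [hs.1, hs.2])
  rw [← intervalIntegral.integral_add_adjacent_intervals (hi (min a (-m)) (-m)) (hi (-m) (max b m)),
    ← intervalIntegral.integral_add_adjacent_intervals (hi (-m) m) (hi m (max b m)),
    hleft, hmid, hright] at hmono
  linarith

/-- As long as `f' ≥ 0`, a solution of `f'' ≥ f² - m²` satisfies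
`f'(0)² - 8m³/3 ≤ f'(T)²`. -/
theorem sq_deriv_sub_le_sq_deriv {f f' f'' : ℝ → ℝ} {m T : ℝ} (hm : 0 ≤ m) (hT : 0 ≤ T)
    (hf : ∀ x ∈ Ici (0 : ℝ), HasDerivWithinAt f (f' x) (Ici 0) x)
    (hf' : ∀ x ∈ Ici (0 : ℝ), HasDerivWithinAt f' (f'' x) (Ici 0) x)
    (hf'' : ∀ x ∈ Ici (0 : ℝ), f x ^ 2 - m ^ 2 ≤ f'' x)
    (hpos : ∀ x ∈ Ico 0 T, 0 ≤ f' x) :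
    f' 0 ^ 2 - 8 / 3 * m ^ 3 ≤ f' T ^ 2 := by
  have hg : Continuous fun s : ℝ => max (m ^ 2 - s ^ 2) 0 := by fun_prop
  have hG : ∀ y, HasDerivAt (fun y => ∫ s in (f 0)..y, max (m ^ 2 - s ^ 2) 0)
      (max (m ^ 2 - y ^ 2) 0) y := fun y =>
    intervalIntegral.integral_hasDerivAt_right (hg.intervalIntegrable _ _)
      (hg.stronglyMeasurableAtFilter _ _) hg.continuousAt
  have hsub : Icc 0 T ⊆ Ici (0 : ℝ) := fun x hx => hx.1
  have hint : ∀ x ∈ interior (Icc 0 T), x ∈ Ioo 0 T := fun x hx => by rwa [interior_Icc] at hx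
  have hfm : MonotoneOn f (Icc 0 T) := by
    refine monotoneOn_of_hasDerivWithinAt_nonneg (convex_Icc 0 T)
      (fun x hx => ((hf x hx.1).mono hsub).continuousWithinAt)
      (fun x hx => (hf x (hint x hx).1.le).mono (interior_subset.trans hsub)) ?_
    exact fun x hx => hpos x ⟨(hint x hx).1.le, (hint x hx).2⟩
  have hE : ∀ x ∈ Ici (0 : ℝ), HasDerivWithinAt
      (fun x => f' x ^ 2 / 2 + ∫ s in (f 0)..(f x), max (m ^ 2 - s ^ 2) 0)
      (f' x * (f'' x + max (m ^ 2 - f x ^ 2) 0)) (Ici 0) x := by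
    intro x hx
    refine ((((hf' x hx).pow 2).div_const 2).add
      ((hG (f x)).comp_hasDerivWithinAt x (hf x hx))).congr_deriv ?_
    push_cast
    ring
  have hEm : MonotoneOn
      (fun x => f' x ^ 2 / 2 + ∫ s in (f 0)..(f x), max (m ^ 2 - s ^ 2) 0) (Icc 0 T) := by
    refine monotoneOn_of_hasDerivWithinAt_nonneg (convex_Icc 0 T)
      (fun x hx => ((hE x hx.1).mono hsub).continuousWithinAt)
      (fun x hx => (hE x (hint x hx).1.le).mono (interior_subset.trans hsub)) ?_
    intro x hx
    refine mul_nonneg (hpos x ⟨(hint x hx).1.le, (hint x hx).2⟩) ?_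
    linarith [hf'' x (hint x hx).1.le, le_max_left (m ^ 2 - f x ^ 2) 0]
  have h0 : (0 : ℝ) ∈ Icc 0 T := ⟨le_rfl, hT⟩
  have hT' : T ∈ Icc 0 T := ⟨hT, le_rfl⟩
  have h1 := hEm h0 hT' hT
  have h2 := integral_max_sq_sub_sq_le hm (hfm h0 hT' hT)
  simp only [intervalIntegral.integral_same] at h1
  linarith

/-- A bounded solution of `f'' ≥ f² - m²` on `[0,∞)` with `f'(0) ≥ 0` has
`f'(0)² ≤ 8m³/3`. -/
theorem sq_deriv_zero_le_of_bounded {f f' f'' : ℝ → ℝ} {m : ℝ} (hm : 0 ≤ m)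
    (hf : ∀ x ∈ Ici (0 : ℝ), HasDerivWithinAt f (f' x) (Ici 0) x)
    (hf' : ∀ x ∈ Ici (0 : ℝ), HasDerivWithinAt f' (f'' x) (Ici 0) x)
    (hf'' : ∀ x ∈ Ici (0 : ℝ), f x ^ 2 - m ^ 2 ≤ f'' x)
    (hbd : ∃ C : ℝ, ∀ x ∈ Ici (0 : ℝ), |f x| ≤ C) (h0 : 0 ≤ f' 0) :
    f' 0 ^ 2 ≤ 8 / 3 * m ^ 3 := by
  by_contra! hlt
  have hcont : ContinuousOn f' (Ici 0) := fun x hx => (hf' x hx).continuousWithinAt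
  have hpos : ∀ x ∈ Ici (0 : ℝ), 0 < f' x := by
    by_contra! hex
    obtain ⟨x₀, hx₀, hx₀'⟩ := hex
    have hclosed : IsClosed (Ici (0 : ℝ) ∩ f' ⁻¹' Iic 0) :=
      hcont.preimage_isClosed_of_isClosed isClosed_Ici isClosed_Iic
    have hbelow : BddBelow (Ici (0 : ℝ) ∩ f' ⁻¹' Iic 0) := ⟨0, fun x hx => hx.1⟩
    have hmem := hclosed.csInf_mem ⟨x₀, hx₀, hx₀'⟩ hbelow
    set T := sInf (Ici (0 : ℝ) ∩ f' ⁻¹' Iic 0)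
    have hT : 0 ≤ T := hmem.1
    have hTle : f' T ≤ 0 := hmem.2
    have hbefore : ∀ x ∈ Ico 0 T, 0 ≤ f' x := fun x hx => by
      by_contra! hneg
      exact absurd (csInf_le hbelow ⟨hx.1, hneg.le⟩) (not_le.2 hx.2)
    have hzero : f' T = 0 := by
      obtain ⟨z, hz, hz0⟩ := intermediate_value_Icc' hT (hcont.mono fun x hx => hx.1)
        (show (0 : ℝ) ∈ Icc (f' T) (f' 0) from ⟨hTle, h0⟩)
      have : T ≤ z := csInf_le hbelow ⟨hz.1, hz0.le⟩
      rwa [le_antisymm hz.2 this] at hz0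
    have := sq_deriv_sub_le_sq_deriv hm hT hf hf' hf'' hbefore
    rw [hzero] at this
    linarith
  obtain ⟨C, hC⟩ := hbd
  set c := √(f' 0 ^ 2 - 8 / 3 * m ^ 3)
  have hc : 0 < c := Real.sqrt_pos.2 (by linarith)
  have hge : ∀ x ∈ Ici (0 : ℝ), c ≤ f' x := fun x hx =>
    Real.sqrt_le_iff.2 ⟨(hpos x hx).le,
      sq_deriv_sub_le_sq_deriv hm hx hf hf' hf'' fun y hy => (hpos y hy.1).le⟩
  have hmono : MonotoneOn (fun x => f x - c * x) (Ici 0) := by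
    refine monotoneOn_of_hasDerivWithinAt_nonneg (f' := fun x => f' x - c * 1) (convex_Ici 0)
      (fun x hx => (((hf x hx).sub ((hasDerivWithinAt_id x _).const_mul c))).continuousWithinAt)
      (fun x hx => ((hf x (interior_subset hx)).sub
        ((hasDerivWithinAt_id x _).const_mul c)).mono interior_subset) ?_
    intro x hx
    linarith [hge x (interior_subset hx)]
  have hC0 := abs_le.1 (hC 0 self_mem_Ici)
  have hX : (0 : ℝ) ≤ (2 * C + 1) / c := div_nonneg (by linarith [hC0.1, hC0.2]) hc.le
  have h1 := hmono self_mem_Ici hX hX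
  simp only [mul_div_cancel₀ _ hc.ne'] at h1
  linarith [(abs_le.1 (hC _ hX)).2, hC0.1]

/-- If `f : [0,∞) → ℝ` is bounded, twice continuously differentiable, and
solves `f'' = f² − φ` on `[0,∞)` (with `φ` smooth and bounded), then
`f'(0) ≤ √(8/3) · ‖φ‖∞^{3/4}`. -/
theorem stmt13 (φ : ℝ → ℝ) (hφ : ContDiff ℝ (⊤ : ℕ∞) φ)
    (hφbd : ∃ C : ℝ, ∀ x : ℝ, |φ x| ≤ C)
    (f f' : ℝ → ℝ)
    (hf : ∀ x ∈ Ici (0:ℝ), HasDerivWithinAt f (f' x) (Ici 0) x)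
    (hf' : ∀ x ∈ Ici (0:ℝ), HasDerivWithinAt f' (f x ^ 2 - φ x) (Ici 0) x)
    (hbd : ∃ C : ℝ, ∀ x ∈ Ici (0:ℝ), |f x| ≤ C) :
    f' 0 ≤ Real.sqrt (8 / 3) * (⨆ x : ℝ, |φ x|) ^ ((3 : ℝ) / 4) := by
  set M := ⨆ x : ℝ, |φ x|
  have hM : ∀ x, |φ x| ≤ M := le_ciSup (by
    obtain ⟨C, hC⟩ := hφbd
    exact ⟨C, forall_mem_range.2 hC⟩)
  have hM0 : 0 ≤ M := (abs_nonneg _).trans (hM 0)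
  rcases le_total (f' 0) 0 with hneg | hnonneg
  · exact hneg.trans (by positivity)
  have key := sq_deriv_zero_le_of_bounded (Real.sqrt_nonneg M) hf hf'
    (fun x _ => by rw [Real.sq_sqrt hM0]; linarith [(le_abs_self _).trans (hM x)]) hbd hnonneg
  refine (sq_le_sq₀ hnonneg (by positivity)).1 ?_
  have hpow : (M ^ ((3 : ℝ) / 4)) ^ 2 = √M ^ 3 := by
    rw [Real.sqrt_eq_rpow, ← Real.rpow_natCast, ← Real.rpow_natCast, ← Real.rpow_mul hM0,
      ← Real.rpow_mul hM0]
    norm_num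
  rw [mul_pow, Real.sq_sqrt (by norm_num), hpow]
  exact key
end

section
/- Suppose there exist real numbers A < B such that −∫_A^B φ(x) dx > √(8/3) · ( (sup_{x ≤ A} |φ(x)|)^{3/4} + (sup_{x ≥ B} |φ(x)|)^{3/4} ). Then there is no bounded, twice continuously differentiable f : ℝ → ℝ satisfying f''(x) = f(x)² − φ(x) for all x ∈ ℝ. -/
open Set Filter intervalIntegral

/-- The drop of the potential `v ^ 3 / 3 - m ^ 2 * v` to the right of any point is at most
`4 / 3 * m ^ 3`. -/
lemma cubic_potential_drop_le {m u v : ℝ} (hm : 0 ≤ m) (huv : u ≤ v) :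
    (u ^ 3 / 3 - m ^ 2 * u) - (v ^ 3 / 3 - m ^ 2 * v) ≤ 4 / 3 * m ^ 3 := by
  have h₁ : 0 ≤ (v - u) * (u + (v - u) / 2) ^ 2 :=
    mul_nonneg (sub_nonneg.2 huv) (sq_nonneg _)
  have h₂ : 0 ≤ (v - u - 2 * m) ^ 2 * (v - u + 4 * m) / 12 :=
    div_nonneg (mul_nonneg (sq_nonneg _) (by linarith)) (by norm_num)
  nlinarith

/-- Energy estimate: while `g` is increasing, `g'' ≥ g ^ 2 - m ^ 2` bounds `g'` from below. -/
lemma sq_deriv_ge_of_pos {g g' g'' : ℝ → ℝ} {B t m : ℝ} (hm : 0 ≤ m) (hBt : B ≤ t)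
    (hg : ∀ x, HasDerivAt g (g' x) x) (hg' : ∀ x, HasDerivAt g' (g'' x) x)
    (hineq : ∀ x ≥ B, g x ^ 2 - m ^ 2 ≤ g'' x) (hpos : ∀ x ∈ Ico B t, 0 < g' x) :
    g' B ^ 2 - 8 / 3 * m ^ 3 ≤ g' t ^ 2 := by
  have hE : ∀ x, HasDerivAt (fun y => g' y ^ 2 / 2 - (g y ^ 3 / 3 - m ^ 2 * g y))
      (g' x * (g'' x - (g x ^ 2 - m ^ 2))) x := fun x => by
    refine ((((hg' x).pow 2).div_const 2).sub
      ((((hg x).pow 3).div_const 3).sub ((hg x).const_mul (m ^ 2)))).congr_deriv ?_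
    push_cast
    ring
  have hgmono : MonotoneOn g (Icc B t) := by
    apply monotoneOn_of_deriv_nonneg (convex_Icc _ _)
    · exact fun x _ => (hg x).continuousAt.continuousWithinAt
    · exact fun x _ => (hg x).differentiableAt.differentiableWithinAt
    · intro x hx
      rw [interior_Icc] at hx
      rw [(hg x).deriv]
      exact (hpos x ⟨hx.1.le, hx.2⟩).le
  have hEmono : MonotoneOn (fun y => g' y ^ 2 / 2 - (g y ^ 3 / 3 - m ^ 2 * g y)) (Icc B t) := by
    apply monotoneOn_of_deriv_nonneg (convex_Icc _ _)
    · exact fun x _ => (hE x).continuousAt.continuousWithinAt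
    · exact fun x _ => (hE x).differentiableAt.differentiableWithinAt
    · intro x hx
      rw [interior_Icc] at hx
      rw [(hE x).deriv]
      exact mul_nonneg (hpos x ⟨hx.1.le, hx.2⟩).le (sub_nonneg.2 (hineq x hx.1.le))
  have h₁ := hgmono (left_mem_Icc.2 hBt) (right_mem_Icc.2 hBt) hBt
  have h₂ := hEmono (left_mem_Icc.2 hBt) (right_mem_Icc.2 hBt) hBt
  have h₃ := cubic_potential_drop_le hm h₁
  simp only at h₂
  linarith

/-- A function bounded on `[B, ∞)` with `g'' ≥ g ^ 2 - m ^ 2` there has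
`g' B ≤ √(8 / 3 * m ^ 3)`. -/
lemma deriv_le_sqrt_of_bounded {g g' g'' : ℝ → ℝ} {B m C : ℝ} (hm : 0 ≤ m)
    (hg : ∀ x, HasDerivAt g (g' x) x) (hg' : ∀ x, HasDerivAt g' (g'' x) x)
    (hineq : ∀ x ≥ B, g x ^ 2 - m ^ 2 ≤ g'' x) (hbd : ∀ x ≥ B, g x ≤ C) :
    g' B ≤ Real.sqrt (8 / 3 * m ^ 3) := by
  by_contra! hlt
  have hm3 : 0 ≤ 8 / 3 * m ^ 3 := by positivity
  have hB : 0 < g' B := (Real.sqrt_nonneg _).trans_lt hlt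
  have hgap : 0 < g' B ^ 2 - 8 / 3 * m ^ 3 := sub_pos.2 ((Real.sqrt_lt' hB).1 hlt)
  have hcont : Continuous g' := continuous_iff_continuousAt.2 fun x => (hg' x).continuousAt
  have hpos : ∀ x ≥ B, 0 < g' x := by
    by_contra! hex
    obtain ⟨x, hx, hx0⟩ := hex
    have hcpt : IsCompact (Icc B x ∩ {y | g' y ≤ 0}) :=
      isCompact_Icc.inter_right (isClosed_le hcont continuous_const)
    obtain ⟨t, ⟨ht, ht0⟩, hleast⟩ := hcpt.exists_isLeast ⟨x, ⟨hx, le_rfl⟩, hx0⟩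
    obtain ⟨y, hy, hy0⟩ := intermediate_value_Icc' ht.1 hcont.continuousOn ⟨ht0, hB.le⟩
    have hty : y = t :=
      le_antisymm hy.2 (hleast ⟨⟨hy.1, hy.2.trans ht.2⟩, hy0.le⟩)
    subst hty
    have hE := sq_deriv_ge_of_pos hm ht.1 hg hg' hineq fun z hz => by
      by_contra! hz0
      exact hz.2.not_ge (hleast ⟨⟨hz.1, hz.2.le.trans ht.2⟩, hz0⟩)
    rw [hy0] at hE
    linarith
  set c := Real.sqrt (g' B ^ 2 - 8 / 3 * m ^ 3)
  have hc0 : 0 < c := Real.sqrt_pos.2 hgap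
  have hslope : ∀ x ≥ B, c ≤ g' x := fun x hx =>
    (Real.sqrt_le_left (hpos x hx).le).2
      (sq_deriv_ge_of_pos hm hx hg hg' hineq fun z hz => hpos z hz.1)
  have hgrow : ∀ x ≥ B, c * (x - B) ≤ g x - g B := fun x hx =>
    (convex_Ici B).mul_sub_le_image_sub_of_le_deriv
      (fun y _ => (hg y).continuousAt.continuousWithinAt)
      (fun y _ => (hg y).differentiableAt.differentiableWithinAt)
      (fun y hy => by
        rw [interior_Ici] at hy
        rw [(hg y).deriv]
        exact hslope y (le_of_lt hy))
      B self_mem_Ici x hx hx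
  have hCB : 0 ≤ C - g B := sub_nonneg.2 (hbd B le_rfl)
  have hx : B ≤ B + ((C - g B) / c + 1) := by
    have := div_nonneg hCB hc0.le
    linarith
  have h₁ := hgrow _ hx
  have h₂ := hbd _ hx
  have h₃ : c * (B + ((C - g B) / c + 1) - B) = C - g B + c := by
    field_simp
    ring
  linarith

/-- For a bounded nonnegative function, the iterated real supremum over the points of a set
bounds the function on that set and is nonnegative. -/
lemma le_biSup_of_nonneg_of_bounded {h : ℝ → ℝ} {C : ℝ} (h₀ : ∀ x, 0 ≤ h x)
    (hC : ∀ x, h x ≤ C) (s : Set ℝ) :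
    0 ≤ (⨆ x ∈ s, h x) ∧ ∀ x ∈ s, h x ≤ ⨆ x ∈ s, h x := by
  refine ⟨Real.iSup_nonneg fun x => Real.iSup_nonneg fun _ => h₀ x, fun x hx => ?_⟩
  have hbdd : BddAbove (range fun y => ⨆ _ : y ∈ s, h y) := by
    refine ⟨C, ?_⟩
    rintro _ ⟨y, rfl⟩
    exact Real.iSup_le (fun _ => hC y) ((h₀ y).trans (hC y))
  have := le_ciSup hbdd x
  simpa [hx] using this

lemma sqrt_const_mul_sqrt_pow_three {c b : ℝ} (hc : 0 ≤ c) (hb : 0 ≤ b) :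
    Real.sqrt (c * Real.sqrt b ^ 3) = Real.sqrt c * b ^ ((3 : ℝ) / 4) := by
  rw [Real.sqrt_mul hc, Real.sqrt_eq_rpow (Real.sqrt b ^ 3), Real.sqrt_eq_rpow b,
    ← Real.rpow_natCast, ← Real.rpow_mul hb, ← Real.rpow_mul hb]
  norm_num

/-- If `−∫_A^B φ > √(8/3)·((sup_{x≤A}|φ|)^{3/4} + (sup_{x≥B}|φ|)^{3/4})`
for some `A < B`, then no bounded twice continuously differentiable solution of
`f'' = f² − φ` on `ℝ` exists. -/
theorem stmt14 (φ : ℝ → ℝ) (hφ : ContDiff ℝ (⊤ : ℕ∞) φ)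
    (hφbd : ∃ C : ℝ, ∀ x : ℝ, |φ x| ≤ C)
    (A B : ℝ) (hAB : A < B)
    (hgap : -(∫ x in A..B, φ x) >
      Real.sqrt (8 / 3) * ((⨆ x ∈ Iic A, |φ x|) ^ ((3 : ℝ) / 4) +
        (⨆ x ∈ Ici B, |φ x|) ^ ((3 : ℝ) / 4))) :
    ¬ ∃ f : ℝ → ℝ, (∃ C : ℝ, ∀ x : ℝ, |f x| ≤ C) ∧ ContDiff ℝ 2 f ∧
      ∀ x : ℝ, deriv (deriv f) x = f x ^ 2 - φ x := by
  rintro ⟨f, ⟨C, hC⟩, hf, hode⟩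
  obtain ⟨M, hM⟩ := hφbd
  obtain ⟨ha₀, ha⟩ := le_biSup_of_nonneg_of_bounded (fun x => abs_nonneg (φ x)) hM (Iic A)
  obtain ⟨hb₀, hb⟩ := le_biSup_of_nonneg_of_bounded (fun x => abs_nonneg (φ x)) hM (Ici B)
  set a := ⨆ x ∈ Iic A, |φ x|
  set b := ⨆ x ∈ Ici B, |φ x|
  have hf₁ : ∀ x, HasDerivAt f (deriv f x) x := fun x =>
    (hf.differentiable (by norm_num) x).hasDerivAt
  have hf₂ : ∀ x, HasDerivAt (deriv f) (f x ^ 2 - φ x) x := fun x => by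
    have hdf : ContDiff ℝ 1 (deriv f) :=
      ((contDiff_succ_iff_deriv (n := 1)).1 (hf.of_le (by norm_num))).2.2
    rw [← hode x]
    exact (hdf.differentiable (by norm_num) x).hasDerivAt
  have hright : deriv f B ≤ Real.sqrt (8 / 3) * b ^ ((3 : ℝ) / 4) := by
    rw [← sqrt_const_mul_sqrt_pow_three (by norm_num) hb₀]
    refine deriv_le_sqrt_of_bounded (C := C) (Real.sqrt_nonneg b) hf₁ hf₂ (fun x hx => ?_)
      fun x _ => (abs_le.1 (hC x)).2
    rw [Real.sq_sqrt hb₀]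
    linarith [(abs_le.1 (hb x hx)).2]
  have hleft : -deriv f A ≤ Real.sqrt (8 / 3) * a ^ ((3 : ℝ) / 4) := by
    rw [← sqrt_const_mul_sqrt_pow_three (by norm_num) ha₀]
    have := deriv_le_sqrt_of_bounded (g := fun x => f (-x)) (g' := fun x => -deriv f (-x))
      (g'' := fun x => f (-x) ^ 2 - φ (-x)) (B := -A) (C := C) (Real.sqrt_nonneg a)
      (fun x => ((hf₁ (-x)).comp x (hasDerivAt_neg x)).congr_deriv (by ring))
      (fun x => ((hf₂ (-x)).comp x (hasDerivAt_neg x)).neg.congr_deriv (by ring))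
      (fun x hx => ?_) fun x _ => (abs_le.1 (hC (-x))).2
    · simpa using this
    · rw [Real.sq_sqrt ha₀]
      linarith [(abs_le.1 (ha (-x) (by rw [mem_Iic]; linarith))).2]
  have hfsq : IntervalIntegrable (fun x => f x ^ 2) MeasureTheory.volume A B :=
    (hf.continuous.pow 2).intervalIntegrable _ _
  have hφint : IntervalIntegrable φ MeasureTheory.volume A B :=
    hφ.continuous.intervalIntegrable _ _
  have hFTC := integral_eq_sub_of_hasDerivAt (fun x _ => hf₂ x) (hfsq.sub hφint)
  rw [integral_sub hfsq hφint] at hFTC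
  have hnonneg : 0 ≤ ∫ x in A..B, f x ^ 2 :=
    integral_nonneg hAB.le fun x _ => sq_nonneg (f x)
  linarith
end

section
/- If φ is M-shaped and φ(x) > 0 for all x ∈ ℝ, then there exists a bounded, twice continuously differentiable f : ℝ → ℝ with f''(x) − f(x)² + φ(x) = 0 for all x ∈ ℝ. -/
open Set Filter MeasureTheory Topology

/-- The solution `x ↦ ∫_{-∞}^x e^{-a(x - t)} h(t) dt` of `u' = -a u + h` that is bounded
when `h` is bounded. -/
noncomputable def expAverage (a : ℝ) (h : ℝ → ℝ) (x : ℝ) : ℝ :=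
  Real.exp (-(a * x)) * ∫ t in Iic x, Real.exp (a * t) * h t

/-- The convolution of `h` with the Green function `e^{-a|x|} / (2a)` of `a² - d²/dx²`. -/
noncomputable def greenConv (a : ℝ) (h : ℝ → ℝ) (x : ℝ) : ℝ :=
  (expAverage a h x + expAverage a (fun t => h (-t)) (-x)) / (2 * a)

lemma integrableOn_exp_mul_bounded {a K : ℝ} (ha : 0 < a) {h : ℝ → ℝ} (hm : Measurable h)
    (hK : ∀ t, |h t| ≤ K) (x : ℝ) :
    IntegrableOn (fun t => Real.exp (a * t) * h t) (Iic x) :=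
  (integrableOn_exp_mul_Iic ha x).mul_bdd (c := K) hm.aestronglyMeasurable
    (Eventually.of_forall hK)

lemma expAverage_mono {a K : ℝ} (ha : 0 < a) {g h : ℝ → ℝ} (hgm : Measurable g)
    (hm : Measurable h) (hgK : ∀ t, |g t| ≤ K) (hK : ∀ t, |h t| ≤ K)
    (hgh : ∀ t, g t ≤ h t) (x : ℝ) : expAverage a g x ≤ expAverage a h x := by
  unfold expAverage
  gcongr
  · exact integrableOn_exp_mul_bounded ha hgm hgK x
  · exact integrableOn_exp_mul_bounded ha hm hK x
  · exact measurableSet_Iic.nullMeasurableSet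
  · exact hgh _

lemma expAverage_const {a : ℝ} (ha : 0 < a) (c x : ℝ) :
    expAverage a (fun _ => c) x = c / a := by
  unfold expAverage
  rw [integral_mul_const, integral_exp_mul_Iic ha, Real.exp_neg]
  field_simp

lemma tendsto_expAverage {a K : ℝ} (ha : 0 < a) {g : ℕ → ℝ → ℝ} {h : ℝ → ℝ}
    (hgm : ∀ n, Measurable (g n)) (hgK : ∀ n t, |g n t| ≤ K)
    (hgh : ∀ t, Tendsto (fun n => g n t) atTop (𝓝 (h t))) (x : ℝ) :
    Tendsto (fun n => expAverage a (g n) x) atTop (𝓝 (expAverage a h x)) := by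
  unfold expAverage
  refine Tendsto.const_mul _ (tendsto_integral_of_dominated_convergence
    (fun t => Real.exp (a * t) * K) (fun n => ?_) ?_ (fun n => ?_) ?_)
  · exact (integrableOn_exp_mul_bounded ha (hgm n) (hgK n) x).aestronglyMeasurable
  · exact (integrableOn_exp_mul_Iic ha x).mul_const K
  · refine Eventually.of_forall fun t => ?_
    rw [Real.norm_eq_abs, abs_mul, Real.abs_exp]
    gcongr
    exact hgK n t
  · exact Eventually.of_forall fun t => (hgh t).const_mul _

lemma expAverage_eq {a K : ℝ} (ha : 0 < a) {h : ℝ → ℝ} (hm : Measurable h)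
    (hK : ∀ t, |h t| ≤ K) (x : ℝ) :
    expAverage a h x = Real.exp (-(a * x)) *
      ((∫ t in Iic 0, Real.exp (a * t) * h t) + ∫ t in (0 : ℝ)..x, Real.exp (a * t) * h t) := by
  have hi := integrableOn_exp_mul_bounded ha hm hK
  rw [← intervalIntegral.integral_Iic_sub_Iic (hi 0) (hi x), expAverage]
  ring

lemma continuous_expAverage {a K : ℝ} (ha : 0 < a) {h : ℝ → ℝ} (hm : Measurable h)
    (hK : ∀ t, |h t| ≤ K) : Continuous (expAverage a h) := by
  rw [funext (expAverage_eq ha hm hK)]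
  have := intervalIntegral.continuous_primitive (μ := volume)
    (f := fun t => Real.exp (a * t) * h t) (fun p q => by
      rw [intervalIntegrable_iff]
      exact (integrableOn_exp_mul_bounded ha hm hK (max p q)).mono_set fun t ht => ht.2) 0
  fun_prop

lemma hasDerivAt_expAverage {a K : ℝ} (ha : 0 < a) {h : ℝ → ℝ} (hc : Continuous h)
    (hK : ∀ t, |h t| ≤ K) (x : ℝ) :
    HasDerivAt (expAverage a h) (-(a * expAverage a h x) + h x) x := by
  have hE := expAverage_eq ha hc.measurable hK
  have hcont : Continuous fun t => Real.exp (a * t) * h t := by fun_prop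
  have hF := (intervalIntegral.integral_hasDerivAt_right (hcont.intervalIntegrable 0 x)
    hcont.aestronglyMeasurable.stronglyMeasurableAtFilter hcont.continuousAt).const_add
    (∫ t in Iic 0, Real.exp (a * t) * h t)
  have hexp : HasDerivAt (fun y => Real.exp (-(a * y))) (Real.exp (-(a * x)) * -(a * 1)) x :=
    (((hasDerivAt_id x).const_mul a).neg).exp
  rw [hE x, funext hE]
  refine (hexp.mul hF).congr_deriv ?_
  rw [← mul_assoc (Real.exp (-(a * x))) (Real.exp (a * x)), ← Real.exp_add]
  simp only [neg_add_cancel, Real.exp_zero]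
  ring

lemma greenConv_mono {a K : ℝ} (ha : 0 < a) {g h : ℝ → ℝ} (hgm : Measurable g)
    (hm : Measurable h) (hgK : ∀ t, |g t| ≤ K) (hK : ∀ t, |h t| ≤ K)
    (hgh : ∀ t, g t ≤ h t) (x : ℝ) : greenConv a g x ≤ greenConv a h x := by
  unfold greenConv
  gcongr
  · exact expAverage_mono ha hgm hm hgK hK hgh x
  · exact expAverage_mono ha (hgm.comp measurable_neg) (hm.comp measurable_neg)
      (fun t => hgK _) (fun t => hK _) (fun t => hgh _) (-x)

lemma greenConv_const {a : ℝ} (ha : 0 < a) (c x : ℝ) :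
    greenConv a (fun _ => c) x = c / a ^ 2 := by
  rw [greenConv, expAverage_const ha, expAverage_const ha]
  field_simp
  ring

lemma tendsto_greenConv {a K : ℝ} (ha : 0 < a) {g : ℕ → ℝ → ℝ} {h : ℝ → ℝ}
    (hgm : ∀ n, Measurable (g n)) (hgK : ∀ n t, |g n t| ≤ K)
    (hgh : ∀ t, Tendsto (fun n => g n t) atTop (𝓝 (h t))) (x : ℝ) :
    Tendsto (fun n => greenConv a (g n) x) atTop (𝓝 (greenConv a h x)) :=
  ((tendsto_expAverage ha hgm hgK hgh x).add
    (tendsto_expAverage ha (fun n => (hgm n).comp measurable_neg) (fun n _ => hgK n _)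
      (fun _ => hgh _) (-x))).div_const _

lemma continuous_greenConv {a K : ℝ} (ha : 0 < a) {h : ℝ → ℝ} (hm : Measurable h)
    (hK : ∀ t, |h t| ≤ K) : Continuous (greenConv a h) :=
  ((continuous_expAverage ha hm hK).add
    ((continuous_expAverage ha (hm.comp measurable_neg) (fun _ => hK _)).comp
      continuous_neg)).div_const _

lemma hasDerivAt_expAverage_reflect {a K : ℝ} (ha : 0 < a) {h : ℝ → ℝ} (hc : Continuous h)
    (hK : ∀ t, |h t| ≤ K) (x : ℝ) :
    HasDerivAt (fun y => expAverage a (fun t => h (-t)) (-y))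
      (a * expAverage a (fun t => h (-t)) (-x) - h x) x := by
  have h1 := hasDerivAt_expAverage ha (hc.comp continuous_neg) (fun t => hK (-t)) (-x)
  refine (h1.comp x (hasDerivAt_neg x)).congr_deriv ?_
  simp only [Function.comp_def, neg_neg]
  ring

lemma hasDerivAt_greenConv {a K : ℝ} (ha : 0 < a) {h : ℝ → ℝ} (hc : Continuous h)
    (hK : ∀ t, |h t| ≤ K) (x : ℝ) :
    HasDerivAt (greenConv a h)
      ((expAverage a (fun t => h (-t)) (-x) - expAverage a h x) / 2) x := by
  refine (((hasDerivAt_expAverage ha hc hK x).add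
    (hasDerivAt_expAverage_reflect ha hc hK x)).div_const (2 * a)).congr_deriv ?_
  field_simp
  ring

lemma hasDerivAt_deriv_greenConv {a K : ℝ} (ha : 0 < a) {h : ℝ → ℝ} (hc : Continuous h)
    (hK : ∀ t, |h t| ≤ K) (x : ℝ) :
    HasDerivAt (deriv (greenConv a h)) (a ^ 2 * greenConv a h x - h x) x := by
  rw [funext fun y => (hasDerivAt_greenConv ha hc hK y).deriv]
  refine (((hasDerivAt_expAverage_reflect ha hc hK x).sub
    (hasDerivAt_expAverage ha hc hK x)).div_const 2).congr_deriv ?_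
  unfold greenConv
  field_simp
  ring

/-- Monotone iteration between the lower solution `0` and the upper solution `M`. -/
lemma exists_greenConv_fixedPoint {φ : ℝ → ℝ} {M a : ℝ} (hM : 0 ≤ M) (ha : 0 < a)
    (haM : 2 * M ≤ a ^ 2) (hφ : Continuous φ) (hφ0 : ∀ x, 0 ≤ φ x) (hφM : ∀ x, φ x ≤ M ^ 2) :
    ∃ f : ℝ → ℝ, Continuous f ∧ (∀ x, f x ∈ Icc 0 M) ∧
      (∀ t, |a ^ 2 * f t - f t ^ 2 + φ t| ≤ a ^ 2 * M) ∧
      f = greenConv a fun t => a ^ 2 * f t - f t ^ 2 + φ t := by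
  set N : (ℝ → ℝ) → ℝ → ℝ := fun f t => a ^ 2 * f t - f t ^ 2 + φ t with hN
  have N_mono : ∀ f g : ℝ → ℝ, (∀ t, f t ∈ Icc 0 M) → (∀ t, g t ∈ Icc 0 M) →
      (∀ t, f t ≤ g t) → ∀ t, N f t ≤ N g t := by
    intro f g hf hg hfg t
    have h1 := (hf t).2
    have h2 := (hg t).2
    have h3 := mul_nonneg (sub_nonneg.2 (hfg t)) (by linarith : 0 ≤ a ^ 2 - (f t + g t))
    simp only [hN]
    nlinarith
  have N_nonneg : ∀ f : ℝ → ℝ, (∀ t, f t ∈ Icc 0 M) → ∀ t, 0 ≤ N f t := by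
    intro f hf t
    have := N_mono (fun _ => 0) f (fun t => ⟨le_rfl, hM⟩) hf (fun t => (hf t).1) t
    refine le_trans ?_ this
    simpa [hN] using hφ0 t
  have N_le : ∀ f : ℝ → ℝ, (∀ t, f t ∈ Icc 0 M) → ∀ t, N f t ≤ a ^ 2 * M := by
    intro f hf t
    refine (N_mono f (fun _ => M) hf (fun t => ⟨hM, le_rfl⟩) (fun t => (hf t).2) t).trans ?_
    simp only [hN]
    linarith [hφM t]
  have N_abs : ∀ f : ℝ → ℝ, (∀ t, f t ∈ Icc 0 M) → ∀ t, |N f t| ≤ a ^ 2 * M := fun f hf t =>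
    (abs_of_nonneg (N_nonneg f hf t)).trans_le (N_le f hf t)
  have N_meas : ∀ f : ℝ → ℝ, Measurable f → Measurable (N f) := by
    intro f hf
    have := hφ.measurable
    fun_prop
  have hK : 0 ≤ a ^ 2 * M := by positivity
  have T_mem : ∀ f : ℝ → ℝ, Measurable f → (∀ t, f t ∈ Icc 0 M) →
      ∀ x, greenConv a (N f) x ∈ Icc 0 M := by
    intro f hfm hf x
    constructor
    · have := greenConv_mono ha measurable_const (N_meas f hfm) (fun t => by simpa using hK)
        (N_abs f hf) (N_nonneg f hf) x
      rwa [greenConv_const ha, zero_div] at this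
    · have := greenConv_mono ha (N_meas f hfm) measurable_const (N_abs f hf)
        (fun t => (abs_of_nonneg hK).le) (N_le f hf) x
      rwa [greenConv_const ha, mul_div_cancel_left₀ _ (by positivity)] at this
  let u : ℕ → ℝ → ℝ := fun n => (fun f => greenConv a (N f))^[n] fun _ => 0
  have u_succ : ∀ n, u (n + 1) = greenConv a (N (u n)) := fun n =>
    Function.iterate_succ_apply' _ _ _
  have u_prop : ∀ n, Measurable (u n) ∧ ∀ t, u n t ∈ Icc 0 M := by
    intro n
    induction n with
    | zero => exact ⟨measurable_const, fun t => ⟨le_rfl, hM⟩⟩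
    | succ n ih =>
      rw [u_succ]
      exact ⟨(continuous_greenConv ha (N_meas _ ih.1) (N_abs _ ih.2)).measurable,
        T_mem _ ih.1 ih.2⟩
  have u_le : ∀ n t, u n t ≤ u (n + 1) t := by
    intro n
    induction n with
    | zero => exact fun t => ((u_prop 1).2 t).1
    | succ n ih =>
      intro t
      rw [u_succ (n + 1), u_succ n]
      have h1 := u_prop n
      have h2 := u_prop (n + 1)
      rw [u_succ n] at h2 ih
      exact greenConv_mono ha (N_meas _ h1.1) (N_meas _ h2.1) (N_abs _ h1.2) (N_abs _ h2.2)
        (N_mono _ _ h1.2 h2.2 ih) t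
  have hlim : ∀ t, Tendsto (fun n => u n t) atTop (𝓝 (⨆ n, u n t)) := fun t =>
    tendsto_atTop_ciSup (monotone_nat_of_le_succ fun n => u_le n t)
      ⟨M, by rintro _ ⟨n, rfl⟩; exact ((u_prop n).2 t).2⟩
  set f : ℝ → ℝ := fun t => ⨆ n, u n t with hf
  have f_meas : Measurable f :=
    measurable_of_tendsto_metrizable (fun n => (u_prop n).1) (tendsto_pi_nhds.2 hlim)
  have f_mem : ∀ t, f t ∈ Icc 0 M := fun t =>
    isClosed_Icc.mem_of_tendsto (hlim t) (Eventually.of_forall fun n => (u_prop n).2 t)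
  have f_eq : f = greenConv a (N f) := by
    funext x
    have h1 := tendsto_greenConv ha (fun n => N_meas _ (u_prop n).1)
      (fun n => N_abs _ (u_prop n).2) (h := N f)
      (fun t => (((hlim t).const_mul _).sub ((hlim t).pow 2)).add_const _) x
    refine tendsto_nhds_unique ((hlim x).comp (tendsto_add_atTop_nat 1)) (h1.congr fun n => ?_)
    simp only [Function.comp_apply, u_succ]
  refine ⟨f, ?_, f_mem, N_abs f f_mem, f_eq⟩
  rw [f_eq]
  exact continuous_greenConv ha (N_meas f f_meas) (N_abs f f_mem)

/-- If `φ` is M-shaped (smooth, bounded, tending to `0` as `|x| → ∞`, with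
some `x₀ > 0` such that `φ > 0` outside `[−x₀, x₀]`, `φ` monotone increasing on
`(−∞, −x₀]` and monotone decreasing on `[x₀, ∞)`) and `φ(x) > 0` for all `x`, then there
is a bounded twice continuously differentiable `f : ℝ → ℝ` with `f'' − f² + φ = 0`. -/
theorem stmt15 (φ : ℝ → ℝ)
    (hφsmooth : ContDiff ℝ (⊤ : ℕ∞) φ)
    (hφbd : ∃ C : ℝ, ∀ x : ℝ, |φ x| ≤ C)
    (hφtop : Tendsto φ atTop (nhds 0)) (hφbot : Tendsto φ atBot (nhds 0))
    (hM : ∃ x₀ : ℝ, 0 < x₀ ∧ (∀ x : ℝ, x₀ < |x| → 0 < φ x) ∧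
      MonotoneOn φ (Iic (-x₀)) ∧ AntitoneOn φ (Ici x₀))
    (hpos : ∀ x : ℝ, 0 < φ x) :
    ∃ f : ℝ → ℝ, (∃ C : ℝ, ∀ x : ℝ, |f x| ≤ C) ∧ ContDiff ℝ 2 f ∧
      ∀ x : ℝ, deriv (deriv f) x - f x ^ 2 + φ x = 0 := by
  obtain ⟨C, hC⟩ := hφbd
  have hC0 : 0 ≤ C := (abs_nonneg _).trans (hC 0)
  have hφ := hφsmooth.continuous
  obtain ⟨f, hfc, hf, hK, hfix⟩ := exists_greenConv_fixedPoint (φ := φ) (M := C + 1)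
    (a := C + 2) (by positivity) (by positivity) (by nlinarith) hφ (fun x => (hpos x).le)
    (fun x => by nlinarith [le_abs_self (φ x), hC x])
  have ha : 0 < C + 2 := by positivity
  have hc : Continuous fun t => (C + 2) ^ 2 * f t - f t ^ 2 + φ t := by fun_prop
  have hd : Differentiable ℝ f := by
    rw [hfix]
    exact fun x => (hasDerivAt_greenConv ha hc hK x).differentiableAt
  have hd2 : ∀ x, HasDerivAt (deriv f) (f x ^ 2 - φ x) x := by
    intro x
    have := hasDerivAt_deriv_greenConv ha hc hK x
    rw [← hfix] at this
    exact this.congr_deriv (by ring)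
  refine ⟨f, ⟨C + 1, fun x => (abs_of_nonneg (hf x).1).trans_le (hf x).2⟩, ?_, fun x => ?_⟩
  · refine (contDiff_succ_iff_deriv (n := 1)).2 ⟨hd, by simp, contDiff_one_iff_deriv.2
      ⟨fun x => (hd2 x).differentiableAt, ?_⟩⟩
    rw [funext fun x => (hd2 x).deriv]
    fun_prop
  · rw [(hd2 x).deriv]
    ring
end

section
/- There exists ε₀ > 0 such that for every 0 < ε < ε₀ there is a smooth function h : ℝ → ℝ with ‖h‖_{L^p(ℝ)} < ε for every 1 ≤ p < ∞ and sup_{x∈ℝ} |h(x)| < ε, for which no classical global solution of the perturbed equation with initial datum h exists. -/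
open MeasureTheory Filter Set
open scoped ENNReal

/-- At a maximum over the past, a time derivative is nonnegative. -/
lemma hasDerivAt_nonneg_of_le_left {φ : ℝ → ℝ} {φ' t : ℝ} (ht : 0 < t)
    (hφ : HasDerivAt φ φ' t) (hmax : ∀ s ∈ Ioo 0 t, φ s ≤ φ t) : 0 ≤ φ' := by
  have h1 : Tendsto (slope φ t) (nhdsWithin t (Iio t)) (nhds φ') :=
    (hasDerivAt_iff_tendsto_slope.1 hφ).mono_left
      (nhdsWithin_mono _ (fun y (hy : y < t) => ne_of_lt hy))
  refine ge_of_tendsto h1 ?_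
  filter_upwards [Ioo_mem_nhdsLT ht] with s hs
  rw [slope_def_field]
  exact div_nonneg_of_nonpos (by linarith [hmax s hs]) (by linarith [hs.2])

/-- The second derivative test, in the form of a necessary condition for a local maximum. -/
lemma IsLocalMax.second_deriv_nonpos {φ g : ℝ → ℝ} {c x : ℝ} (hmax : IsLocalMax φ x)
    (hφ : ∀ᶠ y in nhds x, HasDerivAt φ (g y) y) (hg : HasDerivAt g c x) : c ≤ 0 := by
  by_contra! hc
  have hd : deriv φ =ᶠ[nhds x] g := hφ.mono fun y hy => hy.deriv
  have hdd : deriv (deriv φ) x = c := hd.deriv_eq.trans hg.deriv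
  have hmin : IsLocalMin φ x := by
    refine isLocalMin_of_deriv_deriv_pos (by rwa [hdd]) hmax.deriv_eq_zero ?_
    exact hφ.self_of_nhds.continuousAt
  have hconst : φ =ᶠ[nhds x] fun _ => φ x := by
    filter_upwards [hmax, hmin] with y h1 h2 using le_antisymm h1 h2
  have h0 : deriv φ =ᶠ[nhds x] fun _ => 0 := by
    filter_upwards [hconst.eventuallyEq_nhds] with y hy
    rw [hy.deriv_eq, deriv_const]
  have : deriv (deriv φ) x = 0 := by rw [h0.deriv_eq, deriv_const]
  linarith

/-- A parabolic maximum principle on a rectangle that only uses pointwise derivatives. -/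
lemma parabolic_maximum_principle {z : ℝ → ℝ → ℝ} {a b T Λ : ℝ}
    (hcont : ContinuousOn (fun q : ℝ × ℝ => z q.1 q.2) (Icc 0 T ×ˢ Icc a b))
    (hinit : ∀ x ∈ Icc a b, z 0 x ≤ 0)
    (hleft : ∀ t ∈ Icc 0 T, z t a ≤ 0) (hright : ∀ t ∈ Icc 0 T, z t b ≤ 0)
    (hpde : ∀ t ∈ Ioc 0 T, ∀ x ∈ Ioo a b, 0 < z t x → ∃ (zt zxx : ℝ) (g : ℝ → ℝ),
      HasDerivAt (fun s => z s x) zt t ∧ (∀ᶠ y in nhds x, HasDerivAt (z t) (g y) y) ∧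
      HasDerivAt g zxx x ∧ zt < zxx + Λ * z t x) :
    ∀ t ∈ Icc 0 T, ∀ x ∈ Icc a b, z t x ≤ 0 := by
  intro t₁ ht₁ x₁ hx₁
  by_contra! hpos
  obtain ⟨⟨t, x⟩, ⟨ht, hx⟩, hm⟩ := (isCompact_Icc.prod isCompact_Icc).exists_isMaxOn
    ⟨(t₁, x₁), ht₁, hx₁⟩
    ((Real.continuous_exp.comp (continuous_const.mul continuous_fst)).continuousOn.mul hcont :
      ContinuousOn (fun q : ℝ × ℝ => Real.exp (-Λ * q.1) * z q.1 q.2) _)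
  simp only at ht hx
  have hm' : ∀ s ∈ Icc 0 T, ∀ y ∈ Icc a b,
      Real.exp (-Λ * s) * z s y ≤ Real.exp (-Λ * t) * z t x :=
    fun s hs y hy => hm (show (s, y) ∈ Icc 0 T ×ˢ Icc a b from ⟨hs, hy⟩)
  have hz : 0 < z t x := by
    have := hm' t₁ ht₁ x₁ hx₁
    have h2 : 0 < Real.exp (-Λ * t₁) * z t₁ x₁ := by positivity
    exact pos_of_mul_pos_right (h2.trans_le this) (Real.exp_pos _).le
  have ht0 : 0 < t := lt_of_le_of_ne ht.1 (by rintro rfl; linarith [hinit x hx])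
  have hxa : a < x := lt_of_le_of_ne hx.1 (by rintro rfl; linarith [hleft t ht])
  have hxb : x < b := lt_of_le_of_ne hx.2 (by rintro rfl; linarith [hright t ht])
  obtain ⟨zt, zxx, g, hzt, hg, hzxx, hlt⟩ := hpde t ⟨ht0, ht.2⟩ x ⟨hxa, hxb⟩ hz
  have hxx : zxx ≤ 0 := by
    refine IsLocalMax.second_deriv_nonpos ?_ hg hzxx
    filter_upwards [Icc_mem_nhds hxa hxb] with y hy
    exact le_of_mul_le_mul_left (hm' t ht y hy) (Real.exp_pos _)
  have he : HasDerivAt (fun s => Real.exp (-Λ * s)) (Real.exp (-Λ * t) * (-Λ)) t := by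
    simpa using ((hasDerivAt_id t).const_mul (-Λ)).exp
  have htt := hasDerivAt_nonneg_of_le_left ht0 (he.mul hzt)
    fun s hs => hm' s ⟨hs.1.le, hs.2.le.trans ht.2⟩ x hx
  have : 0 ≤ Real.exp (-Λ * t) * (zt - Λ * z t x) := by linarith
  have := nonneg_of_mul_nonneg_right this (Real.exp_pos _)
  linarith

/-- A function on `[0, ∞) × ℝ` with the regularity of a classical solution of
`∂u/∂t = ∂²u/∂x² − 2 f(x) u − u²`; no growth condition in `x` is imposed. -/
structure IsClassicalSolution (f : ℝ → ℝ) (u : ℝ → ℝ → ℝ) : Prop where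
  continuousOn : ContinuousOn (fun q : ℝ × ℝ => u q.1 q.2) (Ici 0 ×ˢ univ)
  contDiff : ∀ t : ℝ, 0 < t → ContDiff ℝ 2 (u t)
  hasDerivAt : ∀ x : ℝ, ∀ t : ℝ, 0 < t → HasDerivAt (fun s : ℝ => u s x)
    (deriv (deriv (u t)) x - 2 * f x * u t x - (u t x) ^ 2) t

namespace IsClassicalSolution

variable {f : ℝ → ℝ} {u : ℝ → ℝ → ℝ}

lemma hasDerivAt_space (hu : IsClassicalSolution f u) {t : ℝ} (ht : 0 < t) (x : ℝ) :
    HasDerivAt (u t) (deriv (u t) x) x :=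
  ((hu.contDiff t ht).differentiable (by norm_num) x).hasDerivAt

lemma hasDerivAt_deriv_space (hu : IsClassicalSolution f u) {t : ℝ} (ht : 0 < t) (x : ℝ) :
    HasDerivAt (deriv (u t)) (deriv (deriv (u t)) x) x := by
  have h : ContDiff ℝ 1 (deriv (u t)) :=
    ((contDiff_succ_iff_deriv (n := 1)).1
      (by rw [one_add_one_eq_two]; exact hu.contDiff t ht)).2.2
  exact (h.differentiable (by norm_num) x).hasDerivAt

lemma continuousOn_Icc (hu : IsClassicalSolution f u) (T a b : ℝ) :
    ContinuousOn (fun q : ℝ × ℝ => u q.1 q.2) (Icc 0 T ×ˢ Icc a b) :=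
  hu.continuousOn.mono (prod_mono Icc_subset_Ici_self (subset_univ _))

lemma exists_abs_le (hu : IsClassicalSolution f u) (T a b : ℝ) :
    ∃ M : ℝ, 0 < M ∧ ∀ t ∈ Icc 0 T, ∀ x ∈ Icc a b, |u t x| ≤ M := by
  obtain ⟨M, hM⟩ := (isCompact_Icc.prod isCompact_Icc).exists_bound_of_continuousOn
    (hu.continuousOn_Icc T a b)
  exact ⟨max M 1, by positivity, fun t ht x hx =>
    (hM (t, x) ⟨ht, hx⟩).trans (le_max_left _ _)⟩

/-- Keller–Osserman type bound: a solution with nonpositive initial datum lies below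
a stationary barrier that is infinite on the boundary of an interval. -/
lemma le_barrier (hu : IsClassicalSolution f u) (hf : ∀ x, 0 < f x) (h0 : ∀ x, u 0 x ≤ 0)
    {L : ℝ} (hL : 0 < L) {t : ℝ} (ht : 0 ≤ t) (y : ℝ) : u t y ≤ 25 / L ^ 2 := by
  obtain ⟨M, hM, hbd⟩ := hu.exists_abs_le t (y - L) (y + L)
  obtain ⟨K, hK0, hKL, hKM⟩ : ∃ K : ℝ, 0 < K ∧ K < L ∧ M * (L ^ 2 - K ^ 2) ^ 2 ≤ 25 * L ^ 2 := by
    have hc : Tendsto (fun K : ℝ => M * (L ^ 2 - K ^ 2) ^ 2) (nhdsWithin L (Iio L)) (nhds 0) := by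
      have : Continuous fun K : ℝ => M * (L ^ 2 - K ^ 2) ^ 2 := by fun_prop
      simpa using (this.tendsto L).mono_left nhdsWithin_le_nhds
    have h1 := hc.eventually (gt_mem_nhds (show (0 : ℝ) < 25 * L ^ 2 by positivity))
    obtain ⟨K, h2, h3⟩ := (h1.and (Ioo_mem_nhdsLT hL)).exists
    exact ⟨K, h3.1, h3.2, h2.le⟩
  have hd : ∀ x ∈ Icc (y - K) (y + K), 0 < L ^ 2 - (x - y) ^ 2 := fun x hx => by
    nlinarith [hx.1, hx.2]
  have hKL2 : 0 < L ^ 2 - K ^ 2 := by nlinarith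
  have hbdry : M ≤ 25 * L ^ 2 / (L ^ 2 - K ^ 2) ^ 2 := by
    rw [le_div_iff₀ (by positivity)]; exact hKM
  have key := parabolic_maximum_principle (a := y - K) (b := y + K) (T := t) (Λ := 0)
    (z := fun s x => u s x - 25 * L ^ 2 / (L ^ 2 - (x - y) ^ 2) ^ 2) ?_ ?_ ?_ ?_ ?_
    t ⟨ht, le_rfl⟩ y ⟨by linarith, by linarith⟩
  · have : 25 * L ^ 2 / (L ^ 2 - (y - y) ^ 2) ^ 2 = 25 / L ^ 2 := by
      simp only [sub_self]; field_simp; ring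
    linarith
  · refine (hu.continuousOn_Icc _ _ _).sub (ContinuousOn.div (by fun_prop) (by fun_prop) ?_)
    rintro ⟨s, x⟩ ⟨-, hx⟩
    exact pow_ne_zero _ (hd x hx).ne'
  · intro x hx
    have : 0 ≤ 25 * L ^ 2 / (L ^ 2 - (x - y) ^ 2) ^ 2 := by positivity
    linarith [h0 x]
  · intro s hs
    have := (abs_le.1 (hbd s hs (y - K) ⟨by linarith, by linarith⟩)).2
    rw [show (y - K - y) ^ 2 = K ^ 2 by ring]
    linarith
  · intro s hs
    have := (abs_le.1 (hbd s hs (y + K) ⟨by linarith, by linarith⟩)).2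
    rw [show (y + K - y) ^ 2 = K ^ 2 by ring]
    linarith
  · intro s hs x hx hz
    have hdx := hd x ⟨hx.1.le, hx.2.le⟩
    have hB : ∀ x' : ℝ, 0 < L ^ 2 - (x' - y) ^ 2 →
        HasDerivAt (fun x => 25 * L ^ 2 / (L ^ 2 - (x - y) ^ 2) ^ 2)
          (100 * L ^ 2 * (x' - y) / (L ^ 2 - (x' - y) ^ 2) ^ 3) x' := by
      intro x' hx'
      have h1 : HasDerivAt (fun x : ℝ => (L ^ 2 - (x - y) ^ 2) ^ 2) _ x' :=
        ((((hasDerivAt_id x').sub_const y).fun_pow 2).const_sub (L ^ 2)).fun_pow 2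
      refine ((hasDerivAt_const x' (25 * L ^ 2)).fun_div h1
        (pow_ne_zero 2 hx'.ne')).congr_deriv ?_
      simp only [id_eq]
      field_simp
      ring
    have hB' : HasDerivAt (fun x => 100 * L ^ 2 * (x - y) / (L ^ 2 - (x - y) ^ 2) ^ 3)
        (100 * L ^ 2 * (L ^ 2 + 5 * (x - y) ^ 2) / (L ^ 2 - (x - y) ^ 2) ^ 4) x := by
      have h1 : HasDerivAt (fun x : ℝ => (L ^ 2 - (x - y) ^ 2) ^ 3) _ x :=
        ((((hasDerivAt_id x).sub_const y).fun_pow 2).const_sub (L ^ 2)).fun_pow 3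
      refine ((((hasDerivAt_id x).sub_const y).const_mul (100 * L ^ 2)).fun_div h1
        (pow_ne_zero 3 hdx.ne')).congr_deriv ?_
      simp only [id_eq]
      field_simp
      ring
    refine ⟨_, _, fun x => deriv (u s) x - 100 * L ^ 2 * (x - y) / (L ^ 2 - (x - y) ^ 2) ^ 3,
      (hu.hasDerivAt x s hs.1).sub_const _, ?_, (hu.hasDerivAt_deriv_space hs.1 x).sub hB', ?_⟩
    · have : ∀ᶠ x' in nhds x, 0 < L ^ 2 - (x' - y) ^ 2 :=
        (show Continuous fun x' : ℝ => L ^ 2 - (x' - y) ^ 2 by fun_prop).continuousAt.eventually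
          (lt_mem_nhds hdx)
      filter_upwards [this] with x' hx'
      exact (hu.hasDerivAt_space hs.1 x').sub (hB x' hx')
    · set D := L ^ 2 - (x - y) ^ 2 with hD
      have hBpos : 0 < 25 * L ^ 2 / D ^ 2 := by positivity
      have hup : 25 * L ^ 2 / D ^ 2 < u s x := by linarith
      have h1 : (25 * L ^ 2 / D ^ 2) ^ 2 < u s x ^ 2 := by gcongr
      have h2 : 100 * L ^ 2 * (L ^ 2 + 5 * (x - y) ^ 2) / D ^ 4 ≤ (25 * L ^ 2 / D ^ 2) ^ 2 := by
        rw [div_pow, ← pow_mul]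
        gcongr
        nlinarith [sq_nonneg L]
      have h3 : 0 < 2 * f x * u s x := mul_pos (by linarith [hf x]) (hBpos.trans hup)
      linarith

lemma nonpos (hu : IsClassicalSolution f u) (hf : ∀ x, 0 < f x) (h0 : ∀ x, u 0 x ≤ 0)
    {t : ℝ} (ht : 0 ≤ t) (y : ℝ) : u t y ≤ 0 := by
  have h1 : Tendsto (fun L : ℝ => 25 / L ^ 2) atTop (nhds 0) :=
    tendsto_const_nhds.div_atTop (tendsto_pow_atTop (by norm_num))
  refine ge_of_tendsto h1 ?_
  filter_upwards [eventually_gt_atTop 0] with L hL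
  exact hu.le_barrier hf h0 hL ht y

end IsClassicalSolution

/-- The differential inequality that makes `16 / (T - t + (x - x₀)²) - 16 / ρ` a subsolution
where it is positive. -/
lemma blowup_profile_subsolution {s τ ρ φ X : ℝ} (hτ : 0 < τ) (hτρ : 8 * τ ≤ ρ)
    (hs : s = τ + X ^ 2) (hsρ : s < ρ) (hφ : 2 * φ * ρ ≤ 1) :
    16 / s ^ 2 ≤ (-32 / s ^ 2 + 128 * X ^ 2 / s ^ 3) + (16 / s - 16 / ρ) ^ 2
      - 2 * φ * (16 / s - 16 / ρ) := by
  have hsτ : τ ≤ s := by nlinarith [sq_nonneg X]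
  have hs0 : 0 < s := by linarith
  have hρ : 0 < ρ := by linarith
  have hX : X ^ 2 = s - τ := by linarith
  have hφ' : 2 * φ * ρ * (s ^ 2 * (ρ - s)) ≤ 1 * (s ^ 2 * (ρ - s)) :=
    mul_le_mul_of_nonneg_right hφ (mul_nonneg (sq_nonneg s) (by linarith))
  have main : 0 ≤ 5 * s * ρ ^ 2 - 8 * τ * ρ ^ 2 + 16 * s * (ρ - s) ^ 2 - s ^ 2 * (ρ - s) := by
    have h4 : s * (ρ - s) ≤ ρ ^ 2 / 4 := by nlinarith [sq_nonneg (ρ - 2 * s)]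
    have h5 : s ^ 2 * (ρ - s) ≤ s * (ρ ^ 2 / 4) := by nlinarith
    rcases le_total (2 * s) ρ with h | h
    · have h1 : ρ ^ 2 ≤ 4 * (ρ - s) ^ 2 := by nlinarith
      have h2 : s * ρ ^ 2 ≤ s * (4 * (ρ - s) ^ 2) := by gcongr
      have h3 : τ * ρ ^ 2 ≤ s * ρ ^ 2 := by gcongr
      nlinarith [mul_pos hs0 (pow_pos hρ 2)]
    · have h1 : 8 * τ * ρ ^ 2 ≤ 2 * s * ρ ^ 2 := by exact mul_le_mul_of_nonneg_right (by linarith) (by positivity)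
      have h2 : 0 ≤ 16 * s * (ρ - s) ^ 2 := by positivity
      nlinarith [mul_pos hs0 (pow_pos hρ 2)]
  rw [hX, ← sub_nonneg]
  have : (-32 / s ^ 2 + 128 * (s - τ) / s ^ 3) + (16 / s - 16 / ρ) ^ 2
      - 2 * φ * (16 / s - 16 / ρ) - 16 / s ^ 2
      = 16 * (5 * s * ρ ^ 2 - 8 * τ * ρ ^ 2 + 16 * s * (ρ - s) ^ 2
          - 2 * φ * ρ * (s ^ 2 * (ρ - s))) / (s ^ 3 * ρ ^ 2) := by
    field_simp
    ring
  rw [this]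
  refine div_nonneg ?_ (by positivity)
  linarith

/-- No global solution starts below a sufficiently high plateau located where `f` is small. -/
lemma IsClassicalSolution.false_of_le_plateau {f : ℝ → ℝ} {u : ℝ → ℝ → ℝ}
    (hu : IsClassicalSolution f u) (hf : ∀ x, 0 < f x) {R x₀ : ℝ} (hR : 0 < R)
    (hsmall : ∀ x ∈ Icc (x₀ - R) (x₀ + R), 2 * f x * R ^ 2 ≤ 1) (h0 : ∀ x, u 0 x ≤ 0)
    (hplateau : ∀ x ∈ Icc (x₀ - R) (x₀ + R), u 0 x ≤ -(112 / R ^ 2)) : False := by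
  have hcmp : ∀ t₁ : ℝ, 0 ≤ t₁ → t₁ < R ^ 2 / 8 →
      16 / (R ^ 2 / 8 - t₁) - 16 / R ^ 2 + u t₁ x₀ ≤ 0 := by
    intro t₁ ht₁ htT
    have hτ1 : 0 < R ^ 2 / 8 - t₁ := by linarith
    have hsp : ∀ t ≤ t₁, ∀ x : ℝ, 0 < R ^ 2 / 8 - t + (x - x₀) ^ 2 := fun t ht x => by
      nlinarith [sq_nonneg (x - x₀)]
    have key := parabolic_maximum_principle (a := x₀ - R) (b := x₀ + R) (T := t₁)
      (Λ := 2 * (16 / (R ^ 2 / 8 - t₁)))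
      (z := fun t x => (16 / (R ^ 2 / 8 - t + (x - x₀) ^ 2) - 16 / R ^ 2) + u t x) ?_ ?_ ?_ ?_ ?_
      t₁ ⟨ht₁, le_rfl⟩ x₀ ⟨by linarith, by linarith⟩
    · simpa using key
    · refine ((ContinuousOn.div (by fun_prop) (by fun_prop) ?_).sub (by fun_prop)).add
        (hu.continuousOn_Icc _ _ _)
      rintro ⟨s, x⟩ ⟨hs, -⟩
      exact (hsp s hs.2 x).ne'
    · intro x hx
      have h1 : 16 / (R ^ 2 / 8 - 0 + (x - x₀) ^ 2) ≤ 16 / (R ^ 2 / 8) := by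
        gcongr
        nlinarith [sq_nonneg (x - x₀)]
      have h2 : 16 / (R ^ 2 / 8) - 16 / R ^ 2 = 112 / R ^ 2 := by field_simp; norm_num
      linarith [hplateau x hx]
    · intro t ht
      have h1 : 16 / (R ^ 2 / 8 - t + (x₀ - R - x₀) ^ 2) ≤ 16 / R ^ 2 := by
        gcongr
        nlinarith [ht.2]
      linarith [hu.nonpos hf h0 ht.1 (x₀ - R)]
    · intro t ht
      have h1 : 16 / (R ^ 2 / 8 - t + (x₀ + R - x₀) ^ 2) ≤ 16 / R ^ 2 := by
        gcongr
        nlinarith [ht.2]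
      linarith [hu.nonpos hf h0 ht.1 (x₀ + R)]
    · intro t ht x hx hz
      have hs := hsp t ht.2
      have hwt : HasDerivAt (fun t' => 16 / (R ^ 2 / 8 - t' + (x - x₀) ^ 2) - 16 / R ^ 2)
          (16 / (R ^ 2 / 8 - t + (x - x₀) ^ 2) ^ 2) t := by
        have h1 : HasDerivAt (fun t' : ℝ => R ^ 2 / 8 - t' + (x - x₀) ^ 2) _ t :=
          ((hasDerivAt_id t).const_sub (R ^ 2 / 8)).add_const _
        refine (((hasDerivAt_const t (16 : ℝ)).fun_div h1 (hs x).ne').sub_const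
          (16 / R ^ 2)).congr_deriv ?_
        simp
      have hS : ∀ x' : ℝ, HasDerivAt (fun x : ℝ => R ^ 2 / 8 - t + (x - x₀) ^ 2)
          (2 * (x' - x₀)) x' := fun x' => by
        simpa using (((hasDerivAt_id x').sub_const x₀).pow 2).const_add (R ^ 2 / 8 - t)
      have hwx : ∀ x' : ℝ,
          HasDerivAt (fun x => 16 / (R ^ 2 / 8 - t + (x - x₀) ^ 2) - 16 / R ^ 2)
            (-32 * (x' - x₀) / (R ^ 2 / 8 - t + (x' - x₀) ^ 2) ^ 2) x' := fun x' => by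
        refine (((hasDerivAt_const x' (16 : ℝ)).fun_div (hS x') (hs x').ne').sub_const
          (16 / R ^ 2)).congr_deriv ?_
        ring
      have hwxx : HasDerivAt (fun x => -32 * (x - x₀) / (R ^ 2 / 8 - t + (x - x₀) ^ 2) ^ 2)
          (-32 / (R ^ 2 / 8 - t + (x - x₀) ^ 2) ^ 2
            + 128 * (x - x₀) ^ 2 / (R ^ 2 / 8 - t + (x - x₀) ^ 2) ^ 3) x := by
        have hsx := hs x
        refine ((((hasDerivAt_id x).sub_const x₀).const_mul (-32)).fun_div ((hS x).fun_pow 2)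
          (pow_ne_zero 2 hsx.ne')).congr_deriv ?_
        simp only [id_eq]
        generalize R ^ 2 / 8 - t + (x - x₀) ^ 2 = S at hsx ⊢
        field_simp
        ring
      refine ⟨_, _, fun x => -32 * (x - x₀) / (R ^ 2 / 8 - t + (x - x₀) ^ 2) ^ 2 + deriv (u t) x,
        hwt.add (hu.hasDerivAt x t ht.1),
        Eventually.of_forall fun x' => (hwx x').add (hu.hasDerivAt_space ht.1 x'),
        hwxx.add (hu.hasDerivAt_deriv_space ht.1 x), ?_⟩
      have hu0 := hu.nonpos hf h0 ht.1.le x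
      have hw0 : 0 < 16 / (R ^ 2 / 8 - t + (x - x₀) ^ 2) - 16 / R ^ 2 := by linarith
      have hsρ : R ^ 2 / 8 - t + (x - x₀) ^ 2 < R ^ 2 := by
        by_contra! h
        have : 16 / (R ^ 2 / 8 - t + (x - x₀) ^ 2) ≤ 16 / R ^ 2 := by gcongr
        linarith
      have hsub := blowup_profile_subsolution (s := R ^ 2 / 8 - t + (x - x₀) ^ 2)
        (by linarith [ht.2]) (by linarith [ht.1]) rfl hsρ (hsmall x ⟨hx.1.le, hx.2.le⟩)
      have hwM : 16 / (R ^ 2 / 8 - t + (x - x₀) ^ 2) ≤ 16 / (R ^ 2 / 8 - t₁) := by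
        gcongr
        nlinarith [sq_nonneg (x - x₀), ht.2]
      have hRp : 0 < 16 / R ^ 2 := by positivity
      have hwM' : 16 / (R ^ 2 / 8 - t + (x - x₀) ^ 2) - 16 / R ^ 2 < 16 / (R ^ 2 / 8 - t₁) := by
        linarith
      set w := 16 / (R ^ 2 / 8 - t + (x - x₀) ^ 2) - 16 / R ^ 2
      set M := 16 / (R ^ 2 / 8 - t₁)
      have h1 : 0 < (2 * M - (w - u t x)) * (w + u t x) := mul_pos (by linarith) hz
      have h2 : 0 < f x * (w + u t x) := mul_pos (hf x) hz
      nlinarith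
  obtain ⟨M, hM, hbd⟩ := hu.exists_abs_le (R ^ 2 / 8) x₀ x₀
  set K := M + 16 / R ^ 2 + 128 / R ^ 2 with hK
  have hR2 : 0 < R ^ 2 := by positivity
  have hKp : 0 < K := by positivity
  have hKR : 16 / K ≤ R ^ 2 / 8 := by
    rw [div_le_div_iff₀ hKp (by norm_num)]
    have : R ^ 2 * (128 / R ^ 2) = 128 := by field_simp
    have h3 : 0 < R ^ 2 * (M + 16 / R ^ 2) := by positivity
    rw [hK]
    nlinarith
  have hp : 0 < 16 / K := by positivity
  have h1 := hcmp (R ^ 2 / 8 - 16 / K) (by linarith) (by linarith)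
  have h2 := (abs_le.1 (hbd (R ^ 2 / 8 - 16 / K) ⟨by linarith, by linarith⟩ x₀
    ⟨le_rfl, le_rfl⟩)).1
  rw [sub_sub_cancel, div_div_cancel₀ (by norm_num)] at h1
  have : 0 < 128 / R ^ 2 := by positivity
  linarith

/-- instability of the zero equilibrium of
`∂u/∂t = ∂²u/∂x² − 2 f(x) u − u²`.  There is `ε₀ > 0` such that for every `0 < ε < ε₀`
there is a smooth initial datum `h` with all `L^p` norms (`1 ≤ p < ∞`) and sup norm
smaller than `ε`, for which no classical global solution exists. -/
theorem stmt18 (f : ℝ → ℝ)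
    (hf : ContDiff ℝ (⊤ : ℕ∞) f) (hfpos : ∀ x : ℝ, 0 < f x)
    (hftop : Tendsto f atTop (nhds 0)) (hfbot : Tendsto f atBot (nhds 0))
    (hfderiv : ∃ C : ℝ, ∀ x : ℝ, |deriv f x| ≤ C ∧ |deriv (deriv f) x| ≤ C) :
    ∃ ε₀ : ℝ, 0 < ε₀ ∧ ∀ ε : ℝ, 0 < ε → ε < ε₀ →
      ∃ h : ℝ → ℝ, ContDiff ℝ (⊤ : ℕ∞) h ∧
        (∀ p : ℝ, 1 ≤ p → eLpNorm h (ENNReal.ofReal p) volume < ENNReal.ofReal ε) ∧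
        (⨆ x : ℝ, |h x|) < ε ∧
        ¬ ∃ u : ℝ → ℝ → ℝ,
          -- continuity on `[0,∞) × ℝ`
          ContinuousOn (fun q : ℝ × ℝ => u q.1 q.2) (Ici 0 ×ˢ univ) ∧
          -- twice continuously differentiable in `x` for `t > 0`
          (∀ t : ℝ, 0 < t → ContDiff ℝ 2 (u t)) ∧
          -- differentiable in `t` and solving the PDE for `t > 0`
          (∀ x : ℝ, ∀ t : ℝ, 0 < t →
            HasDerivAt (fun s : ℝ => u s x)
              (deriv (deriv (u t)) x - 2 * f x * u t x - (u t x) ^ 2) t) ∧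
          -- initial condition
          (∀ x : ℝ, u 0 x = h x) ∧
          -- boundedness at each time
          (∀ t : ℝ, 0 ≤ t → ∃ C : ℝ, ∀ x : ℝ, |u t x| ≤ C) := by
  refine ⟨1, one_pos, fun ε hε _ => ?_⟩
  obtain ⟨R, hR1, hRε⟩ : ∃ R : ℝ, 1 ≤ R ∧ 448 / R < ε := by
    refine ⟨1 + 448 / ε, by linarith [show 0 < 448 / ε by positivity], ?_⟩
    rw [div_lt_iff₀ (by positivity), mul_add, mul_div_cancel₀ _ hε.ne']
    linarith
  have hR : 0 < R := by linarith
  obtain ⟨x₀, hx₀⟩ : ∃ x₀ : ℝ, ∀ x ∈ Icc (x₀ - R) (x₀ + R), 2 * f x * R ^ 2 ≤ 1 := by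
    have h1 := hftop.eventually (gt_mem_nhds (show (0 : ℝ) < 1 / (2 * R ^ 2) by positivity))
    obtain ⟨N, hN⟩ := eventually_atTop.1 h1
    refine ⟨N + R, fun x hx => ?_⟩
    have := hN x (by linarith [hx.1])
    rw [lt_div_iff₀ (by positivity)] at this
    linarith
  have hM : 0 < 112 / R ^ 2 := by positivity
  have hMε : 112 / R ^ 2 < ε := by
    refine lt_of_le_of_lt ?_ hRε
    rw [div_le_div_iff₀ (by positivity) hR]
    nlinarith
  let B : ContDiffBump x₀ := ⟨R, 2 * R, hR, by linarith⟩
  have habs : ∀ x, |-(112 / R ^ 2) * B x| ≤ 112 / R ^ 2 := fun x => by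
    rw [abs_mul, abs_neg, abs_of_pos hM, abs_of_nonneg B.nonneg]
    exact mul_le_of_le_one_right hM.le B.le_one
  refine ⟨fun x => -(112 / R ^ 2) * B x, contDiff_const.mul B.contDiff, fun p hp => ?_,
    (ciSup_le habs).trans_lt hMε, ?_⟩
  · have hle : eLpNorm (fun x => -(112 / R ^ 2) * B x) (ENNReal.ofReal p) volume ≤
        eLpNorm ((Metric.closedBall x₀ (2 * R)).indicator fun _ => 112 / R ^ 2)
          (ENNReal.ofReal p) volume := by
      refine eLpNorm_mono fun x => ?_
      by_cases hx : x ∈ Metric.closedBall x₀ (2 * R)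
      · rw [indicator_of_mem hx, Real.norm_eq_abs, Real.norm_eq_abs, abs_of_pos hM]
        exact habs x
      · have : B x = 0 := B.zero_of_le_dist (not_le.1 hx).le
        simp [this]
    refine hle.trans_lt ?_
    have hp0 : 0 < p := by linarith
    rw [eLpNorm_indicator_const Metric.isClosed_closedBall.measurableSet
      (by simpa using hp0) ENNReal.ofReal_ne_top, Real.volume_closedBall,
      ENNReal.toReal_ofReal hp0.le, Real.enorm_eq_ofReal hM.le]
    have hpow : ENNReal.ofReal (2 * (2 * R)) ^ (1 / p) ≤ ENNReal.ofReal (2 * (2 * R)) := by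
      conv_rhs => rw [← ENNReal.rpow_one (ENNReal.ofReal (2 * (2 * R)))]
      refine ENNReal.rpow_le_rpow_of_exponent_le ?_ ?_
      · rw [ENNReal.one_le_ofReal]; linarith
      · rw [div_le_one hp0]; exact hp
    calc _ ≤ ENNReal.ofReal (112 / R ^ 2) * ENNReal.ofReal (2 * (2 * R)) := by gcongr
      _ = ENNReal.ofReal (448 / R) := by
        rw [← ENNReal.ofReal_mul hM.le]
        congr 1
        field_simp
        norm_num
      _ < ENNReal.ofReal ε := (ENNReal.ofReal_lt_ofReal_iff hε).2 hRε
  · rintro ⟨u, hcont, hC2, hpde, hinit, -⟩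
    have hu : IsClassicalSolution f u := ⟨hcont, hC2, hpde⟩
    refine hu.false_of_le_plateau hfpos hR hx₀ (fun x => ?_) (fun x hx => ?_)
    · rw [hinit]
      exact mul_nonpos_of_nonpos_of_nonneg (by linarith) B.nonneg
    · have : B x = 1 := B.one_of_mem_closedBall
        (by rw [Real.closedBall_eq_Icc]; exact hx)
      simp [hinit, this]
end
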